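/- Let ℚ̄ be an algebraic closure of ℚ, let d ≥ 1, let f ∈ ℚ̄[x, x₁, …, x_d] be a polynomial, and let μ, μ₁, …, μ_d ∈ ℚ̄ˣ with μ not a root of unity (i.e., μ^k ≠ 1 for every nonzero integer k). Assume that the cyclic subgroup ⟨μ⟩ of ℚ̄ˣ intersects the subgroup ⟨μ₁, …, μ_d⟩ generated by μ₁, …, μ_d trivially. Then the set M of integers m ∈ ℤ for which there exist a₁, …, a_d ∈ ℤ such that f(μ^m, μ₁^{a₁}, …, μ_d^{a_d}) = 0 and such that the one-variable polynomial f(x, μ₁^{a₁}, …, μ_d^{a_d}) ∈ ℚ̄[x] (obtained by substituting μ_i^{a_i} for x_i and leaving x as a variable) is non-constant, is a finite set. -/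

import Mathlib

set_option linter.all false
noncomputable section
open Finset
namespace Sub
variable {R : Type*} [CommRing R] {σ : Type*}

/-- weighted L1 norm -/
def wn (v : AbsoluteValue R ℝ) (r : σ → ℝ) (P : MvPolynomial σ R) : ℝ :=
  ∑ m ∈ P.support, v (P.coeff m) * m.prod (fun j e => r j ^ e)

section wn
variable (v : AbsoluteValue R ℝ) {r : σ → ℝ} (hr : ∀ j, 0 ≤ r j)
include hr

lemma mpr_nonneg (m : σ →₀ ℕ) : 0 ≤ m.prod (fun j e => r j ^ e) :=
  Finset.prod_nonneg fun j _ => pow_nonneg (hr j) _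

lemma wn_nonneg (P : MvPolynomial σ R) : 0 ≤ wn v r P :=
  Finset.sum_nonneg fun m _ => mul_nonneg (v.nonneg _) (mpr_nonneg hr m)

omit hr in
lemma wn_eq_sum {P : MvPolynomial σ R} {s : Finset (σ →₀ ℕ)} (h : P.support ⊆ s) :
    wn v r P = ∑ m ∈ s, v (P.coeff m) * m.prod (fun j e => r j ^ e) := by
  refine Finset.sum_subset h fun m _ hm => ?_
  rw [MvPolynomial.notMem_support_iff.1 hm]; simp

lemma coeff_le_wn (P : MvPolynomial σ R) (m) :
    v (P.coeff m) * m.prod (fun j e => r j ^ e) ≤ wn v r P := by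
  classical
  rw [wn_eq_sum v (s := insert m P.support) (Finset.subset_insert _ _)]
  exact Finset.single_le_sum (f := fun m => v (P.coeff m) * m.prod (fun j e => r j ^ e))
    (fun m _ => mul_nonneg (v.nonneg _) (mpr_nonneg hr m)) (Finset.mem_insert_self _ _)

lemma wn_add (P Q : MvPolynomial σ R) : wn v r (P + Q) ≤ wn v r P + wn v r Q := by
  classical
  rw [wn_eq_sum v (s := P.support ∪ Q.support) MvPolynomial.support_add,
    wn_eq_sum v (P := P) (s := P.support ∪ Q.support) Finset.subset_union_left,
    wn_eq_sum v (P := Q) (s := P.support ∪ Q.support) Finset.subset_union_right, ← Finset.sum_add_distrib]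
  refine Finset.sum_le_sum fun m _ => ?_
  rw [MvPolynomial.coeff_add, ← add_mul]
  exact mul_le_mul_of_nonneg_right (v.add_le _ _) (mpr_nonneg hr m)

omit hr in
lemma wn_zero : wn v r 0 = 0 := by simp [wn]

lemma wn_sum {ι : Type*} (s : Finset ι) (f : ι → MvPolynomial σ R) :
    wn v r (∑ i ∈ s, f i) ≤ ∑ i ∈ s, wn v r (f i) := by
  classical
  induction s using Finset.induction_on with
  | empty => simp [wn_zero]
  | insert a s ha ih =>
    rw [Finset.sum_insert ha, Finset.sum_insert ha]
    exact (wn_add v hr _ _).trans (by linarith)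

omit hr in
lemma wn_monomial (m : σ →₀ ℕ) (a : R) :
    wn v r (MvPolynomial.monomial m a) = v a * m.prod (fun j e => r j ^ e) := by
  classical
  rw [wn_eq_sum v (s := {m}) MvPolynomial.support_monomial_subset]; simp

omit hr in
lemma wn_C (a : R) : wn v r (MvPolynomial.C a) = v a := by
  rw [MvPolynomial.C_apply, wn_monomial]; simp

omit hr in
lemma wn_X [IsDomain R] (j : σ) : wn v r (MvPolynomial.X j : MvPolynomial σ R) = r j := by
  rw [MvPolynomial.X, wn_monomial]; simp

lemma wn_monomial_mul (m : σ →₀ ℕ) (a : R) (Q : MvPolynomial σ R) :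
    wn v r (MvPolynomial.monomial m a * Q) ≤ v a * m.prod (fun j e => r j ^ e) * wn v r Q := by
  classical
  conv_lhs => rw [Q.as_sum, Finset.mul_sum]
  refine (wn_sum v hr _ _).trans (le_of_eq ?_)
  rw [wn, Finset.mul_sum]
  refine Finset.sum_congr rfl fun n _ => ?_
  rw [MvPolynomial.monomial_mul, wn_monomial, map_mul,
    Finsupp.prod_add_index' (by simp) (by intros; rw [pow_add])]
  ring

lemma wn_mul (P Q : MvPolynomial σ R) : wn v r (P * Q) ≤ wn v r P * wn v r Q := by
  classical
  conv_lhs => rw [P.as_sum, Finset.sum_mul]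
  refine (wn_sum v hr _ _).trans ?_
  conv_rhs => rw [wn, Finset.sum_mul]
  exact Finset.sum_le_sum fun n _ => wn_monomial_mul v hr _ _ _

lemma wn_pow [IsDomain R] (P : MvPolynomial σ R) (n : ℕ) : wn v r (P ^ n) ≤ wn v r P ^ n := by
  induction n with
  | zero => rw [pow_zero, pow_zero, ← MvPolynomial.C_1, wn_C]; simp
  | succ n ih =>
    rw [pow_succ, pow_succ]
    exact (wn_mul v hr _ _).trans (mul_le_mul_of_nonneg_right ih (wn_nonneg v hr _))

lemma wn_prod [IsDomain R] {ι : Type*} (s : Finset ι) (f : ι → MvPolynomial σ R) :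
    wn v r (∏ i ∈ s, f i) ≤ ∏ i ∈ s, wn v r (f i) := by
  classical
  induction s using Finset.induction_on with
  | empty => rw [prod_empty, prod_empty, ← MvPolynomial.C_1, wn_C]; simp
  | insert a s ha ih =>
    rw [Finset.prod_insert ha, Finset.prod_insert ha]
    exact (wn_mul v hr _ _).trans (mul_le_mul_of_nonneg_left ih (wn_nonneg v hr _))

/-- substitution bound -/
lemma wn_bind [IsDomain R] {τ : Type*} {r' : τ → ℝ} (hr' : ∀ j, 0 ≤ r' j)
    (φ : τ → MvPolynomial σ R) (hφ : ∀ j, wn v r (φ j) ≤ r' j) (P : MvPolynomial τ R) :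
    wn v r (MvPolynomial.bind₁ φ P) ≤ wn v r' P := by
  classical
  conv_lhs => rw [P.as_sum, map_sum]
  refine (wn_sum v hr _ _).trans (Finset.sum_le_sum fun m _ => ?_)
  rw [MvPolynomial.bind₁_monomial]
  refine (wn_mul v hr _ _).trans ?_
  rw [wn_C]
  refine mul_le_mul_of_nonneg_left ((wn_prod v hr _ _).trans ?_) (v.nonneg _)
  refine Finset.prod_le_prod (fun _ _ => wn_nonneg v hr _) fun j _ => (wn_pow v hr _ _).trans ?_
  exact pow_le_pow_left₀ (wn_nonneg v hr _) (hφ j) _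

lemma wn_det [IsDomain R] {n : ℕ} (M : Matrix (Fin n) (Fin n) (MvPolynomial σ R)) (B : ℝ)
    (hB : ∀ i j, wn v r (M i j) ≤ B) : wn v r M.det ≤ n.factorial * B ^ n := by
  rw [Matrix.det_apply]
  refine (wn_sum v hr _ _).trans ?_
  calc _ ≤ ∑ _p : Equiv.Perm (Fin n), B ^ n := by
        refine Finset.sum_le_sum fun p _ => ?_
        have h1 : wn v r (Equiv.Perm.sign p • ∏ i, M (p i) i) ≤ wn v r (∏ i, M (p i) i) := by
          rcases Int.units_eq_one_or (Equiv.Perm.sign p) with h | h <;> rw [h]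
          · simp
          · simp [wn, MvPolynomial.support_neg]
        refine h1.trans ((wn_prod v hr _ _).trans ?_)
        calc _ ≤ ∏ _i : Fin n, B := Finset.prod_le_prod (fun _ _ => wn_nonneg v hr _) fun j _ => hB _ _
          _ = B ^ n := by simp
    _ = _ := by simp [Fintype.card_perm]
end wn
end Sub
end

noncomputable section
open Finset
namespace Sub
open MvPolynomial
variable {R : Type*} [CommRing R] {σ : Type*}

def bin (m i : σ →₀ ℕ) : ℕ := i.prod fun j e => (m j).choose e

lemma bin_eq_zero {m i : σ →₀ ℕ} (h : ¬ i ≤ m) : bin m i = 0 := by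
  rw [Finsupp.le_def] at h; push Not at h
  obtain ⟨j, hj⟩ := h
  exact Finset.prod_eq_zero (i := j) (by rw [Finsupp.mem_support_iff]; omega) (Nat.choose_eq_zero_of_lt hj)

lemma bin_pos (m i : σ →₀ ℕ) : 0 < bin (m + i) i :=
  Finset.prod_pos fun j _ => Nat.choose_pos (by simp)

lemma bin_eq_prod [Fintype σ] (m i : σ →₀ ℕ) : bin m i = ∏ j, (m j).choose (i j) := by
  rw [bin, Finsupp.prod_fintype]; simp

/-- Hasse derivative -/
def hs (i : σ →₀ ℕ) (P : MvPolynomial σ R) : MvPolynomial σ R :=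
  ∑ m ∈ P.support, monomial (m - i) (bin m i * coeff m P)

lemma coeff_hs (i n : σ →₀ ℕ) (P : MvPolynomial σ R) :
    coeff n (hs i P) = bin (n + i) i * coeff (n + i) P := by
  classical
  rw [hs, coeff_sum]
  simp only [coeff_monomial]
  rw [Finset.sum_eq_single (n + i)]
  · simp
  · intro m _ hm
    split_ifs with h
    · rw [bin_eq_zero, Nat.cast_zero, zero_mul]
      intro hle; apply hm; rw [← h, tsub_add_cancel_of_le hle]
    · rfl
  · intro h; rw [notMem_support_iff.1 h]; simp

lemma hs_add (i : σ →₀ ℕ) (P Q : MvPolynomial σ R) : hs i (P + Q) = hs i P + hs i Q := by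
  ext n; simp [coeff_hs, mul_add]

lemma hs_C_mul (i : σ →₀ ℕ) (a : R) (P : MvPolynomial σ R) : hs i (C a * P) = C a * hs i P := by
  ext n; simp only [coeff_hs, coeff_C_mul]; ring

lemma hs_zero (P : MvPolynomial σ R) : hs 0 P = P := by
  ext n; simp [coeff_hs, bin]

lemma hs_sum {ι : Type*} (i : σ →₀ ℕ) (s : Finset ι) (f : ι → MvPolynomial σ R) :
    hs i (∑ a ∈ s, f a) = ∑ a ∈ s, hs i (f a) := by
  ext n; simp only [coeff_hs, coeff_sum, Finset.mul_sum]

lemma hs_map {R' : Type*} [CommRing R'] (φ : R →+* R') (i : σ →₀ ℕ) (P : MvPolynomial σ R) :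
    hs i (map φ P) = map φ (hs i P) := by
  ext n; simp [coeff_hs, coeff_map]

/-- shift -/
def sh (α : σ → R) : MvPolynomial σ R →ₐ[R] MvPolynomial σ R := aeval fun j => X j + C (α j)

lemma bin_pascal [Fintype σ] (m n : σ →₀ ℕ) (j : σ) (h : n j ≠ 0) :
    bin (m + Finsupp.single j 1) n = bin m n + bin m (n - Finsupp.single j 1) := by
  classical
  simp only [bin_eq_prod]
  rw [← Finset.mul_prod_erase univ _ (Finset.mem_univ j), ← Finset.mul_prod_erase univ (fun x => (m x).choose (n x)) (Finset.mem_univ j),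
    ← Finset.mul_prod_erase univ (fun x => (m x).choose ((n - Finsupp.single j 1 : σ →₀ ℕ) x)) (Finset.mem_univ j)]
  have e1 : ∏ x ∈ univ.erase j, ((m + Finsupp.single j 1 : σ →₀ ℕ) x).choose (n x) = ∏ x ∈ univ.erase j, (m x).choose (n x) := by
    refine Finset.prod_congr rfl fun x hx => ?_
    simp [Finsupp.single_apply, (Finset.ne_of_mem_erase hx).symm]
  have e2 : ∏ x ∈ univ.erase j, (m x).choose ((n - Finsupp.single j 1 : σ →₀ ℕ) x) = ∏ x ∈ univ.erase j, (m x).choose (n x) := by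
    refine Finset.prod_congr rfl fun x hx => ?_
    simp [Finsupp.single_apply, (Finset.ne_of_mem_erase hx).symm]
  rw [e1, e2, ← add_mul]
  congr 1
  obtain ⟨t, ht⟩ := Nat.exists_eq_succ_of_ne_zero h
  simp [ht, Nat.choose_succ_succ]; ring

lemma hs_mul_X [Fintype σ] (n : σ →₀ ℕ) (j : σ) (P : MvPolynomial σ R) :
    hs n (P * X j) = hs n P * X j + if n j = 0 then 0 else hs (n - Finsupp.single j 1) P := by
  classical
  ext m
  rw [coeff_hs, coeff_add, coeff_mul_X', coeff_mul_X']
  by_cases hn : n j = 0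
  · simp only [hn, if_true, coeff_zero, add_zero, Finsupp.mem_support_iff, Finsupp.add_apply]
    by_cases hm : m j = 0
    · simp [hm]
    · simp only [ne_eq, hm, not_false_eq_true, if_true]
      rw [coeff_hs]
      have : m + n - Finsupp.single j 1 = m - Finsupp.single j 1 + n := by
        ext x; by_cases hx : j = x
        · subst hx; simp [hn]
        · simp [Finsupp.single_apply, hx]
      rw [this]
      congr 2
      simp only [bin_eq_prod]
      refine Finset.prod_congr rfl fun x _ => ?_
      by_cases hx : j = x
      · subst hx; simp [hn]
      · simp [Finsupp.single_apply, hx]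
  · simp only [hn, if_false, Finsupp.mem_support_iff, Finsupp.add_apply]
    have h0 : m j + n j ≠ 0 := by omega
    simp only [ne_eq, h0, not_false_eq_true, if_true, coeff_hs]
    have e1 : m + n - Finsupp.single j 1 = m + (n - Finsupp.single j 1) := by
      ext x; by_cases hx : j = x
      · subst hx; simp; omega
      · simp [Finsupp.single_apply, hx]
    have e2 : m + n = m + (n - Finsupp.single j 1) + Finsupp.single j 1 := by
      ext x; by_cases hx : j = x
      · subst hx; simp; omega
      · simp [Finsupp.single_apply, hx]
    rw [e1]
    conv_lhs => rw [e2]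
    rw [bin_pascal _ _ _ hn]
    by_cases hm : m j = 0
    · simp only [hm, not_true_eq_false, if_false, zero_add]
      rw [bin_eq_zero (i := n), zero_add]
      intro hle; have := hle j; simp [hm] at this; omega
    · simp only [hm, not_false_eq_true, if_true]
      have e3 : m - Finsupp.single j 1 + n = m + (n - Finsupp.single j 1) := by
        ext x; by_cases hx : j = x
        · subst hx; simp; omega
        · simp [Finsupp.single_apply, hx]
      rw [e3]; push_cast; ring

lemma taylor [Fintype σ] (α : σ → R) (P : MvPolynomial σ R) :
    ∀ n, coeff n (sh α P) = eval α (hs n P) := by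
  classical
  induction P using MvPolynomial.induction_on with
  | C a =>
    intro n
    by_cases h : n = 0
    · subst h; simp [hs_zero, sh]
    · have : hs n (C a : MvPolynomial σ R) = 0 := by
        ext m; rw [coeff_hs, coeff_C, if_neg]
        · simp
        · intro h'; exact h ((add_eq_zero.1 h'.symm).2)
      rw [this]; simp [sh, coeff_C, Ne.symm h]
  | add p q hp hq => intro n; rw [map_add, coeff_add, hp, hq, hs_add, map_add]
  | mul_X p j ih =>
    intro n
    rw [map_mul, hs_mul_X, map_add, map_mul, eval_X]
    have : sh α (X j : MvPolynomial σ R) = X j + C (α j) := by simp [sh]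
    rw [this, mul_add, coeff_add, coeff_mul_X', mul_comm _ (C _), coeff_C_mul, ih]
    by_cases hn : n j = 0
    · simp [hn, ih, mul_comm]
    · simp [hn, ih, mul_comm, add_comm]

lemma hs_hs [Fintype σ] (n i : σ →₀ ℕ) (P : MvPolynomial σ R) :
    hs n (hs i P) = C (bin (n + i) i : R) * hs (n + i) P := by
  ext m
  rw [coeff_C_mul, coeff_hs, coeff_hs, coeff_hs, ← add_assoc, ← mul_assoc, ← mul_assoc]
  congr 1
  rw [← Nat.cast_mul, ← Nat.cast_mul]; congr 1
  simp only [bin_eq_prod, ← Finset.prod_mul_distrib]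
  refine Finset.prod_congr rfl fun x _ => ?_
  simp only [Finsupp.add_apply]
  have := Nat.choose_mul (n := m x + n x + i x) (k := n x + i x) (s := i x) (by omega)
  rw [mul_comm, mul_comm ((n x + i x).choose _), this]
  congr 2 <;> omega

lemma pderiv_hs [Fintype σ] (i : σ →₀ ℕ) (x : σ) (P : MvPolynomial σ R) :
    pderiv x (hs i P) = C ((i x + 1 : ℕ) : R) * hs (i + Finsupp.single x 1) P := by
  classical
  have h : ∀ Q : MvPolynomial σ R, pderiv x Q = hs (Finsupp.single x 1) Q := by
    intro Q; ext m; rw [coeff_pderiv, coeff_hs]; simp [bin]; ring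
  rw [h, hs_hs, add_comm i]
  congr 2
  have := bin (Finsupp.single x 1 + i) i
  simp only [bin_eq_prod]
  rw [Finset.prod_eq_single x]
  · rw [Finsupp.add_apply, Finsupp.single_eq_same, add_comm 1, Nat.choose_succ_self_right]
  · intro b _ hb; simp [Finsupp.single_apply, Ne.symm hb]
  · simp
end Sub
end

noncomputable section
open Finset
namespace Sub
open MvPolynomial
variable {F : Type*} [Field F] [CharZero F] {k : ℕ}

lemma coeff_X_pderiv (x : Fin k) (c : MvPolynomial (Fin k) F) (m) :
    coeff m (X x * pderiv x c) = m x * coeff m c := by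
  classical
  rw [coeff_X_mul', coeff_pderiv]
  by_cases h : m x = 0
  · simp [h]
  · have : m - Finsupp.single x 1 + Finsupp.single x 1 = m := by
      ext y; by_cases hy : x = y
      · subst hy; simp; omega
      · simp [Finsupp.single_apply, hy]
    rw [if_pos (by simpa using h), this]
    have h2 : (((m - Finsupp.single x 1 : Fin k →₀ ℕ) x : ℕ) : F) + 1 = m x := by
      rw [← Nat.cast_succ]; congr 1; simp; omega
    rw [h2, mul_comm]

lemma propor_deg {e c : MvPolynomial (Fin k) F} (he : e ≠ 0) (hc : c ≠ 0)
    (h : ∀ x, e * pderiv x c = c * pderiv x e) :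
    (MonomialOrder.lex).degree c = (MonomialOrder.lex).degree e := by
  set mo := (MonomialOrder.lex : MonomialOrder (Fin k))
  ext x
  have hd : ∀ p : MvPolynomial (Fin k) F, mo.toSyn (mo.degree (X x * pderiv x p)) ≤ mo.toSyn (mo.degree p) := by
    intro p
    rw [mo.degree_le_iff]
    intro b hb
    apply mo.le_degree
    rw [mem_support_iff] at hb ⊢
    rw [coeff_X_pderiv] at hb
    exact right_ne_zero_of_mul hb
  have h1 := congrArg (fun p => coeff (mo.degree e + mo.degree c) (X x * p)) (h x)
  rw [show X x * (e * pderiv x c) = e * (X x * pderiv x c) by ring,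
    show X x * (c * pderiv x e) = c * (X x * pderiv x e) by ring,
    mo.coeff_mul_of_add_of_degree_le le_rfl (hd c), add_comm,
    mo.coeff_mul_of_add_of_degree_le le_rfl (hd e), coeff_X_pderiv, coeff_X_pderiv] at h1
  have a1 : coeff (mo.degree e) e ≠ 0 := mo.coeff_degree_ne_zero_iff.2 he
  have a2 : coeff (mo.degree c) c ≠ 0 := mo.coeff_degree_ne_zero_iff.2 hc
  have : ((mo.degree c x : ℕ) : F) = mo.degree e x := by
    apply mul_left_cancel₀ (mul_ne_zero a1 a2); linear_combination h1
  exact_mod_cast this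

lemma propor {e c : MvPolynomial (Fin k) F} (he : e ≠ 0)
    (h : ∀ x, e * pderiv x c = c * pderiv x e) : ∃ q : F, c = C q * e := by
  set mo := (MonomialOrder.lex : MonomialOrder (Fin k)) with hmo
  have a1 : coeff (mo.degree e) e ≠ 0 := mo.coeff_degree_ne_zero_iff.2 he
  set q := coeff (mo.degree e) c / coeff (mo.degree e) e with hq
  refine ⟨q, ?_⟩
  by_contra hne
  have hne' : c - C q * e ≠ 0 := sub_ne_zero.2 hne
  have h2 := propor_deg he hne' (fun x => by
    rw [map_sub, pderiv_C_mul, mul_sub, sub_mul, h x]; ring)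
  have h3 : coeff (mo.degree (c - C q * e)) (c - C q * e) ≠ 0 := mo.coeff_degree_ne_zero_iff.2 hne'
  rw [hmo, h2, ← hmo, coeff_sub, coeff_C_mul, hq, div_mul_cancel₀ _ a1, sub_self] at h3
  exact h3 rfl

theorem wronskian (s : ℕ) : ∀ f : Fin s → MvPolynomial (Fin k) F, LinearIndependent F f →
    ∃ i : Fin s → (Fin k →₀ ℕ), (∀ a, (i a).degree ≤ a) ∧
      (Matrix.of fun a r => hs (i a) (f r)).det ≠ 0 := by
  induction s with
  | zero => intro f _; exact ⟨fun a => a.elim0, fun a => a.elim0, by simp⟩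
  | succ s ih =>
    intro f hf
    obtain ⟨i, hi, hU⟩ := ih (f ∘ Fin.castSucc) (hf.comp _ (Fin.castSucc_injective s))
    set c : Fin (s+1) → MvPolynomial (Fin k) F := fun r =>
      (-1) ^ ((Fin.last s : ℕ) + r) * (Matrix.of fun a b => hs (i a) (f (r.succAbove b))).det with hc
    have hdet : ∀ j, (Matrix.of fun a r => hs ((Fin.snoc i j : Fin (s+1) → (Fin k →₀ ℕ)) a) (f r)).det
        = ∑ r, c r * hs j (f r) := by
      intro j
      rw [Matrix.det_succ_row _ (Fin.last s)]
      refine Finset.sum_congr rfl fun r _ => ?_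
      simp only [hc, Matrix.of_apply, Fin.snoc_last]
      have : (Matrix.of fun a r => hs ((Fin.snoc i j : Fin (s+1) → (Fin k →₀ ℕ)) a) (f r)).submatrix
          (Fin.last s).succAbove r.succAbove = Matrix.of fun a b => hs (i a) (f (r.succAbove b)) := by
        ext a b : 2; simp
      rw [this]; ring
    by_contra hcon
    push Not at hcon
    have hrel : ∀ j : Fin k →₀ ℕ, j.degree ≤ s → ∑ r, c r * hs j (f r) = 0 := by
      intro j hj
      rw [← hdet]
      apply hcon
      intro a
      refine Fin.lastCases ?_ (fun a => ?_) a
      · simpa using hj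
      · simpa using hi a
    have hce : c (Fin.last s) ≠ 0 := by
      simp only [hc]
      refine mul_ne_zero (pow_ne_zero _ (by simp)) ?_
      simpa [Fin.succAbove_last] using hU
    have hdrel : ∀ x a, ∑ r, pderiv x (c r) * hs (i a) (f r) = 0 := by
      intro x a
      have h1 := congrArg (pderiv x) (hrel (i a) ((hi a).trans a.2.le))
      rw [map_sum, map_zero] at h1
      simp only [Derivation.leibniz, smul_eq_mul, Finset.sum_add_distrib, pderiv_hs] at h1
      have h2 := hrel (i a + Finsupp.single x 1) (by
        rw [map_add, Finsupp.degree_single]; have := hi a; have := a.2; omega)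
      have h3 : ∑ r, c r * (C ((i a x + 1 : ℕ) : F) * hs (i a + Finsupp.single x 1) (f r)) = 0 := by
        rw [← mul_zero (C ((i a x + 1 : ℕ) : F)), ← h2, Finset.mul_sum]
        refine Finset.sum_congr rfl fun r _ => by ring
      rw [h3, zero_add] at h1
      rw [← h1]; exact Finset.sum_congr rfl fun r _ => by ring
    have hpr : ∀ x (r : Fin s), c (Fin.last s) * pderiv x (c r.castSucc) = c r.castSucc * pderiv x (c (Fin.last s)) := by
      intro x
      set w : Fin s → MvPolynomial (Fin k) F := fun r =>
        c (Fin.last s) * pderiv x (c r.castSucc) - c r.castSucc * pderiv x (c (Fin.last s)) with hw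
      have : w = 0 := by
        apply Matrix.eq_zero_of_mulVec_eq_zero hU
        ext1 a
        have h1 := hdrel x a
        have h2 := hrel (i a) ((hi a).trans a.2.le)
        rw [Fin.sum_univ_castSucc] at h1 h2
        simp only [Matrix.mulVec, dotProduct, Matrix.of_apply, Function.comp, hw, Pi.zero_apply]
        have : ∀ r : Fin s, hs (i a) (f r.castSucc) * (c (Fin.last s) * pderiv x (c r.castSucc) - c r.castSucc * pderiv x (c (Fin.last s)))
          = c (Fin.last s) * (pderiv x (c r.castSucc) * hs (i a) (f r.castSucc)) - pderiv x (c (Fin.last s)) * (c r.castSucc * hs (i a) (f r.castSucc)) := fun r => by ring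
        rw [Finset.sum_congr rfl fun r _ => this r, Finset.sum_sub_distrib, ← Finset.mul_sum, ← Finset.mul_sum]
        linear_combination c (Fin.last s) * h1 - pderiv x (c (Fin.last s)) * h2
      intro r
      exact sub_eq_zero.1 (congrFun this r)
    have hq : ∀ r, ∃ q : F, c r = C q * c (Fin.last s) := by
      intro r
      refine Fin.lastCases ⟨1, by simp⟩ (fun r => ?_) r
      exact propor hce fun x => hpr x r
    choose q hq using hq
    have h0 := hrel 0 (by simp)
    simp only [hs_zero] at h0
    have h1 : c (Fin.last s) * ∑ r, q r • f r = 0 := by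
      rw [← h0, Finset.mul_sum]
      refine Finset.sum_congr rfl fun r _ => ?_
      conv_rhs => rw [hq r]
      rw [smul_eq_C_mul]; ring
    have h2 := (mul_eq_zero.1 h1).resolve_left hce
    have h3 := Fintype.linearIndependent_iff.1 hf q h2 (Fin.last s)
    have h4 := hq (Fin.last s)
    rw [h3] at h4; simp at h4; exact hce h4
end Sub
end

noncomputable section
open Finset
namespace Sub
open MvPolynomial

section ten
variable {R : Type*} [CommRing R] {k : ℕ}

def ten (g : Polynomial R) (f : MvPolynomial (Fin k) R) : MvPolynomial (Fin (k+1)) R :=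
  Polynomial.aeval (X 0) g * rename Fin.succ f

lemma finSucc_ten (g : Polynomial R) (f : MvPolynomial (Fin k) R) :
    finSuccEquiv R k (ten g f) = g.map C * Polynomial.C f := by
  rw [ten, map_mul]
  congr 1
  · induction g using Polynomial.induction_on' with
    | add p q hp hq => simp only [map_add, hp, hq, Polynomial.map_add]
    | monomial n a =>
      rw [Polynomial.aeval_monomial, map_mul, map_pow, finSuccEquiv_X_zero, Polynomial.map_monomial,
        ← Polynomial.C_mul_X_pow_eq_monomial]
      congr 1
      simp [MvPolynomial.algebraMap_eq, finSuccEquiv_apply]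
  · induction f using MvPolynomial.induction_on with
    | C a => simp [finSuccEquiv_apply]
    | add p q hp hq => simp only [map_add, hp, hq]
    | mul_X p j ih => rw [map_mul, map_mul, ih, rename_X, finSuccEquiv_X_succ, map_mul]

lemma coeff_ten (g : Polynomial R) (f : MvPolynomial (Fin k) R) (t : Fin (k+1) →₀ ℕ) :
    coeff t (ten g f) = g.coeff (t 0) * coeff t.tail f := by
  rw [← Finsupp.cons_tail t, ← finSuccEquiv_coeff_coeff, finSucc_ten, Polynomial.coeff_mul_C, Polynomial.coeff_map,
    coeff_C_mul]
  simp

lemma hs_ten (b : ℕ) (i : Fin k →₀ ℕ) (g : Polynomial R) (f : MvPolynomial (Fin k) R) :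
    hs (i.cons b) (ten g f) = ten (Polynomial.hasseDeriv b g) (hs i f) := by
  ext t
  rw [coeff_hs, coeff_ten, coeff_ten, coeff_hs, Polynomial.hasseDeriv_coeff]
  have h1 : (t + i.cons b).tail = t.tail + i := by ext j; simp [Finsupp.tail_apply]
  have h2 : bin (t + i.cons b) (i.cons b) = (t 0 + b).choose b * bin (t.tail + i) i := by
    simp only [bin_eq_prod, Fin.prod_univ_succ]
    simp [Finsupp.tail_apply]
  rw [h1, h2]; simp; ring

lemma sh_ten (α : Fin (k+1) → R) (g : Polynomial R) (f : MvPolynomial (Fin k) R) :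
    sh α (ten g f) = ten (Polynomial.taylor (α 0) g) (sh (fun j => α j.succ) f) := by
  rw [ten, ten, map_mul]
  congr 1
  · rw [← Polynomial.aeval_algHom_apply, Polynomial.taylor_apply, Polynomial.aeval_comp]
    simp [sh]
  · induction f using MvPolynomial.induction_on with
    | C a => simp [sh]
    | add p q hp hq => simp only [map_add, hp, hq]
    | mul_X p j ih => rw [map_mul, map_mul, ih, map_mul, map_mul]; simp [sh]
end ten

lemma wr1 {F : Type*} [Field F] [CharZero F] {s : ℕ} (g : Fin s → Polynomial F) (hg : LinearIndependent F g) :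
    ∃ b : Fin s → ℕ, (∀ a, b a ≤ a) ∧ (Matrix.of fun a r => Polynomial.hasseDeriv (b a) (g r)).det ≠ 0 := by
  have hc : ∀ (g : Polynomial F) t, coeff t (ten g (1 : MvPolynomial (Fin 0) F)) = g.coeff (t 0) := by
    intro g t
    rw [coeff_ten, coeff_one, if_pos (Subsingleton.elim _ _), mul_one]
  set ψ : Polynomial F →ₐ[F] MvPolynomial (Fin 1) F := Polynomial.aeval (X 0) with hψ
  have hψt : ∀ g, ψ g = ten g (1 : MvPolynomial (Fin 0) F) := by intro g; simp [ten, hψ]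
  have hinj : Function.Injective ψ := by
    intro p q h
    ext n
    have := congrArg (coeff (Finsupp.single 0 n)) h
    simpa [hψt, hc] using this
  obtain ⟨i, hi, hd⟩ := wronskian s (fun r => ψ (g r))
    (hg.map' ψ.toLinearMap (LinearMap.ker_eq_bot.2 hinj))
  refine ⟨fun a => i a 0, fun a => ?_, fun h => hd ?_⟩
  · have := hi a; rwa [Finsupp.degree_eq_sum, Fin.sum_univ_one] at this
  · have h2 := congrArg ψ h
    rw [map_zero, AlgHom.map_det] at h2
    rw [← h2]; congr 1
    ext a r : 2
    simp only [Matrix.of_apply, AlgHom.mapMatrix_apply, Matrix.map_apply, hψt]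
    have : i a = Finsupp.cons (i a 0) (0 : Fin 0 →₀ ℕ) := by
      refine Finsupp.ext fun j => ?_
      rw [Subsingleton.elim j 0]; simp
    conv_lhs => rw [this, hs_ten, hs_zero]

/-- index at least θ -/
def Idx {K : Type*} [Field K] {k : ℕ} (α : Fin k → K) (d : Fin k → ℕ) (P : MvPolynomial (Fin k) K) (θ : ℝ) : Prop :=
  ∀ n, coeff n (sh α P) ≠ 0 → θ ≤ ∑ j, (n j : ℝ) / d j

section idx
variable {K : Type*} [Field K] {k : ℕ} {α : Fin k → K} {d : Fin k → ℕ} {P Q : MvPolynomial (Fin k) K} {θ θ' : ℝ}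

lemma Idx.zero' : Idx α d P 0 := fun n _ => Finset.sum_nonneg fun j _ => by positivity

lemma Idx.mul (hP : Idx α d P θ) (hQ : Idx α d Q θ') : Idx α d (P * Q) (θ + θ') := by
  classical
  intro n hn
  rw [map_mul, coeff_mul] at hn
  obtain ⟨⟨a, b⟩, hab, h⟩ := Finset.exists_ne_zero_of_sum_ne_zero hn
  have := hP a (left_ne_zero_of_mul h)
  have := hQ b (right_ne_zero_of_mul h)
  rw [← (mem_antidiagonal.1 hab)]
  simp only [Finsupp.add_apply, Nat.cast_add, add_div, Finset.sum_add_distrib]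
  linarith

lemma Idx.prod {ι : Type*} (s : Finset ι) (f : ι → MvPolynomial (Fin k) K) (t : ι → ℝ) (h : ∀ i ∈ s, Idx α d (f i) (t i)) :
    Idx α d (∏ i ∈ s, f i) (∑ i ∈ s, t i) := by
  classical
  induction s using Finset.induction_on with
  | empty => simpa using Idx.zero'
  | insert a s ha ih =>
    rw [Finset.prod_insert ha, Finset.sum_insert ha]
    exact (h a (by simp)).mul (ih fun i hi => h i (by simp [hi]))

lemma Idx.sum {ι : Type*} (s : Finset ι) (f : ι → MvPolynomial (Fin k) K) (h : ∀ i ∈ s, Idx α d (f i) θ) :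
    Idx α d (∑ i ∈ s, f i) θ := by
  intro n hn
  rw [map_sum, coeff_sum] at hn
  obtain ⟨a, ha, h'⟩ := Finset.exists_ne_zero_of_sum_ne_zero hn
  exact h a ha n h'

lemma Idx.hs (hP : Idx α d P θ) (i : Fin k →₀ ℕ) : Idx α d (hs i P) (max 0 (θ - ∑ j, (i j : ℝ) / d j)) := by
  intro n hn
  refine max_le (Idx.zero' n hn) ?_
  rw [taylor, hs_hs, map_mul, ← taylor] at hn
  have := hP _ (right_ne_zero_of_mul hn)
  simp only [Finsupp.add_apply, Nat.cast_add, add_div, Finset.sum_add_distrib] at this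
  linarith

lemma Idx.det {n : ℕ} (M : Matrix (Fin n) (Fin n) (MvPolynomial (Fin k) K)) (t : Fin n → ℝ)
    (h : ∀ a c, Idx α d (M a c) (t c)) : Idx α d M.det (∑ c, t c) := by
  rw [Matrix.det_apply]
  refine Idx.sum _ _ fun p _ => ?_
  have := Idx.prod univ (fun i => M (p i) i) t fun i _ => h _ _
  rcases Int.units_eq_one_or (Equiv.Perm.sign p) with h | h <;> rw [h]
  · simpa using this
  · intro m hm; exact this m (by simpa using hm)
end idx

lemma degreeOf_det {R : Type*} [CommRing R] {n k : ℕ} (M : Matrix (Fin n) (Fin n) (MvPolynomial (Fin k) R)) (j : Fin k) (e : ℕ)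
    (h : ∀ a c, degreeOf j (M a c) ≤ e) : degreeOf j M.det ≤ n * e := by
  rw [Matrix.det_apply]
  refine (degreeOf_sum_le _ _ _).trans (Finset.sup_le fun p _ => ?_)
  have : degreeOf j (∏ i, M (p i) i) ≤ n * e := by
    refine (degreeOf_prod_le _ _ _).trans ?_
    calc _ ≤ ∑ _i : Fin n, e := Finset.sum_le_sum fun i _ => h _ _
      _ = n * e := by simp
  rcases Int.units_eq_one_or (Equiv.Perm.sign p) with h | h <;> rw [h]
  · simpa using this
  · simpa [degreeOf_neg] using this

lemma degreeOf_hs {R : Type*} [CommRing R] {k : ℕ} (P : MvPolynomial (Fin k) R) (i) (j : Fin k) :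
    degreeOf j (hs i P) ≤ degreeOf j P := by
  classical
  rw [degreeOf_le_iff]
  intro m hm
  rw [mem_support_iff, coeff_hs] at hm
  have := degreeOf_le_iff.1 (le_refl (degreeOf j P)) (m + i) (mem_support_iff.2 (right_ne_zero_of_mul hm))
  simp at this; omega
end Sub
end

noncomputable section
open Finset
namespace Sub
open MvPolynomial

def az : AbsoluteValue ℤ ℝ := (@AbsoluteValue.abs ℝ _ _ _).comp (f := Int.castRingHom ℝ) Int.cast_injective
lemma az_apply (a : ℤ) : az a = |(a : ℝ)| := rfl

def L1 {σ : Type*} (P : MvPolynomial σ ℤ) : ℝ := wn az (fun _ => 1) P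

lemma L1_eq {σ : Type*} (P : MvPolynomial σ ℤ) : L1 P = ∑ m ∈ P.support, |((coeff m P : ℤ) : ℝ)| := by
  simp [L1, wn, az_apply]

lemma one_le_az {a : ℤ} (h : a ≠ 0) : 1 ≤ az a := by
  rw [az_apply]; exact_mod_cast Int.one_le_abs h

lemma one_le_L1 {σ : Type*} {P : MvPolynomial σ ℤ} (h : P ≠ 0) : 1 ≤ L1 P := by
  obtain ⟨m, hm⟩ := ne_zero_iff.1 h
  have := coeff_le_wn az (r := fun _ : σ => (1:ℝ)) (fun _ => zero_le_one) P m
  simp at this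
  exact (one_le_az hm).trans this

lemma abs_int_le {K : Type*} [Field K] (v : AbsoluteValue K ℝ) (a : ℤ) : v (a : K) ≤ az a := by
  rw [← v.apply_natAbs_eq, az_apply]
  refine (v.apply_nat_le_self _).trans ?_
  rw [← Int.cast_abs, Int.abs_eq_natAbs]; simp

lemma L1_hs {k : ℕ} (P : MvPolynomial (Fin k) ℤ) (i : Fin k →₀ ℕ) (D : ℕ) (hD : ∑ j, degreeOf j P ≤ D) :
    L1 (hs i P) ≤ 2 ^ D * L1 P := by
  classical
  have h1 : L1 (hs i P) ≤ ∑ m ∈ P.support, wn az (fun _ => (1:ℝ)) (monomial (m - i) ((bin m i : ℤ) * coeff m P)) :=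
    wn_sum az (fun _ => zero_le_one) _ _
  refine h1.trans ?_
  rw [L1_eq, Finset.mul_sum]
  refine Finset.sum_le_sum fun m hm => ?_
  rw [wn_monomial, map_mul]
  simp only [one_pow, Finsupp.prod, Finset.prod_const_one, mul_one, az_apply]
  refine mul_le_mul_of_nonneg_right ?_ (abs_nonneg _)
  rw [abs_of_nonneg (by positivity)]
  have : bin m i ≤ 2 ^ D := by
    rw [bin_eq_prod]
    calc _ ≤ ∏ j, 2 ^ (m j) := Finset.prod_le_prod (fun _ _ => Nat.zero_le _) fun j _ => Nat.choose_le_two_pow _ _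
      _ = 2 ^ ∑ j, m j := by rw [Finset.prod_pow_eq_pow_sum]
      _ ≤ 2 ^ D := Nat.pow_le_pow_right (by norm_num) ((Finset.sum_le_sum fun j _ =>
          degreeOf_le_iff.1 (le_refl (degreeOf j P)) m hm).trans hD)
  exact_mod_cast this

lemma fac_case {K : Type*} [Field K] (v : AbsoluteValue K ℝ) (α : K) (h : 1 ≤ v α) (m : ℕ) (G : MvPolynomial (Fin 1) K) :
    (v α / 2) ^ m * wn v (fun _ => (1/2 : ℝ)) G ≤ wn v (fun _ => (1/2:ℝ)) ((X 0 - C α) ^ m * G) := by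
  have hr : ∀ j : Fin 1, (0:ℝ) ≤ (fun _ => (1/2:ℝ)) j := fun _ => by norm_num
  have h0 : α ≠ 0 := by rintro rfl; simp at h; linarith
  induction m with
  | zero => simp
  | succ m ih =>
    set Q := (X 0 - C α) ^ m * G with hQ
    have e : (X 0 - C α) ^ (m+1) * G = (X 0 - C α) * Q := by rw [hQ]; ring
    rw [e]
    have h1 : v α * wn v (fun _ => (1/2 : ℝ)) Q ≤ wn v (fun _ => (1/2:ℝ)) (C α * Q) := by
      have := wn_mul v hr (C α⁻¹) (C α * Q)
      rw [← mul_assoc, ← C_mul, inv_mul_cancel₀ h0, C_1, one_mul, wn_C, map_inv₀] at this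
      rw [← div_eq_inv_mul, le_div_iff₀ (by linarith)] at this
      linarith
    have h2 : wn v (fun _ => (1/2:ℝ)) (C α * Q) ≤ wn v (fun _ => (1/2:ℝ)) (X 0 * Q) + wn v (fun _ => (1/2:ℝ)) ((X 0 - C α) * Q) := by
      have h3 : C α * Q = X 0 * Q + (C (-1)) * ((X 0 - C α) * Q) := by rw [C_neg, C_1]; ring
      rw [h3]
      refine (wn_add v hr _ _).trans ?_
      have := wn_mul v hr (C (-1)) ((X 0 - C α) * Q)
      rw [wn_C] at this; simp at this; simp; linarith
    have h3 := wn_mul v hr (X 0) Q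
    rw [wn_X] at h3
    have h4 := wn_nonneg v hr Q
    have h5 : (v α / 2) ^ (m+1) * wn v (fun _ => (1/2 : ℝ)) G ≤ (v α / 2) * wn v (fun _ => (1/2 : ℝ)) Q := by
      rw [pow_succ, mul_comm _ (v α / 2), mul_assoc]; exact mul_le_mul_of_nonneg_left ih (by linarith)
    nlinarith

lemma one_var_abs {K : Type*} [Field K] [CharZero K] (v : AbsoluteValue K ℝ) (α : K) (V : Polynomial ℤ) (hV : V ≠ 0)
    (N : ℕ) (hN : V.natDegree ≤ N) (B : ℝ) (hB : ∑ i ∈ range (N+1), az (V.coeff i) ≤ B) (m : ℕ)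
    (hm : (Polynomial.X - Polynomial.C α) ^ m ∣ V.map (Int.castRingHom K)) :
    v (V.leadingCoeff : K) * max 1 (v α) ^ m ≤ 2 ^ N * B := by
  have hlead : az V.leadingCoeff ≤ B := le_trans
    (Finset.single_le_sum (f := fun i => az (V.coeff i)) (fun i _ => az.nonneg _) (by simp; omega : V.natDegree ∈ range (N+1))) hB
  have hB0 : 0 ≤ B := (az.nonneg _).trans hlead
  have h2N : (1:ℝ) ≤ 2 ^ N := one_le_pow₀ (by norm_num)
  rcases le_or_gt 1 (v α) with h | h
  · rw [max_eq_right h]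
    obtain ⟨G, hG⟩ := hm
    set ψ : Polynomial K →ₐ[K] MvPolynomial (Fin 1) K := Polynomial.aeval (X 0) with hψ
    have hψt : ∀ g, ψ g = ten g (1 : MvPolynomial (Fin 0) K) := by intro g; simp [ten, hψ]
    have hc : ∀ (g : Polynomial K) t, coeff t (ψ g) = g.coeff (t 0) := by
      intro g t; rw [hψt]
      rw [coeff_ten, coeff_one, if_pos (Subsingleton.elim _ _), mul_one]
    have h1 := fac_case v α h m (ψ G)
    have h2 : (X 0 - C α) ^ m * ψ G = ψ (V.map (Int.castRingHom K)) := by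
      rw [hG]; simp [hψ, MvPolynomial.algebraMap_eq]
    rw [h2] at h1
    have h3 : wn v (fun _ => (1/2:ℝ)) (ψ (V.map (Int.castRingHom K))) ≤ B := by
      rw [Polynomial.as_sum_range' V (N+1) (by omega), Polynomial.map_sum, map_sum]
      refine (wn_sum v (fun _ => by norm_num) _ _).trans (le_trans (Finset.sum_le_sum fun i _ => ?_) hB)
      rw [Polynomial.map_monomial, hψ, Polynomial.aeval_monomial, MvPolynomial.algebraMap_eq]
      refine (wn_mul v (fun _ => by norm_num) _ _).trans ?_
      rw [wn_C]
      calc _ ≤ az (V.coeff i) * 1 := by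
            refine mul_le_mul (abs_int_le v _) ?_ (wn_nonneg v (fun _ => by norm_num) _) (az.nonneg _)
            refine (wn_pow v (fun _ => by norm_num) _ _).trans ?_
            rw [wn_X]; exact pow_le_one₀ (by norm_num) (by norm_num)
        _ = _ := mul_one _
    have hdeg : G.natDegree + m = V.natDegree := by
      have := congrArg Polynomial.natDegree hG
      rw [Polynomial.natDegree_map_eq_of_injective (RingHom.injective_int _), Polynomial.natDegree_mul, Polynomial.natDegree_pow,
        Polynomial.natDegree_X_sub_C] at this
      · omega
      · exact pow_ne_zero _ (Polynomial.X_sub_C_ne_zero _)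
      · rintro rfl
        rw [mul_zero, Polynomial.map_eq_zero_iff (RingHom.injective_int _)] at hG; exact hV hG
    have hlc : G.coeff G.natDegree = (V.leadingCoeff : K) := by
      have := congrArg Polynomial.leadingCoeff hG
      rw [Polynomial.leadingCoeff_map_of_injective (RingHom.injective_int _), Polynomial.leadingCoeff_mul, Polynomial.leadingCoeff_pow,
        Polynomial.leadingCoeff_X_sub_C] at this
      simpa using this.symm
    have h4 := coeff_le_wn v (r := fun _ : Fin 1 => (1/2:ℝ)) (fun _ => by norm_num) (ψ G) (Finsupp.single 0 G.natDegree)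
    rw [hc] at h4
    simp only [Finsupp.single_eq_same, hlc, Finsupp.prod_single_index, pow_zero] at h4
    have h5 : (v α / 2) ^ m * (v (V.leadingCoeff : K) * (1 / 2) ^ G.natDegree) ≤ B :=
      (mul_le_mul_of_nonneg_left h4 (by positivity)).trans (h1.trans h3)
    have h6 : (2:ℝ) ^ V.natDegree ≤ 2 ^ N := pow_le_pow_right₀ (by norm_num) hN
    have h7 : v (V.leadingCoeff : K) * v α ^ m = 2 ^ V.natDegree * ((v α / 2) ^ m * (v (V.leadingCoeff : K) * (1 / 2) ^ G.natDegree)) := by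
      rw [← hdeg, pow_add, div_pow, div_pow, one_pow]; field_simp
    rw [h7]
    exact mul_le_mul h6 h5 (by positivity) (by positivity)
  · rw [max_eq_left h.le, one_pow, mul_one]
    calc _ ≤ B := (abs_int_le v _).trans hlead
      _ ≤ _ := le_mul_of_one_le_left hB0 h2N
end Sub
end

noncomputable section
open Finset
namespace Sub
open MvPolynomial

section
variable {K : Type*} [Field K] [CharZero K] {S : Type*} [Fintype S] (v : S → AbsoluteValue K ℝ) (n : S → ℝ)

def hh (α : K) : ℝ := ∑ s, n s * Real.log (max 1 (v s α))

lemma hh_nonneg (hn : ∀ s, 0 ≤ n s) (α : K) : 0 ≤ hh v n α :=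
  Finset.sum_nonneg fun s _ => mul_nonneg (hn s) (Real.log_nonneg (le_max_left _ _))

lemma one_var (hn : ∀ s, 0 ≤ n s) (liou : ∀ a : ℤ, a ≠ 0 → 0 ≤ ∑ s, n s * Real.log (v s (a : K)))
    (α : K) (V : Polynomial ℤ) (hV : V ≠ 0)
    (N : ℕ) (hN : V.natDegree ≤ N) (B : ℝ) (hB : ∑ i ∈ range (N+1), az (V.coeff i) ≤ B) :
    ∃ m, (Polynomial.taylor α (V.map (Int.castRingHom K))).coeff m ≠ 0 ∧
      m * hh v n α ≤ (∑ s, n s) * (N * Real.log 2 + Real.log B) := by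
  classical
  have hVK : V.map (Int.castRingHom K) ≠ 0 := by
    rwa [Ne, Polynomial.map_eq_zero_iff (RingHom.injective_int _)]
  have hex : ∃ m, (Polynomial.taylor α (V.map (Int.castRingHom K))).coeff m ≠ 0 := by
    by_contra h; push Not at h
    apply hVK; apply Polynomial.taylor_injective α; rw [map_zero]; ext m; simpa using h m
  refine ⟨Nat.find hex, Nat.find_spec hex, ?_⟩
  set m := Nat.find hex
  have hdvd : (Polynomial.X - Polynomial.C α) ^ m ∣ V.map (Int.castRingHom K) := by
    rw [Polynomial.X_sub_C_pow_dvd_iff, Polynomial.X_pow_dvd_iff]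
    intro d hd
    have := Nat.find_min hex hd
    rw [Polynomial.taylor_apply] at this
    simpa using this
  have hl : V.leadingCoeff ≠ 0 := by simpa using hV
  have hB0 : 0 < B := lt_of_lt_of_le zero_lt_one ((one_le_az hl).trans (le_trans
    (Finset.single_le_sum (f := fun i => az (V.coeff i)) (fun i _ => az.nonneg _) (by simp; omega : V.natDegree ∈ range (N+1))) hB))
  have key : ∀ s, Real.log (v s (V.leadingCoeff : K)) + m * Real.log (max 1 (v s α)) ≤ N * Real.log 2 + Real.log B := by
    intro s
    have h1 := one_var_abs (v s) α V hV N hN B hB m hdvd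
    have hp : 0 < v s (V.leadingCoeff : K) := (v s).pos (by exact_mod_cast hl)
    have hq : 0 < max 1 (v s α) := lt_max_of_lt_left one_pos
    have h2 := Real.log_le_log (by positivity) h1
    rwa [Real.log_mul hp.ne' (by positivity), Real.log_pow, Real.log_mul (by positivity) hB0.ne', Real.log_pow] at h2
  have := liou _ hl
  have h3 : ∑ s, n s * (Real.log (v s (V.leadingCoeff : K)) + m * Real.log (max 1 (v s α))) ≤ ∑ s, n s * (N * Real.log 2 + Real.log B) :=
    Finset.sum_le_sum fun s _ => mul_le_mul_of_nonneg_left (key s) (hn s)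
  rw [← Finset.sum_mul] at h3
  simp only [mul_add, Finset.sum_add_distrib] at h3
  have h4 : ∑ s, n s * (m * Real.log (max 1 (v s α))) = m * hh v n α := by
    rw [hh, Finset.mul_sum]; exact Finset.sum_congr rfl fun s _ => by ring
  rw [h4] at h3
  linarith
end

/-- decomposition -/
lemma decomp {k : ℕ} (P : MvPolynomial (Fin (k+1)) ℤ) (hP : P ≠ 0) (d0 : ℕ) (hd0 : degreeOf 0 P ≤ d0) :
    ∃ (s : ℕ) (l : Fin s → ℕ) (G : Fin s → Polynomial ℚ), 0 < s ∧ s ≤ d0 + 1 ∧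
      LinearIndependent ℚ (fun r => map (Int.castRingHom ℚ) ((finSuccEquiv ℤ k P).coeff (l r))) ∧
      LinearIndependent ℚ G ∧
      map (Int.castRingHom ℚ) P = ∑ r, ten (G r) (map (Int.castRingHom ℚ) ((finSuccEquiv ℤ k P).coeff (l r))) := by
  classical
  set Q : ℕ → MvPolynomial (Fin k) ℚ := fun n => map (Int.castRingHom ℚ) ((finSuccEquiv ℤ k P).coeff n) with hQ
  have hQ0 : ∀ n, d0 < n → Q n = 0 := by
    intro n hn
    rw [hQ]; simp only
    rw [Polynomial.coeff_eq_zero_of_natDegree_lt, map_zero]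
    rw [natDegree_finSuccEquiv]; omega
  obtain ⟨κ, a, ha, hsp, hli⟩ := exists_linearIndependent' ℚ (fun n : Fin (d0+1) => Q n)
  haveI : Finite κ := Finite.of_injective a ha
  haveI : Fintype κ := Fintype.ofFinite κ
  set s := Fintype.card κ with hs
  let e := Fintype.equivFin κ
  set l : Fin s → ℕ := fun r => a (e.symm r) with hl
  have hli' : LinearIndependent ℚ (fun r => Q (l r)) := hli.comp e.symm e.symm.injective
  have hspan : ∀ n, ∃ c : Fin s → ℚ, ∑ r, c r • Q (l r) = Q n := by
    intro n
    by_cases hn : d0 < n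
    · exact ⟨0, by simp [hQ0 n hn]⟩
    · have : Q n ∈ Submodule.span ℚ (Set.range ((fun n : Fin (d0+1) => Q n) ∘ a)) := by
        rw [hsp]; exact Submodule.subset_span ⟨⟨n, by omega⟩, rfl⟩
      rw [Submodule.mem_span_range_iff_exists_fun] at this
      obtain ⟨c, hc⟩ := this
      refine ⟨fun r => c (e.symm r), ?_⟩
      rw [← hc]
      exact Equiv.sum_comp e.symm (fun x => c x • Q (a x))
  choose g hg using hspan
  have hgl : ∀ r r', g (l r') r = if r = r' then 1 else 0 := by
    intro r r'
    have h1 : ∑ r, (g (l r') r - if r = r' then 1 else 0) • Q (l r) = 0 := by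
      simp only [sub_smul, Finset.sum_sub_distrib, hg]
      simp
    exact sub_eq_zero.1 (Fintype.linearIndependent_iff.1 hli' _ h1 r)
  set G : Fin s → Polynomial ℚ := fun r => ∑ n ∈ range (d0+1), Polynomial.monomial n (g n r) with hG
  have hGc : ∀ r n, n ≤ d0 → (G r).coeff n = g n r := by
    intro r n hn
    simp only [hG, Polynomial.finsetSum_coeff, Polynomial.coeff_monomial]
    rw [Finset.sum_eq_single n]
    · simp
    · intro b _ hb; simp [hb]
    · intro h; simp at h; omega
  have hGc0 : ∀ r n, d0 < n → (G r).coeff n = 0 := by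
    intro r n hn
    simp only [hG, Polynomial.finsetSum_coeff, Polynomial.coeff_monomial]
    refine Finset.sum_eq_zero fun m hm => if_neg ?_
    simp at hm; omega
  refine ⟨s, l, G, ?_, ?_, hli', ?_, ?_⟩
  · rcases Nat.eq_zero_or_pos s with h0 | h0
    · exfalso
      apply hP
      have hq : ∀ n, Q n = 0 := by
        intro n; rw [← hg n]
        haveI : IsEmpty (Fin s) := by rw [h0]; infer_instance
        simp
      apply (finSuccEquiv ℤ k).injective
      rw [map_zero]; ext1 n
      have := hq n
      rw [hQ] at this
      simp only at this
      rw [Polynomial.coeff_zero]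
      exact (map_injective _ (RingHom.injective_int (Int.castRingHom ℚ))) (by rw [this, map_zero])
    · exact h0
  · have := Fintype.card_le_of_injective a ha
    simpa using this
  · rw [Fintype.linearIndependent_iff]
    intro c hc r
    have h1 := congrArg (fun p => Polynomial.coeff p (l r)) hc
    simp only [Polynomial.finsetSum_coeff, Polynomial.coeff_smul, Polynomial.coeff_zero] at h1
    have : ∀ r', (G r').coeff (l r) = if r' = r then 1 else 0 := by
      intro r'; rw [hGc _ _ (by have := (a (e.symm r)).2; simp only [hl]; omega), hgl]
    simpa [this] using h1
  · ext t
    rw [coeff_map, coeff_sum]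
    have h1 : (Int.castRingHom ℚ) (coeff t P) = coeff t.tail (Q (t 0)) := by
      rw [hQ]; simp only [coeff_map]; rw [finSuccEquiv_coeff_coeff, Finsupp.cons_tail]
    rw [h1]
    simp only [coeff_ten]
    by_cases hn : d0 < t 0
    · rw [hQ0 _ hn]; simp [hGc0 _ _ hn]
    · rw [← hg (t 0), coeff_sum]
      refine Finset.sum_congr rfl fun r _ => ?_
      rw [hGc _ _ (by omega), coeff_smul, smul_eq_mul]
end Sub
end

noncomputable section
open Finset
namespace Sub
open MvPolynomial

lemma count_bound (ε : ℝ) (h0 : 0 < ε) (h1 : ε ≤ 1) (s d0 : ℕ) (hd : 0 < d0) (hs0 : 0 < s) (hs : s ≤ d0 + 1) :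
    3 * ε ^ 2 * s / 32 ≤ ∑ c : Fin s, max 0 (7 * ε / 8 - (c : ℝ) / d0) := by
  have hd' : (0:ℝ) < d0 := by exact_mod_cast hd
  rw [Fin.sum_univ_eq_sum_range (fun c : ℕ => max 0 (7 * ε / 8 - (c : ℝ) / d0)) s]
  set t := min s (⌊ε * d0 / 2⌋₊ + 1) with ht
  have ht1 : (s : ℝ) * ε / 4 ≤ t := by
    rw [ht, Nat.cast_min]
    refine le_min ?_ ?_
    · have : (0:ℝ) ≤ s := by positivity
      nlinarith
    · push_cast
      have h2 := (Nat.lt_floor_add_one (ε * d0 / 2)).le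
      have h3 : (s:ℝ) ≤ 2 * d0 := by
        have : s ≤ 2 * d0 := by omega
        exact_mod_cast this
      nlinarith
  calc 3 * ε ^ 2 * s / 32 = (s * ε / 4) * (3 * ε / 8) := by ring
    _ ≤ t * (3 * ε / 8) := by gcongr
    _ = ∑ c ∈ range t, (3 * ε / 8) := by simp
    _ ≤ ∑ c ∈ range t, max 0 (7 * ε / 8 - (c : ℝ) / d0) := by
        refine Finset.sum_le_sum fun c hc => le_max_of_le_right ?_
        have h2 : c ≤ ⌊ε * d0 / 2⌋₊ := by
          have := mem_range.1 hc; omega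
        have h3 : (c:ℝ) ≤ ε * d0 / 2 := (Nat.cast_le.2 h2).trans (Nat.floor_le (by positivity))
        have h4 : (c:ℝ) / d0 ≤ ε / 2 := by
          rw [div_le_iff₀ hd']; linarith
        linarith
    _ ≤ _ := Finset.sum_le_sum_of_subset_of_nonneg (by intro x; simp; omega) fun _ _ _ => le_max_left _ _

lemma L1_sub {σ ι : Type*} (P : MvPolynomial σ ℤ) (T : Finset ι) (φ : ι → (σ →₀ ℕ)) (hφ : Function.Injective φ) :
    ∑ t ∈ T, az (coeff (φ t) P) ≤ L1 P := by
  classical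
  rw [L1, wn_eq_sum az (s := T.image φ ∪ P.support) Finset.subset_union_right]
  rw [← Finset.sum_image (f := fun m => az (coeff m P)) (fun a _ b _ h => hφ h)]
  simp only [one_pow, Finsupp.prod, Finset.prod_const_one, mul_one]
  exact Finset.sum_le_sum_of_subset_of_nonneg Finset.subset_union_left fun _ _ _ => az.nonneg _

lemma log_det_bound (s : ℕ) (hs0 : 0 < s) (D d0 : ℕ) (hs : s ≤ d0 + 1) (hd0 : 0 < d0) (hD : d0 ≤ D) (A x : ℝ) (hA : 1 ≤ A)
    (hx0 : 0 < x) (hx : x ≤ s.factorial * (2 ^ D * A) ^ s) : Real.log x ≤ s * (Real.log A + 3 * D) := by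
  have h1 : x ≤ (s * (2 ^ D * A)) ^ s := by
    rw [mul_pow]
    refine hx.trans (mul_le_mul_of_nonneg_right ?_ (by positivity))
    exact_mod_cast Nat.factorial_le_pow s
  have h2 := Real.log_le_log hx0 h1
  have hs' : (0:ℝ) < s := by exact_mod_cast hs0
  rw [Real.log_pow, Real.log_mul (by positivity) (by positivity), Real.log_mul (by positivity) (by positivity), Real.log_pow] at h2
  refine h2.trans (mul_le_mul_of_nonneg_left ?_ hs'.le)
  have h3 := Real.log_le_sub_one_of_pos hs'
  have h4 : (s:ℝ) - 1 ≤ D := by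
    have : (s:ℝ) ≤ D + 1 := by exact_mod_cast (by omega)
    linarith
  have h5 : Real.log 2 ≤ 1 := by have := Real.log_two_lt_d9; linarith
  have : (0:ℝ) ≤ D := by positivity
  nlinarith

variable {K : Type*} [Field K] [CharZero K] {S : Type*} [Fintype S] (v : S → AbsoluteValue K ℝ) (n : S → ℝ)

def RothP (k : ℕ) : Prop := ∀ ε : ℝ, 0 < ε → ∃ σ : ℝ, 0 < σ ∧ ∃ C : ℝ, 0 < C ∧
  ∀ (α : Fin k → K) (d : Fin k → ℕ) (P : MvPolynomial (Fin k) ℤ), P ≠ 0 → (∀ j, 0 < d j) →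
    (∀ j, degreeOf j P ≤ d j) → (∀ i j, i < j → (d i : ℝ) ≤ σ * d j) →
    (∀ j, Real.log (L1 P) + C * ∑ i, (d i : ℝ) ≤ σ * d j * hh v n (α j)) →
    ∃ m, coeff m (sh α (map (Int.castRingHom K) P)) ≠ 0 ∧ ∑ j, (m j : ℝ) / d j ≤ ε

set_option maxHeartbeats 1600000 in
lemma roth_step (hn : ∀ s, 0 ≤ n s) (liou : ∀ a : ℤ, a ≠ 0 → 0 ≤ ∑ s, n s * Real.log (v s (a : K))) (k : ℕ)
    (ih : RothP v n k) : RothP v n (k+1) := by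
  intro ε₀ hε₀
  set ε := min ε₀ 1 with hε
  have e0 : 0 < ε := lt_min hε₀ one_pos
  have e1 : ε ≤ 1 := min_le_right _ _
  obtain ⟨σ', hσ', C', hC', ihh⟩ := ih (ε^2/128) (by positivity)
  set Nn := ∑ s, n s with hNn
  have hNn0 : 0 ≤ Nn := Finset.sum_nonneg fun s _ => hn s
  set σ := min σ' (min (ε/8) (ε^2/128/(Nn+1))) with hσ
  have hσ0 : 0 < σ := lt_min hσ' (lt_min (by positivity) (by positivity))
  have hσ1 : σ ≤ σ' := min_le_left _ _
  have hσ2 : σ ≤ ε / 8 := (min_le_right _ _).trans (min_le_left _ _)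
  have hσ3 : Nn * σ ≤ ε^2/128 := by
    have h := (min_le_right σ' _).trans (min_le_right (ε/8) (ε^2/128/(Nn+1)))
    rw [← hσ, le_div_iff₀ (by positivity)] at h
    nlinarith
  refine ⟨σ, hσ0, C' + 4, by positivity, ?_⟩
  intro α d P hP hd hdeg hrat hT
  by_contra hcon
  push Not at hcon
  set D := ∑ i, d i with hD
  have hDc : (∑ i, (d i : ℝ)) = D := by rw [hD]; push_cast; rfl
  rw [hDc] at hT
  set PK := map (Int.castRingHom K) P with hPK
  have hIdx : Idx α d PK ε := fun m hm => ((min_le_left _ _).trans (hcon m hm).le)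
  have hd0D : d 0 ≤ D := Finset.single_le_sum (f := d) (fun _ _ => Nat.zero_le _) (mem_univ 0)
  have hA := one_le_L1 hP
  obtain ⟨s, l, G, hs0, hs1, hlf, hlG, hdec⟩ := decomp P hP (d 0) (hdeg 0)
  have hs' : (0:ℝ) < s := by exact_mod_cast hs0
  set f : Fin s → MvPolynomial (Fin k) ℤ := fun r => (finSuccEquiv ℤ k P).coeff (l r) with hf
  obtain ⟨i, hi, hU⟩ := wronskian s _ hlf
  obtain ⟨b, hb, hW⟩ := wr1 G hlG
  set UZ := (Matrix.of fun a r => hs (i a) (f r)).det with hUZ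
  set UQ := (Matrix.of fun a r => hs (i a) (map (Int.castRingHom ℚ) (f r))).det with hUQ
  set W := (Matrix.of fun a r => Polynomial.hasseDeriv (b a) (G r)).det with hWd
  set M : Matrix (Fin s) (Fin s) (MvPolynomial (Fin (k+1)) ℤ) := Matrix.of fun a c => hs ((i a).cons (b c)) P with hM
  have hUmap : map (Int.castRingHom ℚ) UZ = UQ := by
    rw [hUZ, hUQ, RingHom.map_det]; congr 1; ext a r : 2; simp [hs_map]
  have hU0 : UZ ≠ 0 := by rintro h; rw [h, map_zero] at hUmap; exact hU hUmap.symm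
  have hDet : map (Int.castRingHom ℚ) M.det = ten W UQ := by
    have h1 : (map (Int.castRingHom ℚ)).mapMatrix M =
        ((rename Fin.succ : MvPolynomial (Fin k) ℚ →ₐ[ℚ] _).mapMatrix (Matrix.of fun a r => hs (i a) (map (Int.castRingHom ℚ) (f r)))) *
        ((Polynomial.aeval (X 0) : Polynomial ℚ →ₐ[ℚ] MvPolynomial (Fin (k+1)) ℚ).mapMatrix
          (Matrix.of fun a r => Polynomial.hasseDeriv (b a) (G r))).transpose := by
      ext a c : 2
      simp only [RingHom.mapMatrix_apply, AlgHom.mapMatrix_apply, Matrix.map_apply, hM, Matrix.of_apply, Matrix.mul_apply, Matrix.transpose_apply]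
      rw [← hs_map, hdec, hs_sum]
      refine congrArg _ ?_
      apply Finset.sum_congr rfl; intro r _
      rw [hs_ten, ten, mul_comm]
    rw [RingHom.map_det, h1, Matrix.det_mul, Matrix.det_transpose, ← AlgHom.map_det, ← AlgHom.map_det, ten, mul_comm]
  -- bounds
  have hfL : ∀ a r, L1 (hs (i a) (f r)) ≤ 2 ^ D * L1 P := by
    intro a r
    refine (L1_hs (f r) _ D ?_).trans (mul_le_mul_of_nonneg_left ?_ (by positivity))
    · rw [hD, Fin.sum_univ_succ]
      refine le_trans (Finset.sum_le_sum (g := fun j : Fin k => d j.succ) fun j _ => ?_) (Nat.le_add_left _ _)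
      exact (degreeOf_coeff_finSuccEquiv _ _ _).trans (hdeg _)
    · rw [L1_eq]
      refine le_trans (le_of_eq ?_) (L1_sub P (f r).support (fun m => m.cons (l r)) (Finsupp.cons_right_injective _))
      refine Finset.sum_congr rfl fun m _ => ?_
      rw [az_apply, hf, finSuccEquiv_coeff_coeff]
  have hML : ∀ a c, L1 (M a c) ≤ 2 ^ D * L1 P := fun a c =>
    L1_hs P _ D (by rw [hD]; exact Finset.sum_le_sum fun j _ => hdeg j)
  have hUdeg : ∀ j, degreeOf j UZ ≤ s * d j.succ := by
    intro j
    refine degreeOf_det _ _ _ fun a c => (degreeOf_hs _ _ _).trans ?_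
    exact (degreeOf_coeff_finSuccEquiv _ _ _).trans (hdeg _)
  have hMdeg : degreeOf 0 M.det ≤ s * d 0 :=
    degreeOf_det _ _ _ fun a c => (degreeOf_hs _ _ _).trans (hdeg 0)
  -- index of U
  have hUl : Real.log (L1 UZ) ≤ s * (Real.log (L1 P) + 3 * D) :=
    log_det_bound s hs0 D (d 0) hs1 (hd 0) hd0D _ _ hA (lt_of_lt_of_le one_pos (one_le_L1 hU0))
      (wn_det az (fun _ => zero_le_one) _ _ hfL)
  obtain ⟨m', hm', hm'2⟩ := ihh (fun j => α j.succ) (fun j => s * d j.succ) UZ hU0 (fun j => Nat.mul_pos hs0 (hd _)) hUdeg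
    (by
      intro x y hxy
      have := hrat x.succ y.succ (Fin.succ_lt_succ_iff.2 hxy)
      push_cast
      have h2 : σ * (d y.succ : ℝ) ≤ σ' * d y.succ := by gcongr
      nlinarith)
    (by
      intro j
      have h1 := hT j.succ
      have h2 : (∑ i : Fin k, ((s * d i.succ : ℕ) : ℝ)) ≤ s * D := by
        push_cast
        rw [← Finset.mul_sum, ← hDc, Fin.sum_univ_succ]
        have : (0:ℝ) ≤ d 0 := by positivity
        nlinarith
      have h3 : σ * d j.succ * hh v n (α j.succ) ≤ σ' * d j.succ * hh v n (α j.succ) := by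
        have := hh_nonneg v n hn (α j.succ)
        gcongr
      push_cast at h2 ⊢
      have hD0 : (0:ℝ) ≤ D := by positivity
      calc _ ≤ s * (Real.log (L1 P) + 3 * D) + C' * (s * D) := by gcongr
        _ ≤ s * (Real.log (L1 P) + (C' + 4) * D) := by nlinarith
        _ ≤ s * (σ' * d j.succ * hh v n (α j.succ)) := by gcongr; linarith
        _ = _ := by ring)
  -- W
  obtain ⟨m0, hm0⟩ := ne_zero_iff.1 hU0
  set V : Polynomial ℤ := ∑ t ∈ range (s * d 0 + 1), Polynomial.monomial t (coeff (m0.cons t) M.det) with hV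
  have hVc : ∀ t, V.coeff t = coeff (m0.cons t) M.det := by
    intro t
    simp only [hV, Polynomial.finsetSum_coeff, Polynomial.coeff_monomial]
    rw [Finset.sum_eq_single t]
    · simp
    · intro b _ hb; simp [hb]
    · intro h; simp only [if_true]
      by_contra h2
      have := degreeOf_le_iff.1 hMdeg _ (mem_support_iff.2 h2)
      simp at this h; omega
  have hVW : V.map (Int.castRingHom ℚ) = Polynomial.C ((coeff m0 UZ : ℤ) : ℚ) * W := by
    ext t
    rw [Polynomial.coeff_map, hVc, ← coeff_map, hDet, coeff_ten, ← hUmap, coeff_map, Polynomial.coeff_C_mul]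
    simp [mul_comm]
  have hV0 : V ≠ 0 := by
    rintro h
    rw [h, Polynomial.map_zero] at hVW
    rcases mul_eq_zero.1 hVW.symm with h | h
    · rw [Polynomial.C_eq_zero] at h; exact hm0 (by exact_mod_cast h)
    · exact hW h
  have hM0 : M.det ≠ 0 := by
    rintro h; apply hV0; ext t; rw [hVc, h]; simp
  have hVdeg : V.natDegree ≤ s * d 0 := by
    rw [hV]
    refine Polynomial.natDegree_sum_le_of_forall_le _ _ fun t ht => (Polynomial.natDegree_monomial_le _).trans ?_
    have := mem_range.1 ht; omega
  have hVL : ∑ t ∈ range (s * d 0 + 1), az (V.coeff t) ≤ L1 M.det := by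
    simp only [hVc]
    exact L1_sub M.det _ (fun t => m0.cons t) (fun a b h => by simpa using congrArg (fun m : Fin (k+1) →₀ ℕ => m 0) h)
  obtain ⟨e, he, he2⟩ := one_var v n hn liou (α 0) V hV0 (s * d 0) hVdeg _ hVL
  have hMl : Real.log (L1 M.det) ≤ s * (Real.log (L1 P) + 3 * D) :=
    log_det_bound s hs0 D (d 0) hs1 (hd 0) hd0D _ _ hA (lt_of_lt_of_le one_pos (one_le_L1 hM0))
      (wn_det az (fun _ => zero_le_one) _ _ hML)
  have hD1 : (1:ℝ) ≤ D := by exact_mod_cast (hd 0).trans_le hd0D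
  have hlA : 0 ≤ Real.log (L1 P) := Real.log_nonneg hA
  have hd0p : (0:ℝ) < d 0 := by exact_mod_cast hd 0
  have he3 : (e:ℝ) / d 0 ≤ s * (ε^2/128) := by
    have h1 := hT 0
    have hpos : 0 < hh v n (α 0) := by
      by_contra hneg
      have : hh v n (α 0) = 0 := le_antisymm (not_lt.1 hneg) (hh_nonneg v n hn _)
      rw [this, mul_zero] at h1
      nlinarith
    have h2 : (e:ℝ) * hh v n (α 0) ≤ Nn * (s * (σ * d 0 * hh v n (α 0))) := by
      refine he2.trans (mul_le_mul_of_nonneg_left ?_ hNn0)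
      refine le_trans ?_ (mul_le_mul_of_nonneg_left h1 hs'.le)
      have h5 : Real.log 2 ≤ 1 := by have := Real.log_two_lt_d9; linarith
      have h6 : ((s * d 0 : ℕ) : ℝ) * Real.log 2 ≤ s * D := by
        push_cast
        have : (d 0 : ℝ) ≤ D := by exact_mod_cast hd0D
        have h7 : (0:ℝ) ≤ Real.log 2 := Real.log_nonneg (by norm_num)
        calc _ ≤ (s * d 0 : ℝ) * 1 := by gcongr
          _ ≤ _ := by nlinarith
      have : (0:ℝ) ≤ s * (C' * D) := by positivity
      nlinarith
    have h3 : (e:ℝ) ≤ Nn * σ * (s * d 0) := by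
      refine le_of_mul_le_mul_right (h2.trans (le_of_eq ?_)) hpos
      ring
    rw [div_le_iff₀ hd0p]
    calc (e:ℝ) ≤ Nn * σ * (s * d 0) := h3
      _ ≤ ε^2/128 * (s * d 0) := by gcongr
      _ = _ := by ring
  -- nonvanishing coefficient
  have hne : coeff (m'.cons e) (sh α (map (Int.castRingHom K) M.det)) ≠ 0 := by
    have hcomp : (Int.castRingHom K) = (algebraMap ℚ K).comp (Int.castRingHom ℚ) := RingHom.ext_int _ _
    have h1 : map (Int.castRingHom K) M.det = ten (W.map (algebraMap ℚ K)) (map (Int.castRingHom K) UZ) := by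
      rw [hcomp, ← MvPolynomial.map_map, hDet, ← MvPolynomial.map_map, hUmap]
      ext t; simp only [coeff_map, coeff_ten, Polynomial.coeff_map, map_mul]
    rw [h1, sh_ten, coeff_ten]
    simp only [Finsupp.cons_zero, Finsupp.tail_cons]
    refine mul_ne_zero ?_ hm'
    intro h2
    apply he
    rw [hcomp, ← Polynomial.map_map, hVW, Polynomial.map_mul, Polynomial.map_C, Polynomial.taylor_mul, Polynomial.taylor_C,
      Polynomial.coeff_C_mul, h2, mul_zero]
  -- lower bound
  have hlow : Idx α d (map (Int.castRingHom K) M.det) (∑ c : Fin s, max 0 (7 * ε / 8 - (c : ℝ) / d 0)) := by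
    rw [RingHom.map_det]
    refine Idx.det _ _ fun a c => ?_
    simp only [RingHom.mapMatrix_apply, Matrix.map_apply, hM, Matrix.of_apply, ← hs_map]
    intro m hm
    refine le_trans ?_ (hIdx.hs _ m hm)
    refine max_le_max le_rfl ?_
    rw [Fin.sum_univ_succ]
    simp only [Finsupp.cons_zero, Finsupp.cons_succ]
    have h1 : (b c : ℝ) / d 0 ≤ (c:ℝ) / d 0 := by
      gcongr; exact_mod_cast hb c
    have h2 : ∑ j : Fin k, (i a j : ℝ) / d j.succ ≤ ε / 8 := by
      have h3 : ∀ j : Fin k, (i a j : ℝ) / d j.succ ≤ i a j * (σ / d 0) := by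
        intro j
        rw [div_eq_mul_inv]
        refine mul_le_mul_of_nonneg_left ?_ (by positivity)
        have h4 := hrat 0 j.succ (Fin.succ_pos j)
        have h5 : (0:ℝ) < d j.succ := by exact_mod_cast hd _
        rw [inv_le_iff_one_le_mul₀ h5, div_mul_eq_mul_div, le_div_iff₀ hd0p]; linarith
      refine (Finset.sum_le_sum fun j _ => h3 j).trans ?_
      rw [← Finset.sum_mul]
      have h4 : (∑ j, (i a j : ℝ)) ≤ d 0 := by
        have h5 := hi a
        rw [Finsupp.degree_eq_sum] at h5
        have h6 : ∑ j, i a j ≤ d 0 := by have := a.2; omega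
        exact_mod_cast h6
      calc _ ≤ (d 0 : ℝ) * (σ / d 0) := by gcongr
        _ = σ := by field_simp
        _ ≤ _ := hσ2
    linarith
  have hfin := hlow _ hne
  rw [Fin.sum_univ_succ] at hfin
  simp only [Finsupp.cons_zero, Finsupp.cons_succ] at hfin
  have hc := count_bound ε e0 e1 s (d 0) (hd 0) hs0 hs1
  have hm3 : ∑ j : Fin k, (m' j : ℝ) / d j.succ ≤ s * (ε^2/128) := by
    have : ∑ j : Fin k, (m' j : ℝ) / d j.succ = s * ∑ j : Fin k, (m' j : ℝ) / ((s * d j.succ : ℕ) : ℝ) := by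
      rw [Finset.mul_sum]
      refine Finset.sum_congr rfl fun j _ => ?_
      have h5 : (0:ℝ) < d j.succ := by exact_mod_cast hd _
      push_cast; field_simp
    rw [this]; gcongr
  have : 0 < ε^2 * s := by positivity
  nlinarith

theorem roth (hn : ∀ s, 0 ≤ n s) (liou : ∀ a : ℤ, a ≠ 0 → 0 ≤ ∑ s, n s * Real.log (v s (a : K))) (k : ℕ) : RothP v n k := by
  induction k with
  | zero =>
    intro ε hε
    refine ⟨1, one_pos, 1, one_pos, fun α d P hP _ _ _ _ => ?_⟩
    obtain ⟨m, hm⟩ := ne_zero_iff.1 hP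
    refine ⟨m, ?_, by simpa using hε.le⟩
    rw [taylor, Subsingleton.elim m 0, hs_zero]
    rw [Subsingleton.elim m 0] at hm
    rw [eq_C_of_isEmpty P, map_C, eval_C]
    simpa using hm
  | succ k ih => exact roth_step v n hn liou k ih
end Sub
end

noncomputable section
open Finset
namespace Sub
open MvPolynomial

section aux
variable {ι : Type*} [Fintype ι] [DecidableEq ι]

def EE (k : ℕ) (d : Fin k → ℕ) : Finset (Fin k → ι → ℕ) :=
  Fintype.piFinset fun j => Finset.piAntidiag univ (d j)

lemma mem_EE {k : ℕ} {d : Fin k → ℕ} {e : Fin k → ι → ℕ} : e ∈ EE (ι := ι) k d ↔ ∀ j, ∑ i, e j i = d j := by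
  simp [EE, Fintype.mem_piFinset, mem_piAntidiag]

lemma card_EE {k : ℕ} (d : Fin k → ℕ) :
    #(EE (ι := ι) k d) ≤ 2 ^ (Fintype.card ι * ∑ j, d j) := by
  rw [EE, Fintype.card_piFinset, mul_sum, ← prod_pow_eq_pow_sum]
  refine prod_le_prod' fun j _ => ?_
  calc #(piAntidiag (univ : Finset ι) (d j)) ≤ #(Fintype.piFinset fun _ : ι => range (d j + 1)) := by
        refine card_le_card fun e he => ?_
        rw [mem_piAntidiag] at he
        rw [Fintype.mem_piFinset]
        intro i
        rw [mem_range, ← he.1]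
        exact Nat.lt_succ_of_le (single_le_sum (f := e) (fun _ _ => Nat.zero_le _) (mem_univ i))
    _ = (d j + 1) ^ Fintype.card ι := by simp
    _ ≤ (2 ^ d j) ^ Fintype.card ι := Nat.pow_le_pow_left (Nat.lt_two_pow_self) _
    _ = _ := by rw [← pow_mul, mul_comm]

lemma EE_mean [Nonempty ι] {k : ℕ} {d : Fin k → ℕ} (hd : ∀ j, 0 < d j) (i : ι) (j : Fin k)
    (Z : (Fin k → ι → ℕ) → ℝ) (hZ : ∀ e x, Z (Function.update e j x) = Z e) :
    ∑ e ∈ EE (ι := ι) k d, ((e j i : ℝ) / d j - 1 / Fintype.card ι) * Z e = 0 := by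
  have key : ∀ i', ∑ e ∈ EE (ι := ι) k d, (e j i' : ℝ) * Z e = ∑ e ∈ EE (ι := ι) k d, (e j i : ℝ) * Z e := by
    intro i'
    refine Finset.sum_nbij' (fun e => Function.update e j (e j ∘ Equiv.swap i i'))
      (fun e => Function.update e j (e j ∘ Equiv.swap i i')) ?_ ?_ ?_ ?_ ?_
    · intro e he
      rw [mem_EE] at he ⊢
      intro j'
      by_cases h : j' = j
      · subst h
        simp only [Function.update_self]
        rw [← he j']
        exact Equiv.sum_comp (Equiv.swap i i') (e j')
      · simp [Function.update_of_ne h, he]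
    · intro e he
      rw [mem_EE] at he ⊢
      intro j'
      by_cases h : j' = j
      · subst h
        simp only [Function.update_self]
        rw [← he j']
        exact Equiv.sum_comp (Equiv.swap i i') (e j')
      · simp [Function.update_of_ne h, he]
    · intro e he
      simp [Function.comp_assoc]
      ext x; simp
    · intro e he
      simp [Function.comp_assoc]
      ext x; simp
    · intro e he
      simp [hZ]
  have hs : ∑ i', ∑ e ∈ EE (ι := ι) k d, (e j i' : ℝ) * Z e = ∑ e ∈ EE (ι := ι) k d, (d j : ℝ) * Z e := by
    rw [sum_comm]
    refine sum_congr rfl fun e he => ?_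
    rw [← sum_mul, ← mem_EE.1 he j]
    push_cast; rfl
  simp only [key] at hs
  rw [sum_const, nsmul_eq_mul, ← mul_sum, card_univ] at hs
  have h1 : (d j : ℝ) ≠ 0 := by have := hd j; positivity
  have h2 : (Fintype.card ι : ℝ) ≠ 0 := by
    have := Fintype.card_pos (α := ι); positivity
  have : ∑ e ∈ EE (ι := ι) k d, ((e j i : ℝ) / d j - 1 / Fintype.card ι) * Z e
      = (∑ e ∈ EE (ι := ι) k d, (e j i : ℝ) * Z e) / d j - (∑ e ∈ EE (ι := ι) k d, Z e) / Fintype.card ι := by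
    rw [sum_div, sum_div, ← sum_sub_distrib]
    exact sum_congr rfl fun e _ => by ring
  rw [this]
  field_simp
  linarith

lemma EE_cheb [Nonempty ι] {k : ℕ} {d : Fin k → ℕ} (hd : ∀ j, 0 < d j) (i : ι) (η : ℝ) :
    (#{e ∈ EE (ι := ι) k d | η * k < |∑ j, (e j i : ℝ) / d j - k / Fintype.card ι|} : ℝ) * (η * k) ^ 2 ≤
      k * #(EE (ι := ι) k d) ∨ η * k < 0 := by
  by_cases hη : η * k < 0
  · exact Or.inr hη
  left
  push Not at hη
  set Y : Fin k → (Fin k → ι → ℕ) → ℝ := fun j e => (e j i : ℝ) / d j - 1 / Fintype.card ι with hY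
  have hYs : ∀ e, ∑ j, (e j i : ℝ) / d j - k / Fintype.card ι = ∑ j, Y j e := by
    intro e
    simp [hY, sum_sub_distrib, div_eq_mul_inv]
  have hc : (1:ℝ) ≤ Fintype.card ι := by exact_mod_cast Fintype.card_pos (α := ι)
  have hY1 : ∀ e ∈ EE (ι := ι) k d, ∀ j, Y j e * Y j e ≤ 1 := by
    intro e he j
    have hdj : (0:ℝ) < d j := by exact_mod_cast hd j
    have h1 : (e j i : ℝ) / d j ≤ 1 := by
      rw [div_le_one hdj]
      have := mem_EE.1 he j
      rw [← this]
      exact_mod_cast single_le_sum (f := e j) (fun _ _ => Nat.zero_le _) (mem_univ i)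
    have h2 : 0 ≤ (e j i : ℝ) / d j := by positivity
    have h3 : 0 ≤ 1 / (Fintype.card ι : ℝ) := by positivity
    have h4 : 1 / (Fintype.card ι : ℝ) ≤ 1 := by rw [div_le_one (by linarith)]; exact hc
    have : |Y j e| ≤ 1 := by rw [abs_le]; constructor <;> simp only [hY] <;> linarith
    have := abs_le_one_iff_mul_self_le_one.1 this
    exact this
  calc (#{e ∈ EE (ι := ι) k d | η * k < |∑ j, (e j i : ℝ) / d j - k / Fintype.card ι|} : ℝ) * (η * k) ^ 2
      = ∑ e ∈ EE (ι := ι) k d with η * k < |∑ j, (e j i : ℝ) / d j - k / Fintype.card ι|, (η * k) ^ 2 := by simp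
    _ ≤ ∑ e ∈ EE (ι := ι) k d with η * k < |∑ j, (e j i : ℝ) / d j - k / Fintype.card ι|, (∑ j, Y j e) ^ 2 := by
        refine sum_le_sum fun e he => ?_
        rw [mem_filter, hYs] at he
        rw [← sq_abs (∑ j, Y j e)]
        exact pow_le_pow_left₀ hη he.2.le 2
    _ ≤ ∑ e ∈ EE (ι := ι) k d, (∑ j, Y j e) ^ 2 :=
        sum_le_sum_of_subset_of_nonneg (filter_subset _ _) fun _ _ _ => sq_nonneg _
    _ = ∑ j, ∑ j', ∑ e ∈ EE (ι := ι) k d, Y j e * Y j' e := by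
        simp only [sq, sum_mul_sum]
        rw [sum_comm]
        exact sum_congr rfl fun j _ => sum_comm
    _ = ∑ j, ∑ e ∈ EE (ι := ι) k d, Y j e * Y j e := by
        refine sum_congr rfl fun j _ => ?_
        refine sum_eq_single_of_mem j (mem_univ _) fun j' _ h => ?_
        refine EE_mean hd i j (Y j') fun e x => ?_
        simp [hY, Function.update_of_ne h]
    _ ≤ ∑ j : Fin k, ∑ e ∈ EE (ι := ι) k d, (1:ℝ) :=
        sum_le_sum fun j _ => sum_le_sum fun e he => hY1 e he j
    _ = _ := by simp

def BH {k : ℕ} (d : Fin k → ℕ) (f : Fin k × ι →₀ ℕ) : Prop := ∀ j, ∑ i, f (j, i) = d j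

def lin {k : ℕ} {R : Type*} [CommSemiring R] (A : Matrix ι ι R) (x : Fin k × ι) : MvPolynomial (Fin k × ι) R :=
  ∑ i', C (A i' x.2) * X (x.1, i')

def wt (k : ℕ) (x : Fin k × ι) : Fin k → ℕ := Pi.single x.1 1

lemma wt_iff {k : ℕ} (d : Fin k → ℕ) (f : Fin k × ι →₀ ℕ) : Finsupp.weight (wt k) f = d ↔ BH d f := by
  rw [funext_iff]
  refine forall_congr' fun j => ?_
  rw [Finsupp.weight_apply, Finsupp.sum_fintype _ _ (by simp), Finset.sum_apply, Fintype.sum_prod_type,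
    sum_eq_single_of_mem j (mem_univ _)]
  · simp [wt]
  · intro j' _ h
    simp [wt, Pi.single_apply, h.symm]

lemma BH_bind {k : ℕ} {R : Type*} [CommRing R] (A : Matrix ι ι R) (d : Fin k → ℕ) (P : MvPolynomial (Fin k × ι) R)
    (hP : ∀ e ∈ P.support, BH d e) : ∀ e ∈ (bind₁ (lin A) P).support, BH d e := by
  have hl : ∀ x : Fin k × ι, IsWeightedHomogeneous (wt k) (lin A x) (wt k x) := by
    intro x
    unfold lin
    refine IsWeightedHomogeneous.sum _ _ _ fun i' _ => ?_
    have := (isWeightedHomogeneous_C (R := R) (wt k) (A i' x.2)).mul (isWeightedHomogeneous_X R (wt k) (x.1, i'))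
    rw [zero_add] at this
    exact this
  have h2 : IsWeightedHomogeneous (wt k) (bind₁ (lin A) P) d := by
    rw [P.as_sum, map_sum]
    refine IsWeightedHomogeneous.sum _ _ _ fun e he => ?_
    rw [bind₁_monomial]
    have := (isWeightedHomogeneous_C (R := R) (wt k) (coeff e P)).mul
      (IsWeightedHomogeneous.prod e.support (fun i => lin A i ^ e i) (fun i => e i • wt k i) fun i _ => (hl i).pow (e i))
    rw [zero_add] at this
    convert this using 1
    rw [← (wt_iff d e).2 (hP e he), Finsupp.weight_apply, Finsupp.sum]
  intro e he
  rw [← wt_iff]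
  exact h2 (mem_support_iff.1 he)

end aux
end Sub
end

noncomputable section
open Finset
namespace Sub
open MvPolynomial

attribute [local instance] Matrix.seminormedAddCommGroup

lemma siegel' {α β : Type*} [Fintype α] [Fintype β] [DecidableEq α] [DecidableEq β] (M : Matrix α β ℤ)
    (hc : 2 * Fintype.card α ≤ Fintype.card β) (hb : 0 < Fintype.card β) (a : ℝ) (ha : 1 ≤ a)
    (hM : ∀ x y, (|M x y| : ℝ) ≤ a) : ∃ t : β → ℤ, t ≠ 0 ∧ M.mulVec t = 0 ∧
      ∀ y, (|t y| : ℝ) ≤ Fintype.card β * a := by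
  rcases Nat.eq_zero_or_pos (Fintype.card α) with h0 | h0
  · haveI := Fintype.card_eq_zero_iff.1 h0
    obtain ⟨y⟩ := Fintype.card_pos_iff.1 hb
    refine ⟨fun _ => 1, fun h => by simpa using congrFun h y, Subsingleton.elim _ _, fun y => ?_⟩
    have : (1:ℝ) ≤ Fintype.card β := by exact_mod_cast hb
    simp; nlinarith
  · obtain ⟨t, ht, h1, h2⟩ := Int.Matrix.exists_ne_zero_int_vec_norm_le M (by omega) h0
    refine ⟨t, ht, h1, fun y => ?_⟩
    have hn : ‖M‖ ≤ a := by
      rw [Matrix.norm_le_iff (by linarith)]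
      intro x y
      rw [Int.norm_eq_abs]
      exact hM x y
    have hB : (1:ℝ) ≤ Fintype.card β := by exact_mod_cast hb
    have hc' : 2 * (Fintype.card α : ℝ) ≤ Fintype.card β := by exact_mod_cast hc
    have h0' : (0:ℝ) < Fintype.card α := by exact_mod_cast h0
    calc (|t y| : ℝ) = ‖t y‖ := by rw [Int.norm_eq_abs]
      _ ≤ ‖t‖ := norm_le_pi_norm t y
      _ ≤ _ := h2
      _ ≤ (Fintype.card β * max 1 ‖M‖) ^ (1:ℝ) := by
          refine Real.rpow_le_rpow_of_exponent_le ?_ ?_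
          · have : 1 ≤ max 1 ‖M‖ := le_max_left _ _
            nlinarith
          · rw [div_le_one (by linarith)]; linarith
      _ ≤ _ := by
          rw [Real.rpow_one]
          gcongr
          exact max_le ha hn

section aux
variable {ι : Type*} [Fintype ι] [DecidableEq ι]

lemma deg_BH {k : ℕ} {d : Fin k → ℕ} {f : Fin k × ι →₀ ℕ} (h : BH d f) : ∑ x, f x = ∑ j, d j := by
  rw [Fintype.sum_prod_type]
  exact sum_congr rfl fun j _ => h j

def fs {k : ℕ} (e : Fin k → ι → ℕ) : Fin k × ι →₀ ℕ := Finsupp.equivFunOnFinite.symm fun x => e x.1 x.2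

lemma fs_inj {k : ℕ} : Function.Injective (fs (ι := ι) (k := k)) := by
  intro e e' h
  ext j i
  exact DFunLike.congr_fun h (j, i)

lemma BH_fs {k : ℕ} {d : Fin k → ℕ} {e : Fin k → ι → ℕ} (he : e ∈ EE (ι := ι) k d) : BH d (fs e) := fun j => mem_EE.1 he j

theorem aux_poly {S : Type*} [Fintype S] [DecidableEq S] [Nonempty ι] (A : S → Matrix ι ι ℤ) (η : ℝ) (hη : 0 < η) :
    ∃ C : ℝ, 0 < C ∧ ∃ k0 : ℕ, ∀ k ≥ k0, ∀ d : Fin k → ℕ, (∀ j, 0 < d j) →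
    ∃ P : MvPolynomial (Fin k × ι) ℤ, P ≠ 0 ∧ (∀ e ∈ P.support, BH d e) ∧
      Real.log (L1 P) ≤ C * ∑ j, (d j : ℝ) ∧
      ∀ s, ∀ e ∈ (bind₁ (lin (A s)) P).support, BH d e ∧
        ∀ i, |∑ j, (e (j, i) : ℝ) / d j - k / Fintype.card ι| ≤ η * k := by
  set a : ℝ := 1 + ∑ s, ∑ i, ∑ j, az (A s i j) with ha
  have ha1 : 1 ≤ a := by
    have : 0 ≤ ∑ s, ∑ i, ∑ j, az (A s i j) := by positivity
    linarith
  set N := Fintype.card ι with hN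
  have hN0 : 0 < N := Fintype.card_pos
  obtain ⟨k0, hk0⟩ := exists_nat_ge (2 * Fintype.card S * N / η ^ 2 + 1)
  refine ⟨2 * N * Real.log 2 + Real.log a + 1, ?_, k0, fun k hk d hd => ?_⟩
  · have := Real.log_nonneg ha1
    have := Real.log_nonneg one_le_two
    positivity
  have hk' : 2 * Fintype.card S * N / η ^ 2 + 1 ≤ (k:ℝ) := hk0.trans (by exact_mod_cast hk)
  have hkpos : (0:ℝ) < k := by
    have : 0 ≤ 2 * Fintype.card S * N / η ^ 2 := by positivity
    linarith
  set E := EE (ι := ι) k d with hE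
  set B := E.filter (fun e => ∃ i, η * k < |∑ j, (e j i : ℝ) / d j - k / N|) with hB
  have hEpos : 0 < #E := by
    obtain ⟨i0⟩ := ‹Nonempty ι›
    refine card_pos.2 ⟨fun j => Pi.single i0 (d j), mem_EE.2 fun j => by simp⟩
  have hcount : 2 * (Fintype.card S * #B) ≤ #E := by
    have h1 : (#B : ℝ) * (η * k) ^ 2 ≤ N * (k * #E) := by
      have hsub : B ⊆ univ.biUnion fun i => E.filter (fun e => η * k < |∑ j, (e j i : ℝ) / d j - k / N|) := by
        intro e he
        rw [hB, mem_filter] at he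
        obtain ⟨i, hi⟩ := he.2
        exact mem_biUnion.2 ⟨i, mem_univ _, mem_filter.2 ⟨he.1, hi⟩⟩
      have h2 : (#B : ℝ) ≤ ∑ i, (#{e ∈ E | η * k < |∑ j, (e j i : ℝ) / d j - k / N|} : ℝ) := by
        exact_mod_cast (card_le_card hsub).trans card_biUnion_le
      calc (#B : ℝ) * (η * k) ^ 2 ≤ ∑ i, (#{e ∈ E | η * k < |∑ j, (e j i : ℝ) / d j - k / N|} : ℝ) * (η * k) ^ 2 := by
            rw [← sum_mul]; gcongr
        _ ≤ ∑ i : ι, (k * #E : ℝ) := by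
            refine sum_le_sum fun i _ => ?_
            rcases EE_cheb hd i η with h | h
            · exact h
            · exact absurd h (not_lt.2 (by positivity))
        _ = _ := by simp [hN]
    have h3 : 2 * Fintype.card S * N ≤ η ^ 2 * k := by
      have : 2 * Fintype.card S * N / η ^ 2 ≤ (k:ℝ) := by linarith
      rw [div_le_iff₀ (by positivity)] at this
      linarith
    have h4 : (#B : ℝ) * (η ^ 2 * k) ≤ N * #E := by
      have : ((#B : ℝ) * (η ^ 2 * k)) * k ≤ (N * #E) * k := by nlinarith
      exact le_of_mul_le_mul_right this hkpos
    have h5 : (N:ℝ) * (2 * (Fintype.card S * #B)) ≤ N * #E := by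
      refine le_trans ?_ h4
      have : (0:ℝ) ≤ #B := by positivity
      nlinarith
    have h6 := le_of_mul_le_mul_left h5 (by exact_mod_cast hN0)
    exact_mod_cast h6
  set D := ∑ j, d j with hD
  let M : Matrix (S × B) E ℤ := fun x e => coeff (fs x.2.1) (bind₁ (lin (A x.1)) (monomial (fs e.1) (1:ℤ)))
  have hr1 : ∀ x : Fin k × ι, (0:ℝ) ≤ (fun _ => 1 : Fin k × ι → ℝ) x := fun _ => zero_le_one
  have hra : ∀ x : Fin k × ι, (0:ℝ) ≤ (fun _ => a : Fin k × ι → ℝ) x := fun _ => by linarith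
  have hM : ∀ x e, (|M x e| : ℝ) ≤ a ^ D := by
    intro x e
    calc (|M x e| : ℝ) = az (M x e) := by rw [az_apply]
      _ ≤ wn az (fun _ => 1) (bind₁ (lin (A x.1)) (monomial (fs e.1) (1:ℤ))) := by
          refine le_trans ?_ (coeff_le_wn az hr1 _ (fs x.2.1))
          simp [M]
      _ ≤ wn az (fun _ => a) (monomial (fs e.1) (1:ℤ)) := by
          refine wn_bind az hr1 hra _ (fun y => ?_) _
          refine (wn_sum az hr1 _ _).trans ?_
          refine le_trans (b := ∑ i', az (A x.1 i' y.2)) (sum_le_sum fun i' _ => ?_) ?_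
          · refine (wn_mul az hr1 _ _).trans ?_
            rw [wn_C, wn_X]; simp
          · have h1 : ∑ i', az (A x.1 i' y.2) ≤ ∑ i', ∑ j, az (A x.1 i' j) :=
              sum_le_sum fun i' _ => single_le_sum (f := fun j => az (A x.1 i' j)) (fun _ _ => by positivity) (mem_univ _)
            have h2 : ∑ i', ∑ j, az (A x.1 i' j) ≤ ∑ s, ∑ i, ∑ j, az (A s i j) :=
              single_le_sum (f := fun s => ∑ i, ∑ j, az (A s i j)) (fun _ _ => by positivity) (mem_univ x.1)
            linarith
      _ = a ^ D := by
          rw [wn_monomial]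
          rw [Finsupp.prod_fintype _ _ (by simp), prod_pow_eq_pow_sum, deg_BH (BH_fs e.2)]
          simp [az_apply, hD]
  obtain ⟨t, ht0, ht1, ht2⟩ := siegel' M (by simpa using hcount) (by simpa using hEpos) (a ^ D) (one_le_pow₀ ha1) hM
  have hcoeff : ∀ e : E, coeff (fs e.1) (∑ e : E, monomial (fs e.1) (t e)) = t e := by
    intro e
    rw [coeff_sum, sum_eq_single_of_mem e (mem_univ _)]
    · simp
    · intro e' _ h
      rw [coeff_monomial, if_neg]
      intro h'; exact h (Subtype.ext (fs_inj h'))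
  have hPBH : ∀ e ∈ (∑ e : E, monomial (fs e.1) (t e)).support, BH d e := by
    intro f hf
    obtain ⟨e, _, he⟩ := mem_biUnion.1 (support_sum hf)
    have := support_monomial_subset he
    rw [mem_singleton] at this
    rw [this]; exact BH_fs e.2
  refine ⟨∑ e : E, monomial (fs e.1) (t e), ?_, hPBH, ?_, ?_⟩
  · obtain ⟨e, he⟩ := Function.ne_iff.1 ht0
    intro h
    apply he
    rw [← hcoeff e, h]; simp
  · have h1 : L1 (∑ e : E, monomial (fs e.1) (t e)) ≤ #E * (#E * a ^ D) := by
      unfold L1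
      refine (wn_sum az hr1 _ _).trans ?_
      calc _ ≤ ∑ e : E, (#E * a ^ D : ℝ) := by
            refine sum_le_sum fun e _ => ?_
            rw [wn_monomial]
            have := ht2 e
            simp only [Fintype.card_coe] at this
            simp [az_apply, Finsupp.prod]
            exact_mod_cast this
        _ = _ := by simp
    have h2 : L1 (∑ e : E, monomial (fs e.1) (t e)) ≤ 2 ^ (2 * N * D) * a ^ D := by
      refine h1.trans ?_
      have := card_EE (ι := ι) d
      have h3 : (#E : ℝ) ≤ 2 ^ (N * D) := by exact_mod_cast this
      calc (#E * (#E * a ^ D) : ℝ) ≤ 2 ^ (N * D) * (2 ^ (N * D) * a ^ D) := by gcongr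
        _ = _ := by ring
    have hne : (∑ e : E, monomial (fs e.1) (t e)) ≠ 0 := by
      obtain ⟨e, he⟩ := Function.ne_iff.1 ht0
      intro h
      apply he
      rw [← hcoeff e, h]; simp
    have h3 := one_le_L1 hne
    calc _ ≤ Real.log (2 ^ (2 * N * D) * a ^ D) := Real.log_le_log (by linarith) h2
      _ = (2 * N * Real.log 2 + Real.log a) * D := by
          rw [Real.log_mul (by positivity) (by positivity), Real.log_pow, Real.log_pow]
          push_cast; ring
      _ ≤ _ := by
          rw [hD]; push_cast
          have : (0:ℝ) ≤ ∑ j, (d j : ℝ) := by positivity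
          nlinarith
  · intro s f hf
    have hBf := BH_bind (A s) d _ hPBH f hf
    refine ⟨hBf, ?_⟩
    by_contra hcon
    push Not at hcon
    have hff : f = fs (fun j i => f (j, i)) := by ext ⟨j, i⟩; rfl
    have hfB : (fun j i => f (j, i)) ∈ B := by
      rw [hB, mem_filter]
      exact ⟨mem_EE.2 hBf, hcon⟩
    have := congrFun ht1 (s, ⟨_, hfB⟩)
    rw [mem_support_iff] at hf
    apply hf
    rw [map_sum, coeff_sum]
    simp only [Matrix.mulVec, dotProduct, M, Pi.zero_apply, ← hff] at this
    rw [← this]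
    refine sum_congr rfl fun e _ => ?_
    rw [bind₁_monomial, bind₁_monomial, coeff_C_mul, coeff_C_mul]; ring
end aux
end Sub
end

noncomputable section
open Finset
namespace Sub
open MvPolynomial

section F
variable {ι : Type*} [Fintype ι] [DecidableEq ι] {K : Type*} [Field K]

def linj {k : ℕ} {R : Type*} [CommSemiring R] (ξ : Fin k → Matrix ι ι R) (x : Fin k × ι) :
    MvPolynomial (Fin k × ι) R := ∑ l, C (ξ x.1 l x.2) * X (x.1, l)

def Phv {k : ℕ} (a b : ι) (p : Fin k → ι → K) (x : Fin k × ι) : MvPolynomial (Fin k × ι) (MvPolynomial (Fin k) K) :=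
  if x.2 = a then C (X x.1 + C (-(p x.1 b / p x.1 a))) -
      ∑ i ∈ (univ.erase a).erase b, C (C (p x.1 i / p x.1 a)) * X (x.1, i)
    else if x.2 = b then 1 else X x

lemma Phv_p {k : ℕ} (a b : ι) (hab : a ≠ b) (p : Fin k → ι → K) (j : Fin k) (hp : p j a ≠ 0) :
    ∑ i, C (C (p j i)) * Phv a b p (j, i) = C (C (p j a)) * C (X j) := by
  rw [← add_sum_erase univ _ (mem_univ a), ← add_sum_erase (univ.erase a) _ (mem_erase.2 ⟨hab.symm, mem_univ b⟩)]
  have h1 : ∑ i ∈ (univ.erase a).erase b, C (C (p j i)) * Phv a b p (j, i) =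
      ∑ i ∈ (univ.erase a).erase b, C (C (p j i)) * X (j, i) := by
    refine sum_congr rfl fun i hi => ?_
    simp only [mem_erase] at hi
    simp [Phv, hi.1, hi.2.1]
  have h2 : C (C (p j a)) * (∑ i ∈ (univ.erase a).erase b, C (C (p j i / p j a)) * X (j, i)) =
      ∑ i ∈ (univ.erase a).erase b, (C (C (p j i)) * X (j, i) : MvPolynomial (Fin k × ι) (MvPolynomial (Fin k) K)) := by
    rw [mul_sum]
    refine sum_congr rfl fun i hi => ?_
    rw [← mul_assoc, ← C_mul, ← C_mul, mul_div_cancel₀ _ hp]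
  have h3 : (C (C (p j a)) * C (C (-(p j b / p j a))) : MvPolynomial (Fin k × ι) (MvPolynomial (Fin k) K)) = - C (C (p j b)) := by
    rw [← C_mul, ← C_mul, mul_neg, mul_div_cancel₀ _ hp]; simp
  rw [h1]
  simp only [Phv, if_true, if_neg hab.symm, mul_sub, h2, C_add, mul_add, h3]
  ring

lemma Fstep {k : ℕ} (d : Fin k → ℕ) (P : MvPolynomial (Fin k × ι) ℤ) (hP : P ≠ 0) (hBH : ∀ e ∈ P.support, BH d e)
    (a b : ι) (hab : a ≠ b) (p : Fin k → ι → K) (hpa : ∀ j, p j a ≠ 0) (ξ : Fin k → Matrix ι ι K)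
    (hdet : ∀ j, (ξ j).det ≠ 0) (l1 : Fin k → ι) (hperp : ∀ j l, l ≠ l1 j → (ξ j).mulVec (p j) l = 0) (θ : ℝ)
    (hG : ∀ f ∈ (bind₁ (linj ξ) (map (Int.castRingHom K) P)).support, θ ≤ ∑ j, (f (j, l1 j) : ℝ) / d j) :
    ∃ Q : MvPolynomial (Fin k) ℤ, Q ≠ 0 ∧ (∀ j, degreeOf j Q ≤ d j) ∧ L1 Q ≤ L1 P ∧
      ∀ m, coeff m (sh (fun j => -(p j b / p j a)) (map (Int.castRingHom K) Q)) ≠ 0 → θ ≤ ∑ j, (m j : ℝ) / d j := by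
  classical
  set PK := map (Int.castRingHom K) P with hPK
  set CC : K →+* MvPolynomial (Fin k × ι) (MvPolynomial (Fin k) K) := (C).comp C with hCC
  set Ph := eval₂Hom CC (Phv a b p) with hPh
  set ψ : Fin k × ι → MvPolynomial (Fin k × ι) (MvPolynomial (Fin k) K) := fun x =>
    ∑ i, CC ((ξ x.1)⁻¹ i x.2) * Phv a b p (x.1, i) with hψ
  have hu : ∀ j, IsUnit (ξ j).det := fun j => (hdet j).isUnit
  have hΦ : Ph PK = eval₂Hom CC ψ (bind₁ (linj ξ) PK) := by
    rw [eval₂Hom_bind₁, hPh]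
    refine congrFun (congrArg DFunLike.coe (congrArg (eval₂Hom CC) ?_)) PK
    funext x
    simp only [linj, map_sum, map_mul, eval₂Hom_C, eval₂Hom_X', hψ, mul_sum]
    rw [sum_comm]
    have : ∀ i, ∑ l, CC (ξ x.1 l x.2) * (CC ((ξ x.1)⁻¹ i l) * Phv a b p (x.1, i)) =
        CC (((ξ x.1)⁻¹ * ξ x.1) i x.2) * Phv a b p (x.1, i) := by
      intro i
      rw [Matrix.mul_apply, map_sum, sum_mul]
      exact sum_congr rfl fun l _ => by rw [map_mul]; ring
    simp only [this, Matrix.nonsing_inv_mul _ (hu x.1)]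
    rw [sum_eq_single_of_mem x.2 (mem_univ _)]
    · simp
    · intro i _ h; simp [Matrix.one_apply, h]
  have hψ1 : ∀ j, C (X j) ∣ ψ (j, l1 j) := by
    intro j
    set q := (ξ j).mulVec (p j) (l1 j) with hq
    have h1 : (ξ j).mulVec (p j) = Pi.single (l1 j) q := by
      funext l
      by_cases h : l = l1 j
      · subst h; simp [hq]
      · simp [h, hperp j l h]
    have h2 : ∀ i, p j i = (ξ j)⁻¹ i (l1 j) * q := by
      intro i
      have : ((ξ j)⁻¹).mulVec ((ξ j).mulVec (p j)) = p j := by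
        rw [Matrix.mulVec_mulVec, Matrix.nonsing_inv_mul _ (hu j), Matrix.one_mulVec]
      rw [← congrFun this i, h1, Matrix.mulVec_single]
      simp [mul_comm]
    have hq0 : q ≠ 0 := by
      intro h
      exact hpa j (by rw [h2 a, h, mul_zero])
    have h3 := Phv_p a b hab p j (hpa j)
    have h4 : ψ (j, l1 j) = CC (q⁻¹ * p j a) * C (X j) := by
      rw [map_mul, mul_assoc]
      change _ = CC q⁻¹ * (C (C (p j a)) * C (X j))
      rw [← h3, mul_sum]
      refine sum_congr rfl fun i _ => ?_
      rw [← mul_assoc]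
      congr 1
      change _ = CC q⁻¹ * CC (p j i)
      rw [← map_mul, h2 i]
      congr 1
      field_simp
    exact h4 ▸ dvd_mul_left _ _
  -- vanishing
  have hvan : ∀ e m, coeff m (coeff e (Ph PK)) ≠ 0 → θ ≤ ∑ j, (m j : ℝ) / d j := by
    intro e m hm
    rw [hΦ, (bind₁ (linj ξ) PK).as_sum, map_sum, coeff_sum, coeff_sum] at hm
    obtain ⟨f, hf, hfm⟩ := exists_ne_zero_of_sum_ne_zero hm
    refine (hG f hf).trans ?_
    set g : Fin k →₀ ℕ := Finsupp.equivFunOnFinite.symm fun j => f (j, l1 j) with hg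
    have hdv : C (monomial g (1:K)) ∣ (eval₂Hom CC ψ) (monomial f (coeff f (bind₁ (linj ξ) PK))) := by
      rw [eval₂Hom_monomial]
      refine Dvd.dvd.mul_left ?_ _
      rw [Finsupp.prod_fintype _ _ (by simp), Fintype.prod_prod_type]
      have : (monomial g (1:K)) = ∏ j, X j ^ (f (j, l1 j)) := by
        rw [monomial_eq, Finsupp.prod_fintype _ _ (by simp)]; simp [hg]
      rw [this, map_prod]
      refine prod_dvd_prod_of_dvd _ _ fun j _ => ?_
      rw [map_pow]
      exact (pow_dvd_pow_of_dvd (hψ1 j) _).trans (dvd_prod_of_mem (fun l => ψ (j, l) ^ f (j, l)) (mem_univ (l1 j)))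
    obtain ⟨R, hR⟩ := hdv
    rw [hR, coeff_C_mul, coeff_monomial_mul'] at hfm
    have hle : g ≤ m := by
      by_contra h; simp [h] at hfm
    refine sum_le_sum fun j _ => ?_
    have := hle j
    gcongr
    exact this
  -- choose e0
  set pr : (Fin k × ι →₀ ℕ) → (Fin k × ι →₀ ℕ) := fun e => e.filter (fun x => x.2 ≠ a ∧ x.2 ≠ b) with hpr
  set ea : (Fin k × ι →₀ ℕ) → (Fin k →₀ ℕ) := fun e => Finsupp.equivFunOnFinite.symm fun j => e (j, a) with hea
  obtain ⟨e0, he0, hmin⟩ := (P.support.image pr).exists_minimal (by simpa using hP)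
  set T := P.support.filter (fun e => pr e = e0) with hT
  have hinj : ∀ e ∈ T, ∀ e' ∈ T, ea e = ea e' → e = e' := by
    intro e he e' he' h
    rw [hT, mem_filter] at he he'
    have hxa : ∀ j, e (j, a) = e' (j, a) := fun j => DFunLike.congr_fun h j
    have hxi : ∀ j i, i ≠ a → i ≠ b → e (j, i) = e' (j, i) := by
      intro j i h1 h2
      have := DFunLike.congr_fun (he.2.trans he'.2.symm) (j, i)
      simpa [hpr, h1, h2] using this
    ext ⟨j, i⟩
    by_cases h1 : i = a
    · subst h1; exact hxa j
    by_cases h2 : i = b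
    · subst h2
      have s1 := hBH e he.1 j
      have s2 := hBH e' he'.1 j
      rw [← add_sum_erase univ _ (mem_univ i)] at s1 s2
      have : ∑ x ∈ univ.erase i, e (j, x) = ∑ x ∈ univ.erase i, e' (j, x) := by
        refine sum_congr rfl fun x hx => ?_
        by_cases h3 : x = a
        · subst h3; exact hxa j
        · exact hxi j x h3 (ne_of_mem_erase hx)
      omega
    · exact hxi j i h1 h2
  set Q : MvPolynomial (Fin k) ℤ := ∑ e ∈ T, monomial (ea e) (coeff e P) with hQ
  have hTP : T ⊆ P.support := filter_subset _ _
  refine ⟨Q, ?_, ?_, ?_, ?_⟩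
  · obtain ⟨e, he, hee⟩ := mem_image.1 he0
    have heT : e ∈ T := mem_filter.2 ⟨he, hee⟩
    intro h
    have : coeff (ea e) Q = coeff e P := by
      rw [hQ, coeff_sum, sum_eq_single_of_mem e heT]
      · simp
      · intro e' he' hne
        rw [coeff_monomial, if_neg]
        intro h'; exact hne (hinj _ he' _ heT h')
    rw [h] at this
    exact mem_support_iff.1 he (by simpa using this.symm)
  · intro j
    rw [degreeOf_le_iff]
    intro m hm
    obtain ⟨e, he, hem⟩ := mem_biUnion.1 (support_sum hm)
    have := support_monomial_subset hem
    rw [mem_singleton] at this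
    rw [this, ← hBH e (hTP he) j]
    exact single_le_sum (f := fun i => e (j, i)) (fun _ _ => Nat.zero_le _) (mem_univ a)
  · have hr1 : ∀ x : Fin k, (0:ℝ) ≤ (fun _ => 1 : Fin k → ℝ) x := fun _ => zero_le_one
    refine (wn_sum az hr1 _ _).trans ?_
    refine le_trans (sum_le_sum_of_subset_of_nonneg hTP fun _ _ _ => wn_nonneg az hr1 _) ?_
    rw [L1, wn]
    refine sum_le_sum fun e _ => ?_
    rw [wn_monomial]
    simp [Finsupp.prod]
  · intro m hm
    refine hvan e0 m ?_
    suffices hsuf : coeff e0 (Ph PK) = sh (fun j => -(p j b / p j a)) (map (Int.castRingHom K) Q) by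
      rw [hsuf]; exact hm
    have hX : ∀ e ∈ P.support, coeff e0 (Ph (monomial e ((coeff e P : ℤ) : K))) =
        if pr e = e0 then sh (fun j => -(p j b / p j a)) (monomial (ea e) ((coeff e P : ℤ) : K)) else 0 := by
      intro e he
      have h1 : Ph (monomial e ((coeff e P : ℤ) : K)) = monomial (pr e) 1 * (CC (coeff e P : ℤ) * ∏ j, Phv a b p (j, a) ^ e (j, a)) := by
        rw [hPh, eval₂Hom_monomial, mul_left_comm]
        congr 1
        rw [monomial_eq, Finsupp.prod_fintype _ _ (by simp), Finsupp.prod_fintype _ _ (by simp), Fintype.prod_prod_type,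
          Fintype.prod_prod_type, C_1, one_mul, ← prod_mul_distrib]
        refine prod_congr rfl fun j _ => ?_
        rw [← mul_prod_erase univ _ (mem_univ a), mul_comm, ← mul_prod_erase univ (fun x => X (j, x) ^ (pr e) (j, x)) (mem_univ a)]
        congr 1
        simp only [hpr, Finsupp.filter_apply]
        simp only [ne_eq, not_true_eq_false, false_and, if_false, pow_zero, one_mul]
        refine prod_congr rfl fun i hi => ?_
        have hia := ne_of_mem_erase hi
        by_cases hib : i = b
        · simp [Phv, hia, hib, hab.symm]
        · simp [Phv, hia, hib]
      rw [h1, coeff_monomial_mul']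
      by_cases hle : pr e ≤ e0
      · have heq : pr e = e0 := le_antisymm hle (hmin (mem_image_of_mem _ he) hle)
        rw [if_pos hle, if_pos heq, heq, tsub_self, one_mul]
        rw [← constantCoeff_eq, map_mul, map_prod, sh, aeval_monomial, Finsupp.prod_fintype _ _ (by simp)]
        congr 1
        · simp [hCC]
        · refine prod_congr rfl fun j _ => ?_
          simp [Phv, hea, map_sum]
      · rw [if_neg hle, if_neg]
        rintro rfl; exact hle le_rfl
    have hPs : PK = ∑ e ∈ P.support, monomial e ((coeff e P : ℤ) : K) := by
      rw [hPK]
      conv_lhs => rw [P.as_sum]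
      rw [map_sum]
      exact sum_congr rfl fun e _ => by simp [map_monomial]
    rw [hPs, map_sum, coeff_sum, sum_congr rfl hX, ← sum_filter, hQ, map_sum, map_sum]
    exact sum_congr rfl fun e _ => by simp [map_monomial]
end F
end Sub
end

noncomputable section
open Finset
namespace Sub
open MvPolynomial

section E
variable {ι : Type*} [Fintype ι] [DecidableEq ι] {K : Type*} [Field K]

lemma L1_lin {k : ℕ} (d : Fin k → ℕ) (A : Matrix ι ι ℤ) (a : ℝ) (ha : ∀ i, ∑ i', az (A i' i) ≤ a) (ha0 : 0 ≤ a)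
    (P : MvPolynomial (Fin k × ι) ℤ) (hP : ∀ e ∈ P.support, BH d e) :
    L1 (bind₁ (lin A) P) ≤ a ^ (∑ j, d j) * L1 P := by
  have hr1 : ∀ x : Fin k × ι, (0:ℝ) ≤ (fun _ => 1 : Fin k × ι → ℝ) x := fun _ => zero_le_one
  have hra : ∀ x : Fin k × ι, (0:ℝ) ≤ (fun _ => a : Fin k × ι → ℝ) x := fun _ => by linarith
  calc L1 (bind₁ (lin A) P) ≤ wn az (fun _ => a) P := by
        refine wn_bind az hr1 hra _ (fun y => ?_) _
        refine (wn_sum az hr1 _ _).trans ?_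
        refine le_trans (b := ∑ i', az (A i' y.2)) (sum_le_sum fun i' _ => ?_) (ha _)
        refine (wn_mul az hr1 _ _).trans ?_
        rw [wn_C, wn_X]; simp
    _ = _ := by
        rw [wn, L1, wn, mul_sum]
        refine sum_congr rfl fun e he => ?_
        rw [Finsupp.prod_fintype _ _ (by simp), prod_pow_eq_pow_sum, deg_BH (hP e he)]
        simp [Finsupp.prod]; ring

lemma linj_comp {k : ℕ} (A B : Matrix ι ι ℤ) (hBA : B * A = 1) (ξ : Fin k → Matrix ι ι K) (P : MvPolynomial (Fin k × ι) ℤ) :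
    bind₁ (linj ξ) (map (Int.castRingHom K) P) =
      bind₁ (linj fun j => ξ j * B.map (Int.castRingHom K)) (map (Int.castRingHom K) (bind₁ (lin A) P)) := by
  rw [map_bind₁, bind₁_bind₁]
  congr 2
  funext x
  simp only [lin, linj, map_sum, map_mul, map_C, map_X, bind₁_X_right, bind₁_C_right, mul_sum]
  rw [sum_comm]
  refine sum_congr rfl fun l _ => ?_
  simp only [← mul_assoc, ← sum_mul]
  congr 1
  simp only [← C_mul, ← map_sum]
  congr 1
  have h : (B.map (Int.castRingHom K)) * (A.map (Int.castRingHom K)) = 1 := by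
    rw [← Matrix.map_mul, hBA]; simp
  have h2 : ξ x.1 = (ξ x.1 * B.map (Int.castRingHom K)) * A.map (Int.castRingHom K) := by
    rw [Matrix.mul_assoc, h, Matrix.mul_one]
  conv_lhs => rw [h2, Matrix.mul_apply]
  exact sum_congr rfl fun i _ => by simp [mul_comm]

lemma Eplace {k : ℕ} (v : AbsoluteValue K ℝ) (A B : Matrix ι ι ℤ) (hBA : B * A = 1) (P : MvPolynomial (Fin k × ι) ℤ)
    (ξ : Fin k → Matrix ι ι K) (β c : Fin k → ι → ℝ)
    (hξ : ∀ j l i, v ((ξ j * B.map (Int.castRingHom K)) l i) ≤ Real.exp (β j l + c j i)) (W : ℝ) (D : ℕ)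
    (hW : ∀ e ∈ (bind₁ (lin A) P).support, ∑ x, (e x : ℝ) * c x.1 x.2 ≤ W)
    (hD : ∀ e ∈ (bind₁ (lin A) P).support, ∑ x, e x = D) (f : Fin k × ι →₀ ℕ) :
    v (coeff f (bind₁ (linj ξ) (map (Int.castRingHom K) P))) ≤
      Real.exp (∑ x, (f x : ℝ) * β x.1 x.2) * (L1 (bind₁ (lin A) P) * (Fintype.card ι : ℝ) ^ D * Real.exp W) := by
  set Q := bind₁ (lin A) P with hQ
  set r : Fin k × ι → ℝ := fun x => Real.exp (-β x.1 x.2) with hr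
  set r' : Fin k × ι → ℝ := fun x => Fintype.card ι * Real.exp (c x.1 x.2) with hr'
  have hr0 : ∀ x, 0 ≤ r x := fun x => (Real.exp_pos _).le
  have hr0' : ∀ x, 0 ≤ r' x := fun x => by simp only [hr']; positivity
  have h1 := coeff_le_wn v hr0 (bind₁ (linj ξ) (map (Int.castRingHom K) P)) f
  have h2 : wn v r (bind₁ (linj ξ) (map (Int.castRingHom K) P)) ≤ wn v r' (map (Int.castRingHom K) Q) := by
    rw [linj_comp A B hBA]
    refine wn_bind v hr0 hr0' _ (fun x => ?_) _
    refine (wn_sum v hr0 _ _).trans ?_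
    refine le_trans (b := ∑ l : ι, Real.exp (c x.1 x.2)) (sum_le_sum fun l _ => ?_) (by simp [hr'])
    refine (wn_mul v hr0 _ _).trans ?_
    rw [wn_C, wn_X]
    calc _ ≤ Real.exp (β x.1 l + c x.1 x.2) * r (x.1, l) := mul_le_mul_of_nonneg_right (hξ _ _ _) (hr0 _)
      _ = _ := by simp only [hr, ← Real.exp_add]; ring_nf
  have h3 : wn v r' (map (Int.castRingHom K) Q) ≤ L1 Q * (Fintype.card ι : ℝ) ^ D * Real.exp W := by
    rw [wn_eq_sum v (s := Q.support) (support_map_subset _ _), L1, wn, sum_mul, sum_mul]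
    refine sum_le_sum fun e he => ?_
    have h4 : e.prod (fun j e => r' j ^ e) = (Fintype.card ι : ℝ) ^ D * Real.exp (∑ x, (e x : ℝ) * c x.1 x.2) := by
      rw [Finsupp.prod_fintype _ _ (by simp), ← hD e he, ← prod_pow_eq_pow_sum, Real.exp_sum, ← prod_mul_distrib]
      refine prod_congr rfl fun x _ => ?_
      rw [hr', mul_pow, Real.exp_nat_mul]
    rw [h4, coeff_map]
    simp only [one_pow, Finsupp.prod, prod_const_one, mul_one]
    rw [← mul_assoc]
    gcongr
    · exact abs_int_le v _
    · exact hW e he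
  have h5 : f.prod (fun j e => r j ^ e) = Real.exp (-∑ x, (f x : ℝ) * β x.1 x.2) := by
    rw [Finsupp.prod_fintype _ _ (by simp), ← sum_neg_distrib, Real.exp_sum]
    refine prod_congr rfl fun x _ => ?_
    rw [hr, ← Real.exp_nat_mul, mul_neg]
  rw [h5, Real.exp_neg] at h1
  have h6 := h1.trans (h2.trans h3)
  rw [← div_eq_mul_inv, div_le_iff₀ (Real.exp_pos _)] at h6
  rw [mul_comm]; exact h6
end E
end Sub
end

noncomputable section
open Finset
namespace Sub
open MvPolynomial

structure Ar (K S : Type*) [Field K] [Fintype S] where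
  v : S → AbsoluteValue K ℝ
  n : S → ℝ
  hn : ∀ s, 0 < n s
  O : Subring K
  liou : ∀ a ∈ O, a ≠ 0 → 0 ≤ ∑ s, n s * Real.log (v s a)

section M
variable {ι : Type*} [Fintype ι] [DecidableEq ι] {K : Type*} [Field K]

lemma coeff_O {k : ℕ} (O : Subring K) (ξ : Fin k → Matrix ι ι K) (h : ∀ j l i, ξ j l i ∈ O) (P : MvPolynomial (Fin k × ι) ℤ) (f) :
    coeff f (bind₁ (linj ξ) (map (Int.castRingHom K) P)) ∈ O := by
  have : bind₁ (linj ξ) (map (Int.castRingHom K) P) = map O.subtype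
      (bind₁ (linj fun j l i => (⟨ξ j l i, h j l i⟩ : O)) (map (Int.castRingHom O) P)) := by
    rw [map_bind₁, MvPolynomial.map_map]
    congr 2
    · funext x
      simp [linj, map_sum]
  rw [this, coeff_map]
  exact Subtype.property _

lemma balance {k : ℕ} (d : Fin k → ℕ) (hd : ∀ j, 0 < d j) (H : Fin k → ℝ) (X η : ℝ) (hη : 0 ≤ η) (hX : 0 ≤ X)
    (h1 : ∀ j, d j * H j ≤ X) (h2 : ∀ j, X - d j * H j ≤ η * X) (N : ℝ) (hH : ∀ j, 0 ≤ H j)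
    (e : Fin k × ι →₀ ℕ) (he : BH d e) (hb : ∀ i, |∑ j, (e (j, i) : ℝ) / d j - k / N| ≤ η * k)
    (cs : ι → ℝ) (c : Fin k → ι → ℝ) (hc : ∀ j i, c j i ≤ H j * cs i + η * H j) :
    ∑ x, (e x : ℝ) * c x.1 x.2 ≤ X * k / N * ∑ i, cs i + X * k * η * (2 * ∑ i, |cs i| + 1) := by
  have he' : ∀ j i, (e (j, i) : ℝ) ≤ d j := fun j i => by
    rw [← he j]
    exact_mod_cast single_le_sum (f := fun i => e (j, i)) (fun _ _ => Nat.zero_le _) (mem_univ i)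
  have hi : ∀ i, |∑ j, (e (j, i) : ℝ) * H j - X * k / N| ≤ 2 * η * X * k := by
    intro i
    have e1 : ∑ j, (e (j, i) : ℝ) * H j - X * k / N =
        X * (∑ j, (e (j, i) : ℝ) / d j - k / N) - ∑ j, (e (j, i) : ℝ) / d j * (X - d j * H j) := by
      rw [mul_sub, mul_sum, sub_sub, add_comm, ← sub_sub, ← sum_sub_distrib]
      congr 1
      · refine sum_congr rfl fun j _ => ?_
        have : (d j : ℝ) ≠ 0 := by have := hd j; positivity
        field_simp; ring
      · ring
    rw [e1]
    refine (abs_sub _ _).trans ?_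
    have e2 : |X * (∑ j, (e (j, i) : ℝ) / d j - k / N)| ≤ X * (η * k) := by
      rw [abs_mul, abs_of_nonneg hX]; exact mul_le_mul_of_nonneg_left (hb i) hX
    have e3 : |∑ j, (e (j, i) : ℝ) / d j * (X - d j * H j)| ≤ ∑ j : Fin k, η * X := by
      refine (abs_sum_le_sum_abs _ _).trans (sum_le_sum fun j _ => ?_)
      have h3 : 0 ≤ X - d j * H j := by linarith [h1 j]
      have hdj : (0:ℝ) < d j := by exact_mod_cast hd j
      have h4 : (e (j, i) : ℝ) / d j ≤ 1 := by rw [div_le_one hdj]; exact he' j i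
      rw [abs_of_nonneg (by positivity)]
      calc _ ≤ 1 * (X - d j * H j) := by gcongr
        _ ≤ _ := by linarith [h2 j]
    simp only [sum_const, card_univ, Fintype.card_fin, nsmul_eq_mul] at e3
    linarith
  calc ∑ x, (e x : ℝ) * c x.1 x.2 ≤ ∑ x : Fin k × ι, (e x : ℝ) * (H x.1 * cs x.2 + η * H x.1) :=
        sum_le_sum fun x _ => mul_le_mul_of_nonneg_left (hc _ _) (by positivity)
    _ = ∑ i, (∑ j, (e (j, i) : ℝ) * H j) * cs i + ∑ j, η * (d j * H j) := by
        simp only [mul_add, sum_add_distrib]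
        congr 1
        · rw [Fintype.sum_prod_type, sum_comm]
          refine sum_congr rfl fun i _ => ?_
          rw [sum_mul]
          exact sum_congr rfl fun j _ => by ring
        · rw [Fintype.sum_prod_type]
          refine sum_congr rfl fun j _ => ?_
          rw [← he j]; push_cast
          rw [sum_mul, mul_sum]
          exact sum_congr rfl fun i _ => by ring
    _ ≤ ∑ i, (X * k / N * cs i + 2 * η * X * k * |cs i|) + ∑ j : Fin k, η * X := by
        gcongr with i _ j _
        · have h5 := abs_mul (∑ j, (e (j, i) : ℝ) * H j - X * k / N) (cs i)
          have h6 := le_abs_self ((∑ j, (e (j, i) : ℝ) * H j - X * k / N) * cs i)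
          have h7 := mul_le_mul_of_nonneg_right (hi i) (abs_nonneg (cs i))
          linarith
        · exact h1 j
    _ = _ := by
        rw [sum_add_distrib, ← mul_sum, ← mul_sum]
        simp; ring

variable {S : Type*} [Fintype S] [DecidableEq S]

def Pt (R : Ar K S) (B : S → Matrix ι ι ℤ) (a b : ι) (cs : S → ι → ℝ) (δ Cβ κ H : ℝ) (p : ι → K) : Prop :=
  ∃ (c : S → ι → ℝ) (ξ : Matrix ι ι K) (β : ι → S → ℝ) (l1 : ι), p a ≠ 0 ∧
    (∀ s i, c s i ≤ H * cs s i + δ * H) ∧ (∀ l i, ξ l i ∈ R.O) ∧ ξ.det ≠ 0 ∧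
    (∀ l, l ≠ l1 → ξ.mulVec p l = 0) ∧
    (∀ l s i, R.v s ((ξ * (B s).map (Int.castRingHom K)) l i) ≤ Real.exp (β l s + c s i)) ∧
    (∀ l, l ≠ l1 → ∑ s, R.n s * β l s ≤ 0) ∧ ∑ s, R.n s * β l1 s ≤ Cβ * H ∧
    κ * H ≤ hh R.v R.n (-(p b / p a))

set_option maxHeartbeats 1000000 in
theorem main_contra (R : Ar K S) [CharZero K] (A B : S → Matrix ι ι ℤ) (hBA : ∀ s, B s * A s = 1) (a b : ι) (hab : a ≠ b)
    (cs : S → ι → ℝ) (ε : ℝ) (hε : 0 < ε) (hcs : ∑ s, R.n s * ∑ i, cs s i ≤ -ε) (Cβ κ : ℝ) (hCβ : 0 < Cβ) (hκ : 0 < κ) :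
    ∃ δ : ℝ, 0 < δ ∧ ∃ k : ℕ, ∃ Rr : ℝ, 1 ≤ Rr ∧ ∀ (H : Fin k → ℝ) (p : Fin k → ι → K),
      (∀ j, Pt R B a b cs δ Cβ κ (H j) (p j)) → (∀ j, Rr ≤ H j) → (∀ i j, i < j → Rr * H j ≤ H i) → False := by
  haveI : Nonempty ι := ⟨a⟩
  set N := Fintype.card ι with hN
  have hN0 : (1:ℝ) ≤ N := by exact_mod_cast Fintype.card_pos (α := ι)
  set Q := ∑ s, R.n s * ∑ i, |cs s i| with hQ
  set n1 := ∑ s, R.n s with hn1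
  have hnn : ∀ s, 0 ≤ R.n s := fun s => (R.hn s).le
  have hQ0 : 0 ≤ Q := sum_nonneg fun s _ => mul_nonneg (hnn s) (by positivity)
  have hn10 : 0 ≤ n1 := sum_nonneg fun s _ => hnn s
  set η := ε / (4 * N * (2 * Q + n1 + 1)) with hη
  have hη0 : 0 < η := by positivity
  have hη1 : η * (2 * Q + n1) ≤ ε / (4 * N) := by
    have : η * (2 * Q + n1 + 1) = ε / (4 * N) := by rw [hη]; field_simp
    nlinarith
  obtain ⟨C1, hC1, k0, haux⟩ := aux_poly A η hη0
  set k := k0 + 1 with hk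
  have hk1 : (1:ℝ) ≤ k := by rw [hk]; push_cast; linarith [(Nat.cast_nonneg k0 : (0:ℝ) ≤ k0)]
  set θ := k * ε / (4 * N * Cβ) with hθ
  have hθ0 : 0 < θ := by positivity
  have hliou : ∀ a : ℤ, a ≠ 0 → 0 ≤ ∑ s, R.n s * Real.log (R.v s (a:K)) := fun a ha =>
    R.liou _ (intCast_mem R.O a) (by exact_mod_cast ha)
  obtain ⟨σ, hσ, CR, hCR, hroth⟩ := roth R.v R.n hnn hliou k (θ / 2) (by positivity)
  set a0 : ℝ := 1 + ∑ s, ∑ i, ∑ j, az (A s i j) with ha0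
  have ha1 : 1 ≤ a0 := by
    have : 0 ≤ ∑ s, ∑ i, ∑ j, az (A s i j) := by positivity
    linarith
  set C2 := n1 * (C1 + Real.log a0 + Real.log N) with hC2
  have hl1 := Real.log_nonneg ha1
  have hl2 := Real.log_nonneg hN0
  have hC20 : 0 ≤ C2 := by positivity
  set Rr := 1 + 2 / σ + 4 * N * C2 / ε + 2 * k * (C1 + CR) / (σ * κ) with hRr
  have hR1 : 1 ≤ Rr := by
    have : 0 ≤ 2 / σ + 4 * N * C2 / ε + 2 * k * (C1 + CR) / (σ * κ) := by positivity
    linarith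
  have hR2 : 2 / σ ≤ Rr := by
    have : 0 ≤ 1 + 4 * N * C2 / ε + 2 * k * (C1 + CR) / (σ * κ) := by positivity
    linarith
  have hR3 : 4 * N * C2 / ε ≤ Rr := by
    have : 0 ≤ 1 + 2 / σ + 2 * k * (C1 + CR) / (σ * κ) := by positivity
    linarith
  have hR4 : 2 * k * (C1 + CR) / (σ * κ) ≤ Rr := by
    have : 0 ≤ 1 + 2 / σ + 4 * N * C2 / ε := by positivity
    linarith
  refine ⟨η, hη0, k, Rr, hR1, fun H p hPt hHR hHH => ?_⟩
  have hH0 : ∀ j, 0 < H j := fun j => by linarith [hHR j]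
  choose c ξ β l1 hpa hc hξO hdet hperp hξ hβ hβ1 hα using hPt
  set X := (∑ j, H j) * (1 / η + 2) with hX
  have hsum : ∀ j, H j ≤ ∑ j, H j := fun j => single_le_sum (f := H) (fun j _ => (hH0 j).le) (mem_univ j)
  have hX2 : ∀ j, 2 * H j ≤ X := fun j => by
    have : 0 ≤ (∑ j, H j) * (1 / η) := mul_nonneg ((hH0 j).le.trans (hsum j)) (by positivity)
    rw [hX]; linarith [hsum j]
  have hXη : ∀ j, H j ≤ η * X := fun j => by
    have h0 := (hH0 j).le.trans (hsum j)
    have : η * X = (∑ j, H j) + η * (∑ j, H j) * 2 := by rw [hX]; field_simp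
    rw [this]
    have : 0 ≤ η * (∑ j, H j) * 2 := by positivity
    linarith [hsum j]
  have hX0 : 0 < X := by
    have := hX2 (0 : Fin (k0 + 1)); have := hH0 (0 : Fin (k0 + 1)); linarith
  set d : Fin k → ℕ := fun j => ⌊X / H j⌋₊ with hd
  have hdX : ∀ j, d j * H j ≤ X := fun j => by
    rw [← le_div_iff₀ (hH0 j)]
    exact Nat.floor_le (by have := hH0 j; positivity)
  have hdX' : ∀ j, X - d j * H j ≤ H j := fun j => by
    have := (Nat.lt_floor_add_one (X / H j)).le
    rw [div_le_iff₀ (hH0 j)] at this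
    simp only [hd]; linarith
  have hd0 : ∀ j, 0 < d j := fun j => by
    refine Nat.floor_pos.2 ?_
    rw [le_div_iff₀ (hH0 j)]; linarith [hX2 j, hH0 j]
  have hdhalf : ∀ j, X / 2 ≤ d j * H j := fun j => by linarith [hdX' j, hX2 j]
  have hdR : ∀ j, (d j : ℝ) ≤ X / Rr := fun j => by
    rw [le_div_iff₀ (by linarith)]
    refine le_trans ?_ (hdX j)
    gcongr; exact hHR j
  set D := ∑ j, d j with hD
  have hDR : (D : ℝ) ≤ k * (X / Rr) := by
    rw [hD]; push_cast
    calc _ ≤ ∑ j : Fin k, X / Rr := sum_le_sum fun j _ => hdR j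
      _ = _ := by simp
  have hDD : ∑ j, (d j : ℝ) = D := by rw [hD]; push_cast; rfl
  obtain ⟨P, hP0, hPBH, hPL, hPs⟩ := haux k (by omega) d hd0
  rw [hDD] at hPL
  have hL1s : ∀ s, L1 (bind₁ (lin (A s)) P) ≤ Real.exp (D * Real.log a0 + C1 * D) := by
    intro s
    refine (L1_lin d (A s) a0 (fun i => ?_) (by linarith) P hPBH).trans ?_
    · have h1 : ∑ i', az (A s i' i) ≤ ∑ i', ∑ j, az (A s i' j) :=
        sum_le_sum fun i' _ => single_le_sum (f := fun j => az (A s i' j)) (fun _ _ => by positivity) (mem_univ _)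
      have h2 : ∑ i', ∑ j, az (A s i' j) ≤ ∑ s, ∑ i, ∑ j, az (A s i j) :=
        single_le_sum (f := fun s => ∑ i, ∑ j, az (A s i j)) (fun _ _ => by positivity) (mem_univ s)
      linarith
    · rw [Real.exp_add, Real.exp_nat_mul, Real.exp_log (by linarith)]
      gcongr
      have := one_le_L1 hP0
      rw [← Real.log_le_iff_le_exp (by linarith)]; exact hPL
  have hE : ∀ f ∈ (bind₁ (linj ξ) (map (Int.castRingHom K) P)).support, θ ≤ ∑ j, (f (j, l1 j) : ℝ) / d j := by
    intro f hf
    by_contra hlt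
    push Not at hlt
    rw [mem_support_iff] at hf
    set g := coeff f (bind₁ (linj ξ) (map (Int.castRingHom K) P)) with hg
    have hL := R.liou g (coeff_O R.O ξ hξO P f) hf
    set W : S → ℝ := fun s => X * k / N * ∑ i, cs s i + X * k * η * (2 * ∑ i, |cs s i| + 1) with hW
    have hs : ∀ s, Real.log (R.v s g) ≤ ∑ x : Fin k × ι, (f x : ℝ) * β x.1 x.2 s +
        (C1 + Real.log a0 + Real.log N) * D + W s := by
      intro s
      have h1 := Eplace (R.v s) (A s) (B s) (hBA s) P ξ (fun j l => β j l s) (fun j i => c j s i)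
        (fun j l i => hξ j l s i) (W s) D (fun e he => balance d hd0 H X η hη0.le hX0.le hdX
          (fun j => (hdX' j).trans (hXη j)) N (fun j => (hH0 j).le) e (hPs s e he).1 (hPs s e he).2 (cs s) _
          (fun j i => hc j s i)) (fun e he => deg_BH (hPs s e he).1) f
      have hNe : (N:ℝ) ^ D = Real.exp (D * Real.log N) := by
        rw [Real.exp_nat_mul, Real.exp_log (by linarith)]
      rw [Real.log_le_iff_le_exp ((R.v s).pos hf)]
      refine h1.trans ?_
      rw [← hN, hNe]
      calc _ ≤ Real.exp (∑ x : Fin k × ι, (f x : ℝ) * β x.1 x.2 s) * (Real.exp (D * Real.log a0 + C1 * D) *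
            Real.exp (D * Real.log N) * Real.exp (W s)) := by gcongr; exact hL1s s
        _ = _ := by rw [← Real.exp_add, ← Real.exp_add, ← Real.exp_add]; ring_nf
    have h2 : ∑ s, R.n s * Real.log (R.v s g) ≤ ∑ s, R.n s * (∑ x : Fin k × ι, (f x : ℝ) * β x.1 x.2 s +
        (C1 + Real.log a0 + Real.log N) * D + W s) := sum_le_sum fun s _ => mul_le_mul_of_nonneg_left (hs s) (hnn s)
    have h3 : ∑ s, R.n s * (∑ x : Fin k × ι, (f x : ℝ) * β x.1 x.2 s + (C1 + Real.log a0 + Real.log N) * D + W s) =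
        ∑ x : Fin k × ι, (f x : ℝ) * ∑ s, R.n s * β x.1 x.2 s + C2 * D + ∑ s, R.n s * W s := by
      simp only [mul_add, sum_add_distrib]
      congr 1
      congr 1
      · simp only [mul_sum]
        rw [sum_comm]
        exact sum_congr rfl fun _ _ => sum_congr rfl fun _ _ => by ring
      · rw [hC2, hn1, sum_mul, sum_mul]
        exact sum_congr rfl fun s _ => by ring
    have h4 : ∑ s, R.n s * W s ≤ X * k / N * (-ε) + X * k * (ε / (4 * N)) := by
      have : ∑ s, R.n s * W s = X * k / N * (∑ s, R.n s * ∑ i, cs s i) + X * k * (η * (2 * Q + n1)) := by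
        rw [hQ, hn1]
        rw [mul_sum, mul_sum, ← sum_add_distrib, mul_sum, mul_sum, ← sum_add_distrib]
        exact sum_congr rfl fun s _ => by simp only [hW]; ring
      rw [this]
      gcongr
    have h5 : ∑ x : Fin k × ι, (f x : ℝ) * ∑ s, R.n s * β x.1 x.2 s ≤ X * k * (ε / (4 * N)) := by
      calc _ ≤ ∑ j, (f (j, l1 j) : ℝ) * (Cβ * H j) := by
            rw [Fintype.sum_prod_type]
            refine sum_le_sum fun j _ => ?_
            rw [← add_sum_erase univ _ (mem_univ (l1 j))]
            have e1 : ∑ l ∈ univ.erase (l1 j), (f (j, l) : ℝ) * ∑ s, R.n s * β j l s ≤ 0 :=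
              sum_nonpos fun l hl => mul_nonpos_of_nonneg_of_nonpos (by positivity) (hβ j l (ne_of_mem_erase hl))
            have e2 := mul_le_mul_of_nonneg_left (hβ1 j) (Nat.cast_nonneg (α := ℝ) (f (j, l1 j)))
            simp only at e1 ⊢
            linarith
        _ ≤ ∑ j, (f (j, l1 j) : ℝ) / d j * (Cβ * X) := by
            refine sum_le_sum fun j _ => ?_
            have : (0:ℝ) < d j := by exact_mod_cast hd0 j
            rw [div_mul_eq_mul_div, le_div_iff₀ this]
            have e3 := mul_le_mul_of_nonneg_left (hdX j) (mul_nonneg (Nat.cast_nonneg (α := ℝ) (f (j, l1 j))) hCβ.le)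
            linarith
        _ ≤ θ * (Cβ * X) := by rw [← sum_mul]; gcongr
        _ = _ := by rw [hθ]; field_simp
    have h6 : C2 * D ≤ X * k * (ε / (4 * N)) := by
      calc C2 * D ≤ C2 * (k * (X / Rr)) := by gcongr
        _ ≤ _ := by
            have e1 : C2 / Rr ≤ ε / (4 * N) := by
              rw [div_le_iff₀ (by linarith)]
              rw [div_le_iff₀ hε] at hR3
              rw [div_mul_eq_mul_div, le_div_iff₀ (by positivity)]
              linarith
            have : C2 * (k * (X / Rr)) = X * k * (C2 / Rr) := by ring
            rw [this]; gcongr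
    have h7 : X * k / N * (-ε) + X * k * (ε / (4 * N)) + X * k * (ε / (4 * N)) + X * k * (ε / (4 * N)) < 0 := by
      have : X * k / N * (-ε) + X * k * (ε / (4 * N)) + X * k * (ε / (4 * N)) + X * k * (ε / (4 * N)) = -(X * k * ε / (4 * N)) := by
        field_simp; ring
      rw [this]
      have : 0 < X * k * ε / (4 * N) := by positivity
      linarith
    linarith
  obtain ⟨Qp, hQp0, hQd, hQL, hQv⟩ := Fstep d P hP0 hPBH a b hab p hpa ξ hdet l1 hperp θ hE
  have q1 : ∀ i j, i < j → (d i : ℝ) ≤ σ * d j := by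
    intro i j hij
    have h1 := hHH i j hij
    have h2 : (d i : ℝ) * (2 / σ * H j) ≤ X := by
      refine le_trans ?_ (hdX i)
      gcongr
      refine le_trans ?_ h1
      have := (hH0 j).le
      gcongr
    have h3 := hdhalf j
    have h4 : (d i : ℝ) * (2 / σ * H j) ≤ 2 * (d j * H j) := by linarith
    have h5 : (d i : ℝ) * (2 / σ * H j) = (d i / σ) * (2 * H j) := by ring
    have h6 : 2 * (d j * H j) = d j * (2 * H j) := by ring
    rw [h5, h6] at h4
    have := le_of_mul_le_mul_right h4 (by have := hH0 j; positivity)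
    rw [div_le_iff₀ hσ] at this
    linarith
  have q2 : ∀ j, Real.log (L1 Qp) + CR * ∑ i, (d i : ℝ) ≤ σ * d j * hh R.v R.n (-(p j b / p j a)) := by
    intro j
    rw [hDD]
    have hQ1 : Real.log (L1 Qp) ≤ C1 * D :=
      (Real.log_le_log (by linarith [one_le_L1 hQp0]) hQL).trans hPL
    have h1 : σ * (d j) * (κ * H j) ≤ σ * d j * hh R.v R.n (-(p j b / p j a)) := by gcongr; exact hα j
    refine le_trans ?_ h1
    have h2 : σ * κ * (X / 2) ≤ σ * (d j) * (κ * H j) := by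
      have := mul_le_mul_of_nonneg_left (hdhalf j) (mul_nonneg hσ.le hκ.le)
      linarith
    refine le_trans ?_ h2
    have h3 : (C1 + CR) * D ≤ (C1 + CR) * (k * (X / Rr)) := by gcongr
    have h4 : (C1 + CR) * (k * (X / Rr)) ≤ σ * κ * (X / 2) := by
      rw [div_le_iff₀ (by positivity)] at hR4
      have : (C1 + CR) * (k * (X / Rr)) = X / 2 * ((2 * k * (C1 + CR)) / Rr) := by ring
      rw [this, mul_comm]
      gcongr
      rw [div_le_iff₀ (by linarith)]; linarith
    linarith
  obtain ⟨m, hm, hmθ⟩ := hroth (fun j => -(p j b / p j a)) d Qp hQp0 hd0 hQd q1 q2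
  have := hQv m hm
  linarith
end M
end Sub
end

noncomputable section
open Finset
namespace Sub

section D
variable {ι : Type*} [Fintype ι] [DecidableEq ι] [Nonempty ι] {K : Type*} [Field K]

lemma davenport (v : AbsoluteValue K ℝ) (L : ι → (ι → K) →ₗ[K] K) (c : ι → ℝ) (V : ℕ → Submodule K (ι → K))
    (hV : Monotone V) (hd : ∀ t, Module.finrank K (V t) ≤ t) (r : ℕ) :
    ∀ J : Finset ι, #J = r → ∃ e : ℕ → ι, (∀ i ∈ J, ∃ l < r, e l = i) ∧
      ∀ t ≤ r, ∀ y ∈ V t, ∀ i ∈ J, Real.exp (c i) * v (L i y) ≤ r.factorial * ∑ l ∈ range t, Real.exp (c (e l)) * v (L (e l) y) := by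
  induction r with
  | zero =>
    intro J hJ
    rw [card_eq_zero] at hJ
    subst hJ
    exact ⟨fun _ => Classical.arbitrary ι, by simp, by simp⟩
  | succ r ih =>
    intro J hJ
    -- relation
    obtain ⟨a, ⟨i1, hi1, ha1⟩, hrel⟩ : ∃ a : ι → K, (∃ i ∈ J, a i ≠ 0) ∧ ∀ y ∈ V r, ∑ i ∈ J, a i * L i y = 0 := by
      set f : J → Module.Dual K (V r) := fun i => (L i.1).domRestrict (V r) with hf
      have hnot : ¬ LinearIndependent K f := by
        intro h
        have h1 := h.fintype_card_le_finrank
        rw [Subspace.dual_finrank_eq, Fintype.card_coe, hJ] at h1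
        have := hd r
        omega
      rw [Fintype.not_linearIndependent_iff] at hnot
      obtain ⟨g, hg, i, hi⟩ := hnot
      refine ⟨fun i => if h : i ∈ J then g ⟨i, h⟩ else 0, ⟨i.1, i.2, by simpa using hi⟩, fun y hy => ?_⟩
      have := DFunLike.congr_fun hg ⟨y, hy⟩
      simp only [hf, LinearMap.sum_apply, LinearMap.smul_apply, smul_eq_mul, LinearMap.domRestrict_apply, LinearMap.zero_apply] at this
      rw [← this, ← Finset.sum_coe_sort J]
      exact sum_congr rfl fun i _ => by simp
    obtain ⟨i0, hi0, hmax⟩ := J.exists_max_image (fun i => v (a i) * Real.exp (-c i)) ⟨i1, hi1⟩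
    have ha0 : 0 < v (a i0) := by
      have h1 := hmax i1 hi1
      have h2 : 0 < v (a i1) * Real.exp (-c i1) := mul_pos (v.pos ha1) (Real.exp_pos _)
      exact pos_of_mul_pos_left (h2.trans_le h1) (Real.exp_pos _).le
    have hE : ∀ y ∈ V r, Real.exp (c i0) * v (L i0 y) ≤ ∑ i ∈ J.erase i0, Real.exp (c i) * v (L i y) := by
      intro y hy
      have h1 := hrel y hy
      rw [← add_sum_erase J _ hi0] at h1
      have h2 : v (a i0) * v (L i0 y) ≤ ∑ i ∈ J.erase i0, v (a i) * v (L i y) := by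
        rw [← v.map_mul, eq_neg_of_add_eq_zero_left h1, v.map_neg]
        refine (v.sum_le _ _).trans (sum_le_sum fun i _ => by rw [v.map_mul])
      have h3 : v (a i0) * (Real.exp (c i0) * v (L i0 y)) ≤ v (a i0) * ∑ i ∈ J.erase i0, Real.exp (c i) * v (L i y) := by
        calc _ = Real.exp (c i0) * (v (a i0) * v (L i0 y)) := by ring
          _ ≤ Real.exp (c i0) * ∑ i ∈ J.erase i0, v (a i) * v (L i y) := by gcongr
          _ ≤ _ := by
              rw [mul_sum, mul_sum]
              refine sum_le_sum fun i hi => ?_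
              have h4 := hmax i (mem_of_mem_erase hi)
              have h5 : Real.exp (c i0) * v (a i) ≤ v (a i0) * Real.exp (c i) := by
                rw [Real.exp_neg, Real.exp_neg, ← div_eq_mul_inv, ← div_eq_mul_inv, div_le_div_iff₀ (Real.exp_pos _) (Real.exp_pos _)] at h4
                linarith
              have := mul_le_mul_of_nonneg_right h5 (v.nonneg (L i y))
              linarith
      exact le_of_mul_le_mul_left h3 ha0
    obtain ⟨e, he1, he2⟩ := ih (J.erase i0) (by rw [card_erase_of_mem hi0, hJ]; rfl)
    have hpos : ∀ t (e : ℕ → ι) y, 0 ≤ ∑ l ∈ range t, Real.exp (c (e l)) * v (L (e l) y) := fun t e y => by positivity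
    refine ⟨Function.update e r i0, ?_, ?_⟩
    · intro i hi
      by_cases h : i = i0
      · exact ⟨r, by omega, by simp [h]⟩
      · obtain ⟨l, hl, hle⟩ := he1 i (mem_erase.2 ⟨h, hi⟩)
        exact ⟨l, by omega, by rw [Function.update_of_ne (by omega), hle]⟩
    · intro t ht y hy i hi
      rcases Nat.lt_or_ge r t with h | h
      · have : t = r + 1 := by omega
        subst this
        obtain ⟨l, hl, hle⟩ : ∃ l < r + 1, Function.update e r i0 l = i := by
          by_cases h : i = i0
          · exact ⟨r, by omega, by simp [h]⟩
          · obtain ⟨l, hl, hle⟩ := he1 i (mem_erase.2 ⟨h, hi⟩)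
            exact ⟨l, by omega, by rw [Function.update_of_ne (by omega), hle]⟩
        have h1 : (1:ℝ) ≤ (r + 1).factorial := by exact_mod_cast Nat.factorial_pos _
        have h2 := single_le_sum (f := fun l => Real.exp (c (Function.update e r i0 l)) * v (L (Function.update e r i0 l) y))
          (fun _ _ => by positivity) (mem_range.2 hl)
        simp only [hle] at h2
        have h3 := hpos (r + 1) (Function.update e r i0) y
        nlinarith
      · have hs : ∑ l ∈ range t, Real.exp (c (Function.update e r i0 l)) * v (L (Function.update e r i0 l) y) =
            ∑ l ∈ range t, Real.exp (c (e l)) * v (L (e l) y) := by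
          refine sum_congr rfl fun l hl => ?_
          rw [Function.update_of_ne (by have := mem_range.1 hl; omega)]
        rw [hs]
        have h4 := hpos t e y
        have hf : ((r + 1).factorial : ℝ) = (r + 1) * r.factorial := by rw [Nat.factorial_succ]; push_cast; ring
        have hf0 : (0:ℝ) ≤ r.factorial := by positivity
        rw [hf]
        by_cases hii : i = i0
        · subst hii
          refine (hE y (hV h hy)).trans ?_
          calc _ ≤ ∑ i' ∈ J.erase i, (r.factorial * ∑ l ∈ range t, Real.exp (c (e l)) * v (L (e l) y)) :=
                sum_le_sum fun i' hi' => he2 t h y hy i' hi'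
            _ = r * (r.factorial * ∑ l ∈ range t, Real.exp (c (e l)) * v (L (e l) y)) := by
                rw [sum_const, card_erase_of_mem hi0, hJ]; simp
            _ ≤ _ := by
                have := mul_nonneg hf0 h4
                nlinarith
        · refine (he2 t h y hy i (mem_erase.2 ⟨hii, hi⟩)).trans ?_
          have h5 := mul_nonneg hf0 h4
          have : (0:ℝ) ≤ r := by positivity
          nlinarith
end D
end Sub
end

noncomputable section
open Finset
namespace Sub

section G
variable {ι : Type*} [Fintype ι] [DecidableEq ι] {K : Type*} [Field K] {S : Type*} [Fintype S] [DecidableEq S]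

/-- relational height -/
def Ht (R : Ar K S) (A : S → Matrix ι ι ℤ) (c : S → ι → ℝ) (y : ι → K) (b : S → ℝ) : Prop :=
  ∀ s i, R.v s (((A s).map (Int.castRingHom K)).mulVec y i) ≤ Real.exp (b s - c s i)

def nb (R : Ar K S) (b : S → ℝ) : ℝ := ∑ s, R.n s * b s

def vol (R : Ar K S) (c : S → ι → ℝ) : ℝ := ∑ s, R.n s * ∑ i, c s i

def Mink (R : Ar K S) (A : S → Matrix ι ι ℤ) : Prop := ∃ C : ℝ, ∀ c : S → ι → ℝ, ∃ y : ι → K, ∃ b,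
  (∀ i, y i ∈ R.O) ∧ y ≠ 0 ∧ Ht R A c y b ∧ Fintype.card ι * nb R b ≤ vol R c + C

/-- all integer entries bounded -/
lemma v_int_le (v : AbsoluteValue K ℝ) (a : ℤ) : v (a : K) ≤ |(a:ℝ)| := by
  have := abs_int_le v a
  rwa [az_apply] at this

variable (R : Ar K S) (A B : S → Matrix ι ι ℤ)

lemma Ht_lower (hBA : ∀ s, B s * A s = 1) : ∃ C, 0 ≤ C ∧ ∀ c Λ, (∀ s i, c s i ≥ -Λ) → ∀ y b, (∀ i, y i ∈ R.O) → y ≠ 0 →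
    Ht R A c y b → -(C + (∑ s, R.n s) * Λ) ≤ nb R b := by
  set E : ℝ := 1 + ∑ s, ∑ i, ∑ j, |(B s i j : ℝ)| with hE
  have hE1 : 1 ≤ E := by rw [hE]; simp only [le_add_iff_nonneg_right]; positivity
  refine ⟨(∑ s, R.n s) * Real.log E, mul_nonneg (sum_nonneg fun s _ => (R.hn s).le) (Real.log_nonneg hE1), ?_⟩
  intro c Λ hc y b hy hy0 hb
  obtain ⟨i, hi⟩ := Function.ne_iff.1 hy0
  have h1 := R.liou _ (hy i) hi
  have h2 : ∀ s, Real.log (R.v s (y i)) ≤ Real.log E + b s + Λ := by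
    intro s
    have e1 : y i = ∑ j, (B s i j : K) * ((A s).map (Int.castRingHom K)).mulVec y j := by
      have : ((B s).map (Int.castRingHom K)).mulVec (((A s).map (Int.castRingHom K)).mulVec y) = y := by
        rw [Matrix.mulVec_mulVec, ← Matrix.map_mul, hBA, Matrix.map_one _ (map_zero _) (map_one _), Matrix.one_mulVec]
      conv_lhs => rw [← this]
      rfl
    have e2 : R.v s (y i) ≤ E * Real.exp (b s + Λ) := by
      rw [e1]
      refine ((R.v s).sum_le _ _).trans ?_
      calc _ ≤ ∑ j, |(B s i j : ℝ)| * Real.exp (b s + Λ) := by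
            refine sum_le_sum fun j _ => ?_
            rw [(R.v s).map_mul]
            refine mul_le_mul (v_int_le _ _) ((hb s j).trans (Real.exp_le_exp.2 (by linarith [hc s j]))) ((R.v s).nonneg _) (abs_nonneg _)
        _ = (∑ j, |(B s i j : ℝ)|) * Real.exp (b s + Λ) := by rw [sum_mul]
        _ ≤ _ := by
            refine mul_le_mul_of_nonneg_right ?_ (Real.exp_pos _).le
            have f1 := single_le_sum (f := fun s => ∑ i, ∑ j, |(B s i j : ℝ)|) (fun _ _ => by positivity) (mem_univ s)
            have f2 := single_le_sum (f := fun i => ∑ j, |(B s i j : ℝ)|) (fun _ _ => by positivity) (mem_univ i)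
            beta_reduce at f1 f2
            linarith
    have e3 := Real.log_le_log ((R.v s).pos hi) e2
    rw [Real.log_mul (by linarith) (Real.exp_pos _).ne', Real.log_exp] at e3
    linarith
  have h3 : ∑ s, R.n s * Real.log (R.v s (y i)) ≤ ∑ s, R.n s * (Real.log E + b s + Λ) :=
    sum_le_sum fun s _ => mul_le_mul_of_nonneg_left (h2 s) (R.hn s).le
  simp only [mul_add, sum_add_distrib, ← sum_mul] at h3
  unfold nb
  linarith

lemma Ht_upper : ∃ C, 0 ≤ C ∧ ∀ c Λ, (∀ s i, c s i ≤ Λ) → ∀ V : Submodule K (ι → K), V ≠ ⊤ →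
    ∃ y b, (∀ i, y i ∈ R.O) ∧ y ∉ V ∧ Ht R A c y b ∧ nb R b ≤ C + (∑ s, R.n s) * Λ := by
  set E : ℝ := 1 + ∑ s, ∑ i, ∑ j, |(A s i j : ℝ)| with hE
  have hE1 : 1 ≤ E := by rw [hE]; simp only [le_add_iff_nonneg_right]; positivity
  refine ⟨(∑ s, R.n s) * Real.log E, mul_nonneg (sum_nonneg fun s _ => (R.hn s).le) (Real.log_nonneg hE1), ?_⟩
  intro c Λ hc V hV
  obtain ⟨j, hj⟩ : ∃ j, (Pi.single j 1 : ι → K) ∉ V := by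
    by_contra! h
    apply hV
    rw [eq_top_iff, ← (Pi.basisFun K ι).span_eq, Submodule.span_le]
    rintro _ ⟨j, rfl⟩
    simpa using h j
  refine ⟨Pi.single j 1, fun s => Real.log E + Λ, ?_, hj, ?_, ?_⟩
  · intro i
    by_cases h : i = j
    · subst h; simp [R.O.one_mem]
    · simp [h, R.O.zero_mem]
  · intro s i
    rw [Matrix.mulVec_single_one]
    simp only [Matrix.col_apply, Matrix.map_apply, eq_intCast]
    refine (v_int_le _ _).trans ?_
    have f1 := single_le_sum (f := fun s => ∑ i, ∑ j, |(A s i j : ℝ)|) (fun _ _ => by positivity) (mem_univ s)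
    have f2 := single_le_sum (f := fun i => ∑ j, |(A s i j : ℝ)|) (fun _ _ => by positivity) (mem_univ i)
    have f3 := single_le_sum (f := fun j => |(A s i j : ℝ)|) (fun _ _ => by positivity) (mem_univ j)
    beta_reduce at f1 f2 f3
    calc |(A s i j : ℝ)| ≤ E := by linarith
      _ = Real.exp (Real.log E) := (Real.exp_log (by linarith)).symm
      _ ≤ _ := Real.exp_le_exp.2 (by linarith [hc s i])
  · unfold nb; rw [← sum_mul, mul_add]

lemma det_bound (v : AbsoluteValue K ℝ) (Q : Matrix ι ι K) (b c : ι → ℝ) (h : ∀ l i, v (Q l i) ≤ Real.exp (b l - c i)) :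
    v Q.det ≤ (Fintype.card ι).factorial * Real.exp (∑ l, b l - ∑ i, c i) := by
  rw [Matrix.det_apply]
  refine (v.sum_le _ _).trans ?_
  calc _ ≤ ∑ σ : Equiv.Perm ι, Real.exp (∑ l, b l - ∑ i, c i) := by
        refine sum_le_sum fun σ _ => ?_
        have e0 : ∀ x : K, v (Equiv.Perm.sign σ • x) = v x := fun x => by
          rcases Int.units_eq_one_or (Equiv.Perm.sign σ) with h | h <;> simp [h, Units.smul_def]
        rw [e0, map_prod]
        calc _ ≤ ∏ i, Real.exp (b (σ i) - c i) := prod_le_prod (fun _ _ => v.nonneg _) fun i _ => h _ _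
          _ = _ := by rw [← Real.exp_sum, sum_sub_distrib, Equiv.sum_comp σ b]
    _ = _ := by simp [Fintype.card_perm]

/-- the twist -/
lemma twist [Nonempty ι] (s0 : S) : ∃ C0, 0 ≤ C0 ∧ ∀ (c : S → ι → ℝ) (V : ℕ → Submodule K (ι → K)) (_ : Monotone V)
    (_ : ∀ t, Module.finrank K (V t) ≤ t), ∃ pos : ι ≃ Fin (Fintype.card ι), ∀ (ρ : ℕ → ℝ), Monotone ρ →
    ∀ c'', (∀ s i, c'' s i = c s i - (if s = s0 then ρ (pos i) / R.n s0 else 0)) →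
    ∀ t < Fintype.card ι, ∀ y ∈ V (t+1), ∀ b, Ht R A c'' y b →
      ∃ b', Ht R A c y b' ∧ nb R b' = nb R b + ρ t + C0 := by
  set N := Fintype.card ι with hN
  have hN0 : 0 < N := Fintype.card_pos
  have hlog : 0 ≤ Real.log (N.factorial * N) := Real.log_nonneg (by
    have h1 : 1 ≤ N.factorial := Nat.factorial_pos _
    exact_mod_cast Nat.one_le_iff_ne_zero.2 (by positivity))
  refine ⟨R.n s0 * Real.log (N.factorial * N), mul_nonneg (R.hn s0).le hlog, ?_⟩
  intro c V hV hd
  obtain ⟨e, he1, he2⟩ := davenport (R.v s0) (fun i => (LinearMap.proj i).comp (Matrix.mulVecLin ((A s0).map (Int.castRingHom K))))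
    (c s0) V hV hd N univ (by simp [hN])
  have hsurj : Function.Surjective (fun l : Fin N => e l) := fun i => by
    obtain ⟨l, hl, h⟩ := he1 i (mem_univ _)
    exact ⟨⟨l, hl⟩, h⟩
  have hbij : Function.Bijective (fun l : Fin N => e l) :=
    (Fintype.bijective_iff_surjective_and_card _).2 ⟨hsurj, by simp [hN]⟩
  set φ := (Equiv.ofBijective _ hbij) with hφ
  have hφe : ∀ l (hl : l < N), φ.symm (e l) = ⟨l, hl⟩ := fun l hl => by
    rw [Equiv.symm_apply_eq]; rfl
  refine ⟨φ.symm, ?_⟩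
  intro ρ hρ c'' hc'' t ht y hy b hb
  refine ⟨fun s => b s + (if s = s0 then ρ t / R.n s0 + Real.log (N.factorial * N) else 0), ?_, ?_⟩
  · intro s i
    have h1 := hb s i
    rw [hc''] at h1
    by_cases hs : s = s0
    · subst hs
      simp only [if_true] at h1 ⊢
      have h2 := he2 (t+1) ht y hy i (mem_univ i)
      simp only [LinearMap.comp_apply, LinearMap.proj_apply, Matrix.mulVecLin_apply] at h2
      have h3 : ∑ l ∈ range (t+1), Real.exp (c s (e l)) * R.v s (((A s).map (Int.castRingHom K)).mulVec y (e l)) ≤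
          N * Real.exp (b s + ρ t / R.n s) := by
        calc _ ≤ ∑ l ∈ range (t+1), Real.exp (b s + ρ t / R.n s) := by
              refine sum_le_sum fun l hl => ?_
              have hlt : l ≤ t := Nat.lt_succ_iff.1 (mem_range.1 hl)
              have h4 := hb s (e l)
              rw [hc'', hφe l (by omega)] at h4
              simp only [if_true] at h4
              calc _ ≤ Real.exp (c s (e l)) * Real.exp (b s - (c s (e l) - ρ l / R.n s)) := by gcongr
                _ = Real.exp (b s + ρ l / R.n s) := by rw [← Real.exp_add]; congr 1; ring
                _ ≤ _ := by
                  have := hρ hlt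
                  have hn := (R.hn s).le
                  gcongr
          _ = (t+1) * Real.exp (b s + ρ t / R.n s) := by simp
          _ ≤ _ := by
            have : ((t:ℝ) + 1) ≤ N := by exact_mod_cast ht
            gcongr
      have h5 : Real.exp (c s i) * R.v s (((A s).map (Int.castRingHom K)).mulVec y i) ≤ N.factorial * (N * Real.exp (b s + ρ t / R.n s)) :=
        h2.trans (by gcongr)
      rw [show b s + (ρ t / R.n s + Real.log (N.factorial * N)) - c s i = Real.log (N.factorial * N) + (b s + ρ t / R.n s) + -(c s i) by ring,
        Real.exp_add, Real.exp_add, Real.exp_log (by positivity), Real.exp_neg, ← div_eq_mul_inv, le_div_iff₀ (Real.exp_pos _)]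
      linarith
    · simpa [hs] using h1
  · unfold nb
    simp only [mul_add, sum_add_distrib, mul_ite, mul_zero, sum_ite_eq', mem_univ, if_true]
    have := (R.hn s0).ne'
    field_simp
    ring

end G
end Sub
end

noncomputable section
open Finset
namespace Sub

section G
variable {ι : Type*} [Fintype ι] [DecidableEq ι] {K : Type*} [Field K] {S : Type*} [Fintype S] [DecidableEq S]
variable (R : Ar K S) (A B : S → Matrix ι ι ℤ)

structure Gr (c : S → ι → ℝ) (C : ℝ) (g : ℕ → ι → K) (b : ℕ → S → ℝ) (V : ℕ → Submodule K (ι → K)) (lam : ℕ → ℝ) : Prop where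
  V0 : V 0 = ⊥
  Vm : Monotone V
  Vf : ∀ t, Module.finrank K (V t) ≤ t
  Vt : V (Fintype.card ι) = ⊤
  Vs : ∀ t, V (t+1) = V t ⊔ Submodule.span K {g t}
  gO : ∀ t < Fintype.card ι, ∀ i, g t i ∈ R.O
  gV : ∀ t < Fintype.card ι, g t ∉ V t
  gH : ∀ t < Fintype.card ι, Ht R A c (g t) (b t)
  gb : ∀ t < Fintype.card ι, nb R (b t) ≤ lam t + 1
  lm : Monotone lam
  ll : ∀ t < Fintype.card ι, ∀ y, (∀ i, y i ∈ R.O) → y ∉ V t → ∀ b', Ht R A c y b' → lam t ≤ nb R b'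
  ls : ∑ t ∈ range (Fintype.card ι), lam t ≤ vol R c + C
  lb : ∀ Λ, (∀ s i, |c s i| ≤ Λ) → ∀ t, |lam t| ≤ C * (1 + Λ)

lemma greedy [Nonempty ι] (hBA : ∀ s, B s * A s = 1) (hM : Mink R A) (s0 : S) : ∃ C, 0 ≤ C ∧ ∀ c, ∃ g b V lam, Gr R A c C g b V lam := by
  obtain ⟨C1, hC1, low⟩ := Ht_lower R A B hBA
  obtain ⟨C2, hC2, upp⟩ := Ht_upper R A
  obtain ⟨C3, hM⟩ := hM
  obtain ⟨C0, hC0, tw⟩ := twist R A s0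
  set N := Fintype.card ι with hN
  have hN0 : 0 < N := Fintype.card_pos
  set n1 := ∑ s, R.n s with hn1
  have hn10 : 0 ≤ n1 := sum_nonneg fun s _ => (R.hn s).le
  have hfr : ∀ V : Submodule K (ι → K), Module.finrank K V < N → V ≠ ⊤ := by
    rintro V hV rfl
    rw [finrank_top, Module.finrank_fintype_fun_eq_card] at hV
    omega
  refine ⟨C1 + C2 + |C3| + N * C0 + n1, by positivity, fun c => ?_⟩
  set Λ0 : ℝ := ∑ s, ∑ i, |c s i| with hΛ0
  have hcΛ0 : ∀ s i, |c s i| ≤ Λ0 := fun s i => by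
    have f1 := single_le_sum (f := fun s => ∑ i, |c s i|) (fun _ _ => by positivity) (mem_univ s)
    have f2 := single_le_sum (f := fun i => |c s i|) (fun _ _ => by positivity) (mem_univ i)
    beta_reduce at f1 f2
    linarith
  set T : Submodule K (ι → K) → Set ℝ := fun V => {x | ∃ y b, (∀ i, y i ∈ R.O) ∧ y ∉ V ∧ Ht R A c y b ∧ x = nb R b} with hT
  have hTlow : ∀ V Λ, (∀ s i, |c s i| ≤ Λ) → ∀ x ∈ T V, -(C1 + n1 * Λ) ≤ x := by
    rintro V Λ hΛ x ⟨y, b, hy, hyV, hb, rfl⟩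
    exact low c Λ (fun s i => (abs_le.1 (hΛ s i)).1) y b hy (fun h => hyV (h ▸ V.zero_mem)) hb
  have hTup : ∀ V, V ≠ ⊤ → ∀ Λ, (∀ s i, |c s i| ≤ Λ) → ∃ x ∈ T V, x ≤ C2 + n1 * Λ := by
    intro V hV Λ hΛ
    obtain ⟨y, b, h1, h2, h3, h4⟩ := upp c Λ (fun s i => (abs_le.1 (hΛ s i)).2) V hV
    exact ⟨_, ⟨y, b, h1, h2, h3, rfl⟩, h4⟩
  have hTbdd : ∀ V, BddBelow (T V) := fun V => ⟨_, fun x hx => hTlow V Λ0 hcΛ0 x hx⟩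
  have hTne : ∀ V, V ≠ ⊤ → (T V).Nonempty := fun V hV => let ⟨x, h, _⟩ := hTup V hV Λ0 hcΛ0; ⟨x, h⟩
  have hch : ∀ V : Submodule K (ι → K), ∃ y b, V ≠ ⊤ → (∀ i, y i ∈ R.O) ∧ y ∉ V ∧ Ht R A c y b ∧ nb R b ≤ sInf (T V) + 1 := by
    intro V
    by_cases hV : V = ⊤
    · exact ⟨0, 0, fun h => absurd hV h⟩
    · obtain ⟨x, ⟨y, b, h1, h2, h3, rfl⟩, h4⟩ := exists_lt_of_csInf_lt (hTne V hV) (lt_add_one (sInf (T V)))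
      exact ⟨y, b, fun _ => ⟨h1, h2, h3, h4.le⟩⟩
  choose G Gb hG using hch
  set V : ℕ → Submodule K (ι → K) := fun t => Nat.rec ⊥ (fun _ W => W ⊔ Submodule.span K {G W}) t with hV
  have hVs : ∀ t, V (t+1) = V t ⊔ Submodule.span K {G (V t)} := fun t => rfl
  have hVm : Monotone V := monotone_nat_of_le_succ fun t => by rw [hVs]; exact le_sup_left
  have hVf : ∀ t, Module.finrank K (V t) ≤ t := by
    intro t
    induction t with
    | zero => simp [hV]
    | succ t ih =>
      rw [hVs]
      have h1 := Submodule.finrank_add_le_finrank_add_finrank (V t) (Submodule.span K {G (V t)})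
      have h2 := finrank_span_le_card (R := K) ({G (V t)} : Set (ι → K))
      simp at h2
      omega
  have hVne : ∀ t < N, V t ≠ ⊤ := fun t ht => hfr _ ((hVf t).trans_lt ht)
  have hVg : ∀ t ≤ N, t ≤ Module.finrank K (V t) := by
    intro t
    induction t with
    | zero => simp
    | succ t ih =>
      intro ht
      have h1 := ih (by omega)
      have h2 : V t < V (t+1) := by
        refine lt_of_le_of_ne (hVm (Nat.le_succ t)) fun h => ?_
        apply (hG (V t) (hVne t (by omega))).2.1
        refine h.ge ?_
        rw [hVs]
        exact Submodule.mem_sup_right (Submodule.mem_span_singleton_self _)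
      have := Submodule.finrank_lt_finrank_of_lt h2
      omega
  have hVt : V N = ⊤ := Submodule.eq_top_of_finrank_eq (by
    rw [Module.finrank_fintype_fun_eq_card]
    exact le_antisymm (hVf N) (hVg N le_rfl))
  set lam : ℕ → ℝ := fun t => sInf (T (V (min t (N-1)))) with hlam
  have hlt : ∀ t < N, lam t = sInf (T (V t)) := fun t ht => by
    simp only [hlam]; rw [min_eq_left (by omega)]
  have hlm : Monotone lam := by
    intro t u htu
    refine csInf_le_csInf (hTbdd _) (hTne _ (hVne _ (by omega))) ?_
    rintro x ⟨y, b, h1, h2, h3, h4⟩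
    exact ⟨y, b, h1, fun h => h2 (hVm (by omega) h), h3, h4⟩
  have hll : ∀ t < N, ∀ y, (∀ i, y i ∈ R.O) → y ∉ V t → ∀ b', Ht R A c y b' → lam t ≤ nb R b' := by
    intro t ht y h1 h2 b' h3
    rw [hlt t ht]
    exact csInf_le (hTbdd _) ⟨y, b', h1, h2, h3, rfl⟩
  refine ⟨fun t => G (V t), fun t => Gb (V t), V, lam, rfl, hVm, hVf, hVt, hVs, fun t ht => (hG _ (hVne t ht)).1,
    fun t ht => (hG _ (hVne t ht)).2.1, fun t ht => (hG _ (hVne t ht)).2.2.1, fun t ht => ?_, hlm, hll, ?_, ?_⟩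
  · rw [hlt t ht]; exact (hG _ (hVne t ht)).2.2.2
  · obtain ⟨pos, htw⟩ := tw c V hVm hVf
    set c'' : S → ι → ℝ := fun s i => c s i - (if s = s0 then lam (pos i) / R.n s0 else 0) with hc''
    have hvol : vol R c'' = vol R c - ∑ t ∈ range N, lam t := by
      simp only [vol, hc'', sum_sub_distrib, mul_sub]
      congr 1
      rw [sum_eq_single s0]
      · simp only [if_true]
        rw [mul_sum, Finset.sum_range, ← Equiv.sum_comp pos]
        refine sum_congr rfl fun i _ => ?_
        have := (R.hn s0).ne'
        field_simp
      · intro s _ hs; simp [hs]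
      · simp
    obtain ⟨y, b, hy, hy0, hb, hvb⟩ := hM c''
    have hex : ∃ t, y ∈ V t := ⟨N, by rw [hVt]; trivial⟩
    classical
    obtain ⟨t, ht⟩ : ∃ t, Nat.find hex = t + 1 := by
      refine Nat.exists_eq_succ_of_ne_zero fun h => hy0 ?_
      have := Nat.find_spec hex
      rw [h] at this
      exact this
    have h1 : y ∈ V (t+1) := ht ▸ Nat.find_spec hex
    have h2 : y ∉ V t := Nat.find_min hex (by omega)
    have h3 : t < N := by
      have : Nat.find hex ≤ N := Nat.find_min' hex (by rw [hVt]; trivial)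
      omega
    obtain ⟨b', hb', hbb⟩ := htw lam hlm c'' (fun s i => rfl) t h3 y h1 b hb
    have h4 := hll t h3 y hy h2 b' hb'
    have h5 : -C0 ≤ nb R b := by linarith
    have h6 : -(N * C0) ≤ N * nb R b := by
      have : (0:ℝ) ≤ N := by positivity
      nlinarith
    rw [hvol] at hvb
    have := le_abs_self C3
    linarith
  · intro Λ hΛ t
    have hΛ0' : 0 ≤ Λ := (abs_nonneg (c s0 (Classical.arbitrary ι))).trans (hΛ _ _)
    have hX : 0 ≤ |C3| + N * C0 := by positivity
    have h0 := mul_nonneg hX (by linarith : 0 ≤ 1 + Λ)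
    have h1 := mul_nonneg hC1 hΛ0'
    have h2 := mul_nonneg hC2 hΛ0'
    rw [abs_le]
    constructor
    · have : -(C1 + n1 * Λ) ≤ lam t := le_csInf (hTne _ (hVne _ (by omega))) (hTlow _ Λ hΛ)
      nlinarith
    · obtain ⟨x, hx, hxl⟩ := hTup (V (min t (N-1))) (hVne _ (by omega)) Λ hΛ
      have : lam t ≤ x := csInf_le (hTbdd _) hx
      nlinarith

variable {R A B}

lemma Gr.span {c C g b V lam} (h : Gr R A c C g b V lam) (t : ℕ) : V t ≤ Submodule.span K (g '' {l | l < t}) := by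
  induction t with
  | zero => rw [h.V0]; exact bot_le
  | succ t ih =>
    rw [h.Vs]
    refine sup_le (ih.trans (Submodule.span_mono (Set.image_mono fun l (hl : l < t) => Nat.lt_succ_of_lt hl))) ?_
    refine Submodule.span_mono ?_
    rintro _ rfl
    exact ⟨t, Nat.lt_succ_self t, rfl⟩

lemma Gr.det_ne {c C g b V lam} (h : Gr R A c C g b V lam) (φ : ι ≃ Fin (Fintype.card ι)) :
    (Matrix.of fun l i => g (φ l) i).det ≠ 0 := by
  have h1 : ⊤ ≤ Submodule.span K (Set.range fun l : ι => g (φ l)) := by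
    rw [← h.Vt]
    refine (h.span _).trans (Submodule.span_mono ?_)
    rintro _ ⟨l, hl, rfl⟩
    exact ⟨φ.symm ⟨l, hl⟩, by simp⟩
  have h2 := linearIndependent_of_top_le_span_of_card_eq_finrank h1 (by simp)
  have h3 : IsUnit (Matrix.of fun l i => g (φ l) i) := Matrix.linearIndependent_rows_iff_isUnit.1 h2
  exact ((Matrix.isUnit_iff_isUnit_det _).1 h3).ne_zero

lemma detA (hBA : ∀ s, B s * A s = 1) (v : AbsoluteValue K ℝ) (s : S) : v ((A s).map (Int.castRingHom K)).det = 1 := by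
  have h1 : (A s).det * (B s).det = 1 := by rw [mul_comm, ← Matrix.det_mul, hBA, Matrix.det_one]
  have h2 : ((A s).map (Int.castRingHom K)).det = ((A s).det : K) := by
    rw [← RingHom.mapMatrix_apply, ← RingHom.map_det]; rfl
  rw [h2]
  rcases Int.isUnit_iff.1 (IsUnit.of_mul_eq_one _ h1) with h | h <;> simp [h]

lemma det_O (O : Subring K) (M : Matrix ι ι K) (h : ∀ i j, M i j ∈ O) : M.det ∈ O := by
  rw [Matrix.det_apply]
  exact O.sum_mem fun σ _ => by
    rw [Units.smul_def]; exact O.zsmul_mem (O.prod_mem fun i _ => h _ _) _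

lemma Gr.hadamard {c C g b V lam} (hBA : ∀ s, B s * A s = 1) (h : Gr R A c C g b V lam) :
    vol R c ≤ ∑ t ∈ range (Fintype.card ι), lam t + Fintype.card ι + (∑ s, R.n s) * Real.log (Fintype.card ι).factorial := by
  set N := Fintype.card ι with hN
  have φ : ι ≃ Fin N := Fintype.equivFin ι
  set M : Matrix ι ι K := Matrix.of fun l i => g (φ l) i with hM
  have hdet := h.det_ne φ
  have h1 := R.liou _ (det_O R.O M fun i j => h.gO _ (φ i).2 _) hdet
  have h2 : ∀ s, Real.log (R.v s M.det) ≤ Real.log N.factorial + (∑ l, b (φ l) s - ∑ i, c s i) := by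
    intro s
    have h3 : R.v s M.det = R.v s (M * ((A s).map (Int.castRingHom K)).transpose).det := by
      rw [Matrix.det_mul, Matrix.det_transpose, (R.v s).map_mul, detA hBA, mul_one]
    have h4 := det_bound (R.v s) (M * ((A s).map (Int.castRingHom K)).transpose) (fun l => b (φ l) s) (c s) (by
      intro l i
      have h5 := h.gH _ (φ l).2 s i
      convert h5 using 2
      rw [Matrix.mul_apply, Matrix.mulVec, dotProduct]
      exact sum_congr rfl fun j _ => by rw [Matrix.transpose_apply, mul_comm]; rfl)
    rw [← h3] at h4
    have h6 := Real.log_le_log ((R.v s).pos hdet) h4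
    rwa [Real.log_mul (by positivity) (Real.exp_pos _).ne', Real.log_exp] at h6
  have h7 : 0 ≤ ∑ s, R.n s * (Real.log N.factorial + (∑ l, b (φ l) s - ∑ i, c s i)) :=
    h1.trans (sum_le_sum fun s _ => mul_le_mul_of_nonneg_left (h2 s) (R.hn s).le)
  have h8 : ∑ s, R.n s * ∑ l, b (φ l) s = ∑ t ∈ range N, nb R (b t) := by
    simp only [mul_sum]
    rw [sum_comm, Finset.sum_range, ← Equiv.sum_comp φ]
    rfl
  have h9 : ∑ t ∈ range N, nb R (b t) ≤ ∑ t ∈ range N, lam t + N := by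
    have := sum_le_sum fun t ht => h.gb t (mem_range.1 ht)
    simpa [sum_add_distrib] using this
  simp only [mul_add, mul_sub, sum_add_distrib, sum_sub_distrib, h8, ← sum_mul] at h7
  unfold vol
  linarith

end G
end Sub
end

noncomputable section
open Finset
namespace Sub

section G
variable {ι : Type*} [Fintype ι] [DecidableEq ι] {K : Type*} [Field K] {S : Type*} [Fintype S] [DecidableEq S]
variable {R : Ar K S} {A B : S → Matrix ι ι ℤ}

lemma span_eq_of_mem {p g : ι → K} (h : g ∈ Submodule.span K {p}) (h0 : g ≠ 0) : Submodule.span K {g} = Submodule.span K {p} := by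
  obtain ⟨a, rfl⟩ := Submodule.mem_span_singleton.1 h
  have ha : a ≠ 0 := fun h => h0 (by simp [h])
  exact Submodule.span_singleton_smul_eq (IsUnit.mk0 a ha) p

lemma adj_O (O : Subring K) (M : Matrix ι ι K) (h : ∀ i j, M i j ∈ O) (i j) : M.adjugate i j ∈ O := by
  rw [Matrix.adjugate_apply]
  refine det_O O _ fun a b => ?_
  rw [Matrix.updateRow_apply]
  split_ifs
  · by_cases hb : b = i
    · subst hb; simp [O.one_mem]
    · simp [hb, O.zero_mem]
  · exact h _ _

/-- dual bounds -/
lemma Gr.dual {c C g b V lam} (hBA : ∀ s, B s * A s = 1) (h : Gr R A c C g b V lam) (φ : ι ≃ Fin (Fintype.card ι)) (s l i) :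
    R.v s (((Matrix.of fun l i => g (φ l) i).adjugate.transpose * (B s).map (Int.castRingHom K)) l i) ≤
      Real.exp (∑ m ∈ univ.erase l, b (φ m) s - ∑ i, c s i + Real.log (Fintype.card ι).factorial + c s i) := by
  set M : Matrix ι ι K := Matrix.of fun l i => g (φ l) i with hM
  set AK : Matrix ι ι K := (A s).map (Int.castRingHom K) with hAK
  set BK : Matrix ι ι K := (B s).map (Int.castRingHom K) with hBK
  have hBA' : BK * AK = 1 := by rw [hBK, hAK, ← Matrix.map_mul, hBA, Matrix.map_one _ (map_zero _) (map_one _)]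
  have hAB' : AK * BK = 1 := mul_eq_one_comm.1 hBA'
  have hadj : AK.adjugate = AK.det • BK := by
    calc AK.adjugate = AK.adjugate * (AK * BK) := by rw [hAB', mul_one]
      _ = _ := by rw [← mul_assoc, Matrix.adjugate_mul, Matrix.smul_mul, one_mul]
  have h1 : (M * AK.transpose).adjugate.transpose = AK.det • (M.adjugate.transpose * BK) := by
    rw [Matrix.adjugate_mul_distrib, Matrix.transpose_mul, ← Matrix.adjugate_transpose AK, Matrix.transpose_transpose, hadj, Matrix.mul_smul]
  have h2 : R.v s ((M.adjugate.transpose * BK) l i) = R.v s ((M * AK.transpose).adjugate i l) := by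
    rw [← Matrix.transpose_apply (M * AK.transpose).adjugate, h1, Matrix.smul_apply, smul_eq_mul, (R.v s).map_mul, detA hBA, one_mul]
  rw [h2, Matrix.adjugate_apply]
  refine (det_bound (R.v s) _ (Function.update (fun m => b (φ m) s) l (c s i)) (c s) ?_).trans ?_
  · intro m j
    rw [Matrix.updateRow_apply]
    by_cases hm : m = l
    · subst hm
      by_cases hj : j = i
      · subst hj; simp
      · simp [hj, Real.exp_nonneg]
    · rw [if_neg hm, Function.update_of_ne hm]
      have h5 := h.gH _ (φ m).2 s j
      convert h5 using 2
      rw [Matrix.mul_apply, Matrix.mulVec, dotProduct]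
      exact sum_congr rfl fun j _ => by rw [Matrix.transpose_apply, mul_comm]; rfl
  · have e1 : ∑ m, Function.update (fun m => b (φ m) s) l (c s i) m = c s i + ∑ m ∈ univ.erase l, b (φ m) s := by
      rw [← add_sum_erase univ _ (mem_univ l), Function.update_self]
      congr 1
      exact sum_congr rfl fun m hm => Function.update_of_ne (ne_of_mem_erase hm) _ _
    rw [e1, show ∑ m ∈ univ.erase l, b (φ m) s - ∑ i, c s i + Real.log (Fintype.card ι).factorial + c s i =
      Real.log (Fintype.card ι).factorial + (c s i + ∑ m ∈ univ.erase l, b (φ m) s - ∑ i, c s i) by ring, Real.exp_add, Real.exp_log (by positivity)]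

theorem stepA (hBA : ∀ s, B s * A s = 1) (hM : Mink R A) (s0 : S) (hN2 : 2 ≤ Fintype.card ι) : ∃ C, 0 < C ∧
    ∀ (c : S → ι → ℝ) (Λ : ℝ), (∀ s i, |c s i| ≤ Λ) → ∀ (p : ι → K) (hp : S → ℝ) (G : ℝ), (∀ i, p i ∈ R.O) → p ≠ 0 → Ht R A c p hp →
    (∀ y, (∀ i, y i ∈ R.O) → y ∉ Submodule.span K {p} → ∀ b, Ht R A c y b → nb R hp + G ≤ nb R b) → C ≤ G →
    ∃ (c'' : S → ι → ℝ) (ξ : Matrix ι ι K) (β : ι → S → ℝ) (l1 : ι), (∀ s i, |c'' s i| ≤ C * (1 + Λ)) ∧ vol R c'' ≤ -G + C ∧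
      (∀ l i, ξ l i ∈ R.O) ∧ ξ.det ≠ 0 ∧ (∀ l, l ≠ l1 → ξ.mulVec p l = 0) ∧
      (∀ l s i, R.v s ((ξ * (B s).map (Int.castRingHom K)) l i) ≤ Real.exp (β l s + c'' s i)) ∧
      (∀ l, l ≠ l1 → ∑ s, R.n s * β l s ≤ 0) ∧ ∑ s, R.n s * β l1 s ≤ C * (1 + Λ) := by
  haveI : Nonempty ι := Fintype.card_pos_iff.1 (by omega)
  obtain ⟨C1, hC1, gr⟩ := greedy R A B hBA hM s0
  obtain ⟨C0, hC0, tw⟩ := twist R A s0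
  have hspan1 : ∀ c C g b V lam, Gr R A c C g b V lam → ∀ p, g 0 ∈ Submodule.span K {p} → V 1 = Submodule.span K {p} := by
    intro c C g b V lam h p hg
    rw [h.Vs 0, h.V0, bot_sup_eq]
    exact span_eq_of_mem hg fun h0 => h.gV 0 (by omega) (by rw [h0]; exact (V 0).zero_mem)
  have hgr_had := fun c C g b V lam (h : Gr R A c C g b V lam) => h.hadamard hBA
  have hgr_dual := fun c C g b V lam (h : Gr R A c C g b V lam) φ => h.dual hBA φ
  have hgr_det := fun c C g b V lam (h : Gr R A c C g b V lam) φ => h.det_ne φ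
  set N := Fintype.card ι with hN
  have φ : ι ≃ Fin N := Fintype.equivFin ι
  set n1 := ∑ s, R.n s with hn1
  have hn1p : 0 < n1 := sum_pos (fun s _ => R.hn s) ⟨s0, mem_univ _⟩
  have hn0 := R.hn s0
  set F := n1 * Real.log N.factorial with hF
  have hF0 : 0 ≤ F := mul_nonneg hn1p.le (Real.log_nonneg (by exact_mod_cast Nat.factorial_pos N))
  set X := C1 + N + F + C0 with hX
  have hX0 : 0 ≤ X := by positivity
  set D := 1 + C1 / R.n s0 with hD
  have hD0 : 0 ≤ D := by positivity
  have hNX : 0 ≤ N * X := by positivity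
  have hXn : 0 ≤ X / n1 := by positivity
  have hCD : 0 ≤ C1 * D := by positivity
  refine ⟨D + X / n1 + X + C1 * D + N + F + 1 + N * X + 3 + C0, by positivity, ?_⟩
  intro c Λ hΛ p hp G hpO hp0 hpH hgap hG
  have hΛ0 : 0 ≤ Λ := (abs_nonneg (c s0 (Classical.arbitrary ι))).trans (hΛ _ _)
  obtain ⟨g, b, V, lam, h⟩ := gr c
  have hl0 : lam 0 ≤ nb R hp := h.ll 0 (by omega) p hpO (by rw [h.V0]; simpa using hp0) hp hpH
  have hN0 : (0:ℝ) ≤ N := by positivity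
  have hg0 : g 0 ∈ Submodule.span K {p} := by
    by_contra hcon
    have := hgap (g 0) (h.gO 0 (by omega)) hcon (b 0) (h.gH 0 (by omega))
    have := h.gb 0 (by omega)
    linarith
  have hV1 := hspan1 _ _ _ _ _ _ h p hg0
  have hl1 : nb R hp + G - 1 ≤ lam 1 := by
    have h1 := hgap (g 1) (h.gO 1 (by omega)) (by rw [← hV1]; exact h.gV 1 (by omega)) (b 1) (h.gH 1 (by omega))
    have := h.gb 1 (by omega)
    linarith
  obtain ⟨pos, htw⟩ := tw c V h.Vm h.Vf
  set ρ : ℕ → ℝ := fun t => lam (max t 1) with hρ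
  have hρm : Monotone ρ := fun t u htu => h.lm (max_le_max_right _ htu)
  set c'' : S → ι → ℝ := fun s i => c s i - (if s = s0 then ρ (pos i) / R.n s0 else 0) with hc''
  have hvol : vol R c'' ≤ N + F + 1 - G := by
    have e1 : vol R c'' = vol R c - ∑ t ∈ range N, ρ t := by
      simp only [vol, hc'', sum_sub_distrib, mul_sub]
      congr 1
      rw [sum_eq_single s0]
      · simp only [if_true]
        rw [mul_sum, Finset.sum_range, ← Equiv.sum_comp pos]
        refine sum_congr rfl fun i _ => ?_
        have := hn0.ne'
        field_simp
      · intro s _ hs; simp [hs]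
      · simp
    have e2 : ∑ t ∈ range N, ρ t = ∑ t ∈ range N, lam t - lam 0 + lam 1 := by
      obtain ⟨k, hk⟩ : ∃ k, N = k + 1 := ⟨N - 1, by omega⟩
      rw [hk, sum_range_succ', sum_range_succ']
      have : ∀ t, ρ (t+1) = lam (t+1) := fun t => by simp [hρ]
      simp only [this]
      simp [hρ]
    have := hgr_had _ _ _ _ _ _ h
    linarith
  have hlow : ∀ y, (∀ i, y i ∈ R.O) → y ∉ Submodule.span K {p} → ∀ b, Ht R A c'' y b → -C0 ≤ nb R b := by
    intro y hyO hy b hb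
    have hex : ∃ t, y ∈ V t := ⟨N, by rw [h.Vt]; trivial⟩
    classical
    have hfind : 1 < Nat.find hex := by
      by_contra hcon
      apply hy
      rw [← hV1]
      exact h.Vm (not_lt.1 hcon) (Nat.find_spec hex)
    obtain ⟨t, ht⟩ : ∃ t, Nat.find hex = t + 1 := ⟨Nat.find hex - 1, by omega⟩
    have h1 : y ∈ V (t+1) := ht ▸ Nat.find_spec hex
    have h2 : y ∉ V t := Nat.find_min hex (by omega)
    have h3 : t < N := by
      have : Nat.find hex ≤ N := Nat.find_min' hex (by rw [h.Vt]; trivial)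
      omega
    obtain ⟨b', hb', hbb⟩ := htw ρ hρm c'' (fun s i => rfl) t h3 y h1 b hb
    have h4 := h.ll t h3 y hyO h2 b' hb'
    have h5 : ρ t = lam t := by simp only [hρ]; rw [max_eq_left (by omega)]
    linarith
  have hp'' : Ht R A c'' p (fun s => hp s - if s = s0 then lam 1 / R.n s0 else 0) := by
    intro s i
    refine (hpH s i).trans (Real.exp_le_exp.2 ?_)
    simp only [hc'']
    by_cases hs : s = s0
    · have : lam 1 / R.n s0 ≤ ρ (pos i) / R.n s0 := by
        have := h.lm (le_max_right (pos i : ℕ) 1)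
        gcongr
      simp only [hs, if_true]; linarith
    · simp [hs]
  have hnbp : nb R (fun s => hp s - if s = s0 then lam 1 / R.n s0 else 0) = nb R hp - lam 1 := by
    unfold nb
    simp only [mul_sub, sum_sub_distrib, mul_ite, mul_zero, sum_ite_eq', mem_univ, if_true]
    have := hn0.ne'
    field_simp
  obtain ⟨g', b', V', lam', h'⟩ := gr c''
  have hl0' := h'.ll 0 (by omega) p hpO (by rw [h'.V0]; simpa using hp0) _ hp''
  rw [hnbp] at hl0'
  have hg0' : g' 0 ∈ Submodule.span K {p} := by
    by_contra hcon
    have h1 := hlow (g' 0) (h'.gO 0 (by omega)) hcon (b' 0) (h'.gH 0 (by omega))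
    have h2 := h'.gb 0 (by omega)
    linarith
  have hV1' := hspan1 _ _ _ _ _ _ h' p hg0'
  have hbl : ∀ t < N, 1 ≤ t → -C0 ≤ nb R (b' t) := fun t ht h1 =>
    hlow (g' t) (h'.gO t ht) (by rw [← hV1']; exact fun hm => h'.gV t ht (h'.Vm h1 hm)) _ (h'.gH t ht)
  have hΛ'' : ∀ s i, |c'' s i| ≤ Λ + C1 * (1 + Λ) / R.n s0 := by
    intro s i
    refine (abs_sub _ _).trans (add_le_add (hΛ s i) ?_)
    split_ifs
    · rw [abs_div, abs_of_pos hn0]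
      have := h.lb Λ hΛ (max (pos i) 1)
      gcongr
    · rw [abs_zero]; positivity
  have hDΛ : 1 + (Λ + C1 * (1 + Λ) / R.n s0) = D * (1 + Λ) := by rw [hD]; ring
  have hb0 : -(C1 * (D * (1 + Λ))) ≤ nb R (b' 0) := by
    have h1 := h'.ll 0 (by omega) (g' 0) (h'.gO 0 (by omega)) (h'.gV 0 (by omega)) _ (h'.gH 0 (by omega))
    have h2 := (abs_le.1 (h'.lb _ hΛ'' 0)).1
    rw [hDΛ] at h2
    linarith
  have hsum : ∑ l, nb R (b' (φ l)) ≤ vol R c'' + C1 + N := by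
    have e1 : ∑ l, nb R (b' (φ l)) = ∑ t ∈ range N, nb R (b' t) := by
      rw [Finset.sum_range, ← Equiv.sum_comp φ]
    have e2 := sum_le_sum fun t ht => h'.gb t (mem_range.1 ht)
    simp only [sum_add_distrib, sum_const, card_range, nsmul_eq_mul, mul_one] at e2
    have := h'.ls
    rw [e1]; linarith
  set M : Matrix ι ι K := Matrix.of fun l i => g' (φ l) i with hM
  set β : ι → S → ℝ := fun l s => ∑ m ∈ univ.erase l, b' (φ m) s - ∑ i, c'' s i + Real.log N.factorial - X / n1 with hβ
  have hnβ : ∀ l, ∑ s, R.n s * β l s = ∑ m, nb R (b' (φ m)) - nb R (b' (φ l)) - vol R c'' + F - X := by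
    intro l
    simp only [hβ, mul_sub, mul_add, sum_sub_distrib, sum_add_distrib, ← sum_mul]
    rw [mul_div_cancel₀ _ hn1p.ne']
    congr 3
    rw [← add_sum_erase univ _ (mem_univ l), add_sub_cancel_left]
    simp only [nb, mul_sum]
    rw [sum_comm]
  refine ⟨fun s i => c'' s i + X / n1, M.adjugate.transpose, β, φ.symm ⟨0, by omega⟩, ?_, ?_, ?_, ?_, ?_, ?_, ?_, ?_⟩
  · intro s i
    refine (abs_add_le _ _).trans ?_
    rw [abs_of_nonneg hXn]
    have h1 := hΛ'' s i
    have h2 : X / n1 ≤ X / n1 * (1 + Λ) := le_mul_of_one_le_right hXn (by linarith)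
    have h3 : 0 ≤ (X + C1 * D + N + F + 1 + N * X + 3 + C0) * (1 + Λ) := by positivity
    linarith
  · have e1 : vol R (fun s i => c'' s i + X / n1) = vol R c'' + N * X := by
      simp only [vol, sum_add_distrib, mul_add, sum_const, card_univ, nsmul_eq_mul, ← sum_mul]
      rw [← hn1, ← hN]
      field_simp
    rw [e1]
    linarith
  · intro l i
    exact adj_O R.O M (fun i j => h'.gO _ (φ i).2 _) i l
  · rw [Matrix.det_transpose, Matrix.det_adjugate]
    exact pow_ne_zero _ (hgr_det _ _ _ _ _ _ h' φ)
  · intro l hl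
    obtain ⟨a, ha⟩ : ∃ a : K, a • g' 0 = p := by
      have : p ∈ Submodule.span K {g' 0} := by
        rw [span_eq_of_mem hg0' (fun h0 => h'.gV 0 (by omega) (by rw [h0]; exact (V' 0).zero_mem))]
        exact Submodule.mem_span_singleton_self p
      exact Submodule.mem_span_singleton.1 this
    have e1 : (M * M.adjugate) (φ.symm ⟨0, by omega⟩) l = 0 := by
      rw [Matrix.mul_adjugate, Matrix.smul_apply, Matrix.one_apply_ne hl.symm, smul_zero]
    rw [← ha, Matrix.mulVec_smul, Pi.smul_apply]
    suffices M.adjugate.transpose.mulVec (g' 0) l = 0 by rw [this, smul_zero]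
    rw [← e1, Matrix.mul_apply, Matrix.mulVec, dotProduct]
    exact sum_congr rfl fun i _ => by simp [hM, mul_comm]
  · intro l s i
    refine (hgr_dual _ _ _ _ _ _ h' φ s l i).trans (le_of_eq ?_)
    congr 1
    simp only [hβ]; ring
  · intro l hl
    rw [hnβ]
    have h1 : 1 ≤ (φ l : ℕ) := by
      by_contra hcon
      apply hl
      rw [Equiv.eq_symm_apply]
      exact Fin.ext (by show (φ l : ℕ) = 0; omega)
    have := hbl (φ l) (φ l).2 h1
    linarith
  · rw [hnβ]
    simp only [Equiv.apply_symm_apply]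
    have h3 : 0 ≤ (D + X / n1 + X + N + F + 1 + N * X + 3 + C0) * (1 + Λ) := by positivity
    linarith

end G
end Sub
end

noncomputable section
open Finset
namespace Sub

section G
variable {ι : Type*} [Fintype ι] [DecidableEq ι] {K : Type*} [Field K] {S : Type*} [Fintype S] [DecidableEq S]
variable {R : Ar K S} {A B : S → Matrix ι ι ℤ}

theorem geo_contra [CharZero K] (hBA : ∀ s, B s * A s = 1) (hM : Mink R A) (s0 : S) (a b : ι) (hab : a ≠ b)
    (c : ℕ → S → ι → ℝ) (H : ℕ → ℝ) (hH : Filter.Tendsto H Filter.atTop Filter.atTop)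
    (p : ℕ → ι → K) (hp : ℕ → S → ℝ) (C' ε κ : ℝ) (hC' : 0 ≤ C') (hε : 0 < ε) (hκ : 0 < κ)
    (hc : ∀ m s i, |c m s i| ≤ C' * H m) (hpO : ∀ m i, p m i ∈ R.O) (hpa : ∀ m, p m a ≠ 0) (hpH : ∀ m, Ht R A (c m) (p m) (hp m))
    (hgap : ∀ m y, (∀ i, y i ∈ R.O) → y ∉ Submodule.span K {p m} → ∀ b', Ht R A (c m) y b' → nb R (hp m) + ε * H m ≤ nb R b')
    (hk : ∀ m, κ * H m ≤ hh R.v R.n (-(p m b / p m a))) : False := by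
  have hcard : 2 ≤ Fintype.card ι := by
    exact Fintype.one_lt_card_iff_nontrivial.2 ⟨a, b, hab⟩
  obtain ⟨C, hC, hA⟩ := stepA hBA hM s0 hcard
  -- bound
  obtain ⟨m0, hm0⟩ : ∃ m0, ∀ m ≥ m0, 1 ≤ H m ∧ 2 * C / ε ≤ H m := by
    have := (hH.eventually_ge_atTop 1).and (hH.eventually_ge_atTop (2 * C / ε))
    exact Filter.eventually_atTop.1 this
  have hA' : ∀ m : ℕ, ∃ (c'' : S → ι → ℝ) (ξ : Matrix ι ι K) (β : ι → S → ℝ) (l1 : ι), (∀ s i, |c'' s i| ≤ C * (1 + C') * H (m0 + m)) ∧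
      vol R c'' ≤ -(ε/2) * H (m0 + m) ∧
      (∀ l i, ξ l i ∈ R.O) ∧ ξ.det ≠ 0 ∧ (∀ l, l ≠ l1 → ξ.mulVec (p (m0 + m)) l = 0) ∧
      (∀ l s i, R.v s ((ξ * (B s).map (Int.castRingHom K)) l i) ≤ Real.exp (β l s + c'' s i)) ∧
      (∀ l, l ≠ l1 → ∑ s, R.n s * β l s ≤ 0) ∧ ∑ s, R.n s * β l1 s ≤ C * (1 + C') * H (m0 + m) := by
    intro m
    obtain ⟨h1, h2⟩ := hm0 (m0 + m) (by omega)
    rw [div_le_iff₀ hε] at h2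
    obtain ⟨c'', ξ, β, l1, k1, k2, k3, k4, k5, k6, k7, k8⟩ := hA (c (m0+m)) (C' * H (m0 + m)) (hc _) (p (m0+m)) (hp (m0+m)) (ε * H (m0+m))
      (hpO _) (fun h => hpa (m0+m) (by rw [h]; rfl)) (hpH _) (hgap _) (by linarith)
    have h3 : C * (1 + C' * H (m0 + m)) ≤ C * (1 + C') * H (m0 + m) := by
      have : 1 + C' * H (m0 + m) ≤ (1 + C') * H (m0 + m) := by nlinarith
      rw [mul_assoc]; gcongr
    exact ⟨c'', ξ, β, l1, fun s i => (k1 s i).trans h3, by linarith, k3, k4, k5, k6, k7, k8.trans h3⟩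
  choose c'' ξ β l1 k1 k2 k3 k4 k5 k6 k7 k8 using hA'
  set H' : ℕ → ℝ := fun m => H (m0 + m) with hH'
  have hH'p : ∀ m, 1 ≤ H' m := fun m => (hm0 (m0 + m) (by omega)).1
  have hH't : Filter.Tendsto H' Filter.atTop Filter.atTop := by
    refine hH.comp ?_
    exact Filter.tendsto_atTop_mono (fun m => Nat.le_add_left m m0) Filter.tendsto_id
  set C2 := C * (1 + C') with hC2
  have hC20 : 0 < C2 := by positivity
  set q : ℕ → S → ι → ℝ := fun m s i => c'' m s i / H' m with hq
  have hqb : ∀ m, q m ∈ Metric.closedBall (0 : S → ι → ℝ) C2 := by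
    intro m
    rw [mem_closedBall_zero_iff, pi_norm_le_iff_of_nonneg hC20.le]
    intro s
    rw [pi_norm_le_iff_of_nonneg hC20.le]
    intro i
    have := hH'p m
    rw [Real.norm_eq_abs, abs_div, abs_of_pos (by linarith : 0 < H' m), div_le_iff₀ (by linarith)]
    exact k1 m s i
  obtain ⟨cs, _, θ, hθ, hlim⟩ := (isCompact_closedBall (0 : S → ι → ℝ) C2).tendsto_subseq hqb
  have hlim' : ∀ s i, Filter.Tendsto (fun m => q (θ m) s i) Filter.atTop (nhds (cs s i)) := fun s i =>
    (tendsto_pi_nhds.1 ((tendsto_pi_nhds.1 hlim) s)) i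
  have hcs : ∑ s, R.n s * ∑ i, cs s i ≤ -(ε/2) := by
    have h1 : Filter.Tendsto (fun m => ∑ s, R.n s * ∑ i, q (θ m) s i) Filter.atTop (nhds (∑ s, R.n s * ∑ i, cs s i)) :=
      tendsto_finset_sum _ fun s _ => (tendsto_finset_sum _ fun i _ => hlim' s i).const_mul _
    refine le_of_tendsto h1 (Filter.Eventually.of_forall fun m => ?_)
    have h2 := k2 (θ m)
    have h3 := hH'p (θ m)
    have h4 : ∑ s, R.n s * ∑ i, q (θ m) s i = vol R (c'' (θ m)) / H' (θ m) := by
      simp only [hq, vol, ← sum_div, ← mul_div_assoc]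
    rw [h4, div_le_iff₀ (by linarith)]
    exact h2
  obtain ⟨δ, hδ, k, Rr, hRr, hmain⟩ := main_contra R A B hBA a b hab cs (ε/2) (by positivity) hcs C2 κ (by positivity) (by positivity)
  have hev : ∀ᶠ m in Filter.atTop, ∀ s i, q (θ m) s i ≤ cs s i + δ := by
    rw [Filter.eventually_all]; intro s
    rw [Filter.eventually_all]; intro i
    exact (hlim' s i).eventually_le_const (by linarith)
  have hHθ := hH't.comp hθ.tendsto_atTop
  have hgood : ∀ᶠ m in Filter.atTop, Pt R B a b cs δ C2 κ (H' (θ m)) (p (m0 + θ m)) := by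
    filter_upwards [hev] with m hm
    have h3 := hH'p (θ m)
    refine ⟨c'' (θ m), ξ (θ m), β (θ m), l1 (θ m), hpa _, fun s i => ?_, k3 _, k4 _, k5 _, k6 _, k7 _, k8 _, hk _⟩
    have := hm s i
    simp only [hq] at this
    rw [div_le_iff₀ (by linarith)] at this
    linarith
  obtain ⟨f, hf1, hf2⟩ := exists_seq_of_forall_finset_exists
    (fun m => Pt R B a b cs δ C2 κ (H' (θ m)) (p (m0 + θ m)) ∧ Rr ≤ H' (θ m)) (fun x y => Rr * H' (θ x) ≤ H' (θ y)) (by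
      intro s hs
      have h1 : ∀ᶠ m in Filter.atTop, ∀ x ∈ s, Rr * H' (θ x) ≤ H' (θ m) := by
        rw [Filter.eventually_all_finset]
        intro x _
        exact hHθ.eventually_ge_atTop _
      obtain ⟨m, h2, h3, h4⟩ := (h1.and (hgood.and (hHθ.eventually_ge_atTop Rr))).exists
      exact ⟨m, ⟨h3, h4⟩, h2⟩)
  exact hmain (fun j => H' (θ (f (Fin.rev j)))) (fun j => p (m0 + θ (f (Fin.rev j)))) (fun j => (hf1 _).1) (fun j => (hf1 _).2)
    (fun i j hij => hf2 _ _ (Fin.lt_def.1 (Fin.rev_lt_rev.2 hij)))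

end G
end Sub
end

noncomputable section
open Finset
namespace Sub

section G
variable {J : Type} [Fintype J] [DecidableEq J] {K : Type} [Field K] {S : Type} [Fintype S] [DecidableEq S]
variable (R : Ar K S)

def UU (x : K) : Prop := x ≠ 0 ∧ x ∈ R.O ∧ x⁻¹ ∈ R.O

variable {R}
lemma UU.div {x y : K} (hx : UU R x) (hy : UU R y) : UU R (x / y) :=
  ⟨div_ne_zero hx.1 hy.1, by rw [div_eq_mul_inv]; exact R.O.mul_mem hx.2.1 hy.2.2, by
    rw [inv_div, div_eq_mul_inv]; exact R.O.mul_mem hy.2.1 hx.2.2⟩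

lemma UU.sum {x : K} (hx : UU R x) : ∑ s, R.n s * Real.log (R.v s x) = 0 := by
  refine le_antisymm ?_ (R.liou x hx.2.1 hx.1)
  have := R.liou _ hx.2.2 (inv_ne_zero hx.1)
  simp only [map_inv₀, Real.log_inv, mul_neg, sum_neg_distrib] at this
  linarith

lemma hh_mul (x y : K) : hh R.v R.n (x * y) ≤ hh R.v R.n x + hh R.v R.n y := by
  unfold hh
  rw [← sum_add_distrib]
  refine sum_le_sum fun s _ => ?_
  rw [← mul_add]
  refine mul_le_mul_of_nonneg_left ?_ (R.hn s).le
  have h1 : 1 ≤ max 1 (R.v s x) := le_max_left _ _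
  have h2 : 1 ≤ max 1 (R.v s y) := le_max_left _ _
  rw [← Real.log_mul (by linarith) (by linarith)]
  refine Real.log_le_log (by positivity) (max_le (one_le_mul_of_one_le_of_one_le h1 h2) ?_)
  rw [(R.v s).map_mul]
  exact mul_le_mul (le_max_right _ _) (le_max_right _ _) ((R.v s).nonneg _) (by linarith)

lemma hh_div_le (x y : K) (hx : x ≠ 0) (hy0 : y ≠ 0) (hy : y ∈ R.O) (b : S → ℝ) (h1 : ∀ s, R.v s x ≤ Real.exp (b s)) (h2 : ∀ s, R.v s y ≤ Real.exp (b s)) :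
    hh R.v R.n (x / y) ≤ nb R b := by
  have h3 := R.liou y hy hy0
  have h4 : hh R.v R.n (x / y) ≤ ∑ s, R.n s * (b s - Real.log (R.v s y)) := by
    refine sum_le_sum fun s _ => mul_le_mul_of_nonneg_left ?_ (R.hn s).le
    have hp := (R.v s).pos hy0
    rw [Real.log_le_iff_le_exp (by positivity), Real.exp_sub, Real.exp_log hp, map_div₀]
    exact max_le ((one_le_div hp).2 (h2 s)) (by have := h1 s; gcongr)
  simp only [mul_sub, sum_sub_distrib] at h4
  unfold nb
  linarith

lemma hh_neg (x : K) : hh R.v R.n (-x) = hh R.v R.n x := by simp [hh]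

variable (R)

def NB (I : Finset J) (Q : (J → K) → Prop) (c C ε H0 : ℝ) : Prop :=
  ∀ (x z : J → K) (b : S → ℝ) (H : ℝ), 0 < H → H0 ≤ H → Q x → (∀ i ∈ I, UU R (x i)) →
    (∀ i ∈ I, z i ∈ R.O ∧ z i ≠ 0 ∧ ∀ s, R.v s (z i) ≤ Real.exp (b s)) → nb R b ≤ ε * H → ∑ i ∈ I, z i * x i = 0 →
    (∀ i ∈ I, ∀ j ∈ I, i ≠ j → c * H ≤ hh R.v R.n (x i / x j)) → (∀ i ∈ I, ∀ s, |Real.log (R.v s (x i))| ≤ C * H) → False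

variable {R}

lemma NB.mono {I : Finset J} {Q : (J → K) → Prop} {c C ε H0 ε' H0' : ℝ} (h : NB R I Q c C ε H0) (hε : ε' ≤ ε) (hH : H0 ≤ H0') :
    NB R I Q c C ε' H0' := fun x z b H h0 h1 h2 h3 h4 h5 => h x z b H h0 (hH.trans h1) h2 h3 h4 (h5.trans (by gcongr))

lemma unif {α : Type} [Finite α] (P : α → ℝ → ℝ → Prop) (hP : ∀ a ε H ε' H', P a ε H → ε' ≤ ε → H ≤ H' → P a ε' H')
    (h : ∀ a, ∃ ε > 0, ∃ H, P a ε H) : ∃ ε > 0, ∃ H, ∀ a, P a ε H := by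
  cases nonempty_fintype α
  choose e he H hH using h
  by_cases hne : Nonempty α
  · obtain ⟨a0, ha0⟩ := Finite.exists_min e
    obtain ⟨a1, ha1⟩ := Finite.exists_max H
    exact ⟨e a0, he a0, H a1, fun a => hP a _ _ _ _ (hH a) (ha0 a) (ha1 a)⟩
  · exact ⟨1, one_pos, 0, fun a => (hne ⟨a⟩).elim⟩

/-- matrices -/
def Am {ι : Type} [DecidableEq ι] (k : Option ι) : Matrix ι ι ℤ := match k with
  | none => 1
  | some k => (1 : Matrix ι ι ℤ).updateRow k (fun _ => -1)

lemma Am_mulVec {ι : Type} [Fintype ι] [DecidableEq ι] {F : Type} [CommRing F] (k : Option ι) (y : ι → F) (i : ι) :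
    ((Am k).map (Int.castRingHom F)).mulVec y i = if k = some i then -∑ j, y j else y i := by
  cases k with
  | none => simp [Am]
  | some k =>
    by_cases h : k = i
    · subst h
      simp [Am, Matrix.mulVec, dotProduct]
    · have : some k ≠ some i := fun h' => h (Option.some_injective _ h')
      rw [if_neg this]
      simp [Am, Matrix.mulVec, dotProduct, Matrix.updateRow_apply, Ne.symm h, Matrix.one_apply]

lemma Am_sq {ι : Type} [Fintype ι] [DecidableEq ι] (k : Option ι) : Am k * Am k = 1 := by
  have hmap : (Am k).map (Int.castRingHom ℤ) = Am k := by ext; simp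
  have hA := fun (y : ι → ℤ) i => Am_mulVec k y i
  rw [hmap] at hA
  refine Matrix.ext_of_mulVec_single fun j => ?_
  rw [← Matrix.mulVec_mulVec, Matrix.one_mulVec]
  funext i
  rw [hA]
  by_cases h : k = some i
  · rw [if_pos h]
    subst h
    rw [← add_sum_erase univ _ (mem_univ i), hA, if_pos rfl, ← add_sum_erase univ _ (mem_univ i)]
    have : ∑ x ∈ univ.erase i, (Am (some i)).mulVec (Pi.single j 1) x = ∑ x ∈ univ.erase i, (Pi.single j 1 : ι → ℤ) x := by
      refine sum_congr rfl fun x hx => ?_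
      rw [hA, if_neg (fun h => (ne_of_mem_erase hx) (Option.some_injective _ h).symm)]
    rw [this]; ring
  · rw [if_neg h, hA, if_neg h]

end G
end Sub
end

noncomputable section
open Finset
namespace Sub

section G
variable {J : Type} [Fintype J] [DecidableEq J] {K : Type} [Field K] {S : Type} [Fintype S] [DecidableEq S]
variable {R : Ar K S}

lemma exp_log_v (v : AbsoluteValue K ℝ) {x : K} (hx : x ≠ 0) (b : ℝ) : Real.exp (b - -Real.log (v x)) = Real.exp b * v x := by
  rw [sub_neg_eq_add, Real.exp_add, Real.exp_log (v.pos hx)]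

lemma NB_step [CharZero K] (hM : ∀ (ι : Type) [Fintype ι] [DecidableEq ι] [Nonempty ι] (A B : S → Matrix ι ι ℤ), (∀ s, B s * A s = 1) → Mink R A) (s0 : S)
    (I : Finset J) (hI : 3 ≤ #I) (k : S → J) (hk : ∀ s, k s ∈ I) (c C : ℝ) (hc : 0 < c) (hC : 0 ≤ C)
    (IH : ∃ ε > 0, ∃ H0, ∀ I', I' ⊂ I → I'.Nonempty → NB R I' (fun _ => True) c C ε H0) :
    ∃ ε > 0, ∃ H0, NB R I (fun x => ∀ s, ∀ i ∈ I, R.v s (x i) ≤ R.v s (x (k s))) c C ε H0 := by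
  obtain ⟨ε1, hε1, H1, IH⟩ := IH
  obtain ⟨i0, hi0⟩ : I.Nonempty := card_pos.1 (by omega)
  obtain ⟨a, b, ha, hb, hab⟩ : ∃ a b, a ∈ I.erase i0 ∧ b ∈ I.erase i0 ∧ a ≠ b := by
    have : 1 < #(I.erase i0) := by rw [card_erase_of_mem hi0]; omega
    obtain ⟨a, ha, b, hb, h⟩ := one_lt_card.1 this
    exact ⟨a, b, ha, hb, h⟩
  set n1 := ∑ s, R.n s with hn1
  have hn10 : 0 ≤ n1 := sum_nonneg fun s _ => (R.hn s).le
  have hcard1 : (1:ℝ) ≤ #I := by exact_mod_cast (by omega : 1 ≤ #I)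
  set L := n1 * (Real.log 2 + Real.log #I) with hL
  by_contra hcon
  push Not at hcon
  set e0 := min (ε1 / 4) (c / 2) with he0
  have he0p : 0 < e0 := by positivity
  have hseq : ∀ m : ℕ, ∃ (x z : J → K) (b : S → ℝ) (H : ℝ), (m:ℝ) ≤ H ∧ H1 ≤ H ∧ 4 * L / ε1 ≤ H ∧ 0 < H ∧ (∀ s, ∀ i ∈ I, R.v s (x i) ≤ R.v s (x (k s))) ∧
      (∀ i ∈ I, UU R (x i)) ∧ (∀ i ∈ I, z i ∈ R.O ∧ z i ≠ 0 ∧ ∀ s, R.v s (z i) ≤ Real.exp (b s)) ∧ nb R b ≤ e0 * H ∧ ∑ i ∈ I, z i * x i = 0 ∧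
      (∀ i ∈ I, ∀ j ∈ I, i ≠ j → c * H ≤ hh R.v R.n (x i / x j)) ∧ (∀ i ∈ I, ∀ s, |Real.log (R.v s (x i))| ≤ C * H) := by
    intro m
    have h := hcon e0 he0p (max m (max H1 (4 * L / ε1)))
    unfold NB at h
    push Not at h
    obtain ⟨x, z, b, H, h1, h2, h3, h4, h5, h6, h7, h8, h9, _⟩ := h
    simp only [max_le_iff] at h2
    exact ⟨x, z, b, H, h2.1, h2.2.1, h2.2.2, h1, h3, h4, h5, h6, h7, h8, h9⟩
  choose x z bz H hHm hH1 hHL hHp hmax hU hz hbz hsum hlow hlog using hseq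
  -- index type
  let ι : Type := {i // i ∈ I.erase i0}
  let ks : S → Option ι := fun s => if h : k s ∈ I.erase i0 then some ⟨k s, h⟩ else none
  let A : S → Matrix ι ι ℤ := fun s => Am (ks s)
  let kk : S → ι → J := fun s i => if ks s = some i then i0 else i.1
  let ex : (ι → K) → J → K := fun y j => if h : j ∈ I.erase i0 then y ⟨j, h⟩ else -∑ i, y i
  have hkkI : ∀ s i, kk s i ∈ I := fun s i => by
    simp only [kk]; split_ifs
    · exact hi0
    · exact mem_of_mem_erase i.2
  have hex0 : ∀ y, ex y i0 = -∑ i, y i := fun y => by simp [ex]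
  have hexi : ∀ y (i : ι), ex y i.1 = y i := fun y i => by simp only [ex]; rw [dif_pos i.2]
  have hA : ∀ s (y : ι → K) i, ((A s).map (Int.castRingHom K)).mulVec y i = ex y (kk s i) := by
    intro s y i
    simp only [A]
    rw [Am_mulVec]
    simp only [kk]
    split_ifs
    · rw [hex0]
    · rw [hexi]
  have hkk : ∀ s, ∀ j ∈ I, j ≠ k s → ∃ i, kk s i = j := by
    intro s j hj hne
    by_cases h0 : j = i0
    · have h : k s ∈ I.erase i0 := mem_erase.2 ⟨fun h => hne (h0.trans h.symm), hk s⟩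
      refine ⟨⟨k s, h⟩, ?_⟩
      simp only [kk, ks]; rw [dif_pos h, if_pos rfl, h0]
    · refine ⟨⟨j, mem_erase.2 ⟨h0, hj⟩⟩, ?_⟩
      simp only [kk]; rw [if_neg]
      simp only [ks]
      split_ifs with h
      · intro h'
        have := Option.some_injective _ h'
        exact hne (congrArg Subtype.val this).symm
      · simp
  have hexsum : ∀ y, ∑ j ∈ I, ex y j = 0 := by
    intro y
    rw [← add_sum_erase I _ hi0, hex0, ← Finset.sum_coe_sort (I.erase i0)]
    have : ∑ i : I.erase i0, ex y i.1 = ∑ i : ι, y i := sum_congr rfl fun i _ => hexi y i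
    rw [this]; ring
  let p : ℕ → ι → K := fun m i => z m i.1 * x m i.1
  have hexp : ∀ m, ∀ j ∈ I, ex (p m) j = z m j * x m j := by
    intro m j hj
    by_cases h0 : j = i0
    · have h1 := hexsum (p m)
      have h2 := hsum m
      rw [← add_sum_erase I _ hi0] at h1 h2
      have h3 : ∑ j ∈ I.erase i0, ex (p m) j = ∑ j ∈ I.erase i0, z m j * x m j :=
        sum_congr rfl fun j hj => hexi (p m) ⟨j, hj⟩
      rw [h3] at h1
      rw [h0]
      exact add_right_cancel (h1.trans h2.symm)
    · exact hexi (p m) ⟨j, mem_erase.2 ⟨h0, hj⟩⟩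
  have hx0 : ∀ m, ∀ j ∈ I, x m j ≠ 0 := fun m j hj => (hU m j hj).1
  haveI : Nonempty ι := ⟨⟨a, ha⟩⟩
  refine geo_contra (R := R) (A := A) (B := A) (fun s => Am_sq _) (hM ι A A fun s => Am_sq _) s0 ⟨a, ha⟩ ⟨b, hb⟩
    (fun h => hab (congrArg Subtype.val h)) (fun m s i => -Real.log (R.v s (x m (kk s i)))) H
    (Filter.tendsto_atTop_mono hHm tendsto_natCast_atTop_atTop) p bz C (ε1 / 4) (c / 2) hC (by positivity) (by positivity)
    ?_ ?_ ?_ ?_ ?_ ?_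
  · intro m s i
    rw [abs_neg]
    exact hlog m _ (hkkI s i) s
  · intro m i
    exact R.O.mul_mem (hz m _ (mem_of_mem_erase i.2)).1 (hU m _ (mem_of_mem_erase i.2)).2.1
  · intro m
    exact mul_ne_zero (hz m a (mem_of_mem_erase ha)).2.1 (hx0 m a (mem_of_mem_erase ha))
  · intro m s i
    rw [hA, hexp m _ (hkkI s i), (R.v s).map_mul, exp_log_v _ (hx0 m _ (hkkI s i))]
    exact mul_le_mul_of_nonneg_right ((hz m _ (hkkI s i)).2.2 s) ((R.v s).nonneg _)
  · intro m y hyO hy b' hb'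
    by_contra hlt
    push Not at hlt
    -- w
    set w : J → K := fun j => ex y j / x m j with hw
    have hexO : ∀ j, ex y j ∈ R.O := fun j => by
      simp only [ex]; split_ifs
      · exact hyO _
      · exact R.O.neg_mem (R.O.sum_mem fun i _ => hyO i)
    have hwO : ∀ j ∈ I, w j ∈ R.O := fun j hj => by
      simp only [hw, div_eq_mul_inv]; exact R.O.mul_mem (hexO j) (hU m j hj).2.2
    have hwx : ∀ j ∈ I, w j * x m j = ex y j := fun j hj => div_mul_cancel₀ _ (hx0 m j hj)
    have hwb1 : ∀ s, ∀ j ∈ I, j ≠ k s → R.v s (ex y j) ≤ Real.exp (b' s) * R.v s (x m j) := by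
      intro s j hj hne
      obtain ⟨i, hi⟩ := hkk s j hj hne
      have h1 := hb' s i
      rwa [hA, exp_log_v _ (hx0 m _ (hkkI s i)), hi] at h1
    have hwb : ∀ s, ∀ j ∈ I, R.v s (w j) ≤ Real.exp (b' s + Real.log #I) := by
      intro s j hj
      rw [Real.exp_add, Real.exp_log (by linarith)]
      simp only [hw, map_div₀]
      rw [div_le_iff₀ ((R.v s).pos (hx0 m j hj))]
      by_cases hjk : j = k s
      · have h1 := hexsum y
        rw [← add_sum_erase I _ hj] at h1
        rw [eq_neg_of_add_eq_zero_left h1, (R.v s).map_neg]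
        refine ((R.v s).sum_le _ _).trans ?_
        calc _ ≤ ∑ i ∈ I.erase j, Real.exp (b' s) * R.v s (x m j) := by
              refine sum_le_sum fun i hi => (hwb1 s i (mem_of_mem_erase hi) (hjk ▸ ne_of_mem_erase hi)).trans ?_
              have := hmax m s i (mem_of_mem_erase hi)
              rw [← hjk] at this
              gcongr
          _ ≤ #I * (Real.exp (b' s) * R.v s (x m j)) := by
              rw [sum_const, nsmul_eq_mul]
              have h2 : 0 ≤ Real.exp (b' s) * R.v s (x m j) := by positivity
              refine mul_le_mul_of_nonneg_right ?_ h2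
              exact_mod_cast card_le_card (erase_subset j I)
          _ = _ := by ring
      · refine (hwb1 s j hj hjk).trans ?_
        have h2 : 0 ≤ Real.exp (b' s) * R.v s (x m j) := by positivity
        nlinarith
    set u : J → K := fun j => z m i0 * w j - w i0 * z m j with hu
    classical
    set I' := I.filter (fun j => u j ≠ 0) with hI'
    have hI'ne : I'.Nonempty := by
      by_contra hemp
      rw [not_nonempty_iff_eq_empty, filter_eq_empty_iff] at hemp
      push Not at hemp
      apply hy
      rw [Submodule.mem_span_singleton]
      refine ⟨w i0 / z m i0, ?_⟩
      funext i
      have hiI := mem_of_mem_erase i.2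
      have h1 := hemp hiI
      have h2 := hwx i.1 hiI
      rw [hexi] at h2
      have h3 := (hz m i0 hi0).2.1
      simp only [hu] at h1
      simp only [Pi.smul_apply, smul_eq_mul, p]
      rw [← h2, div_mul_eq_mul_div, div_eq_iff h3]
      linear_combination (- x m i.1) * h1
    have hI'ss : I' ⊂ I := by
      refine (filter_subset _ _).ssubset_of_ne fun h => ?_
      have := h.ge hi0
      rw [mem_filter] at this
      exact this.2 (by simp only [hu]; ring)
    have hI'I : ∀ i ∈ I', i ∈ I := fun i hi => hI'ss.1 hi
    refine IH I' hI'ss hI'ne (x m) u (fun s => bz m s + b' s + (Real.log 2 + Real.log #I)) (H m) (hHp m) (hH1 m) trivial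
      (fun i hi => hU m i (hI'I i hi)) ?_ ?_ ?_ (fun i hi j hj => hlow m i (hI'I i hi) j (hI'I j hj)) (fun i hi => hlog m i (hI'I i hi))
    · intro i hi
      have hiI := hI'I i hi
      refine ⟨R.O.sub_mem (R.O.mul_mem (hz m i0 hi0).1 (hwO i hiI)) (R.O.mul_mem (hwO i0 hi0) (hz m i hiI).1), (mem_filter.1 hi).2, fun s => ?_⟩
      have g1 : ∀ i ∈ I, ∀ j ∈ I, R.v s (z m i) * R.v s (w j) ≤ Real.exp (bz m s) * Real.exp (b' s + Real.log #I) := fun i hi j hj =>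
        mul_le_mul ((hz m i hi).2.2 s) (hwb s j hj) ((R.v s).nonneg _) (Real.exp_pos _).le
      have g2 := (R.v s).sub_le_add (z m i0 * w i) (w i0 * z m i)
      simp only [(R.v s).map_mul] at g2
      have g3 := g1 i0 hi0 i hiI
      have g4 := g1 i hiI i0 hi0
      rw [show bz m s + b' s + (Real.log 2 + Real.log #I) = Real.log 2 + (bz m s + (b' s + Real.log #I)) by ring, Real.exp_add,
        Real.exp_log (by norm_num), Real.exp_add]
      linarith
    · have g1 : nb R (fun s => bz m s + b' s + (Real.log 2 + Real.log #I)) = nb R (bz m) + nb R b' + L := by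
        simp only [nb, mul_add, sum_add_distrib, ← sum_mul, hL]; ring
      have g2 := hbz m
      have g3 := hHL m
      rw [div_le_iff₀ hε1] at g3
      have g4 : e0 * H m ≤ ε1 / 4 * H m := mul_le_mul_of_nonneg_right (min_le_left _ _) (hHp m).le
      rw [g1]
      linarith
    · have g1 : ∑ i ∈ I', u i * x m i = ∑ i ∈ I, u i * x m i := by
        rw [hI', sum_filter]
        refine sum_congr rfl fun i _ => ?_
        split_ifs with h
        · rfl
        · push Not at h; rw [h, zero_mul]
      rw [g1]
      have g2 : ∑ i ∈ I, w i * x m i = 0 := by rw [← hexsum y]; exact sum_congr rfl fun i hi => hwx i hi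
      have g3 : ∀ i, u i * x m i = z m i0 * (w i * x m i) - w i0 * (z m i * x m i) := fun i => by simp only [hu]; ring
      simp only [g3, sum_sub_distrib, ← mul_sum, g2, hsum m]
      ring
  · intro m
    rw [hh_neg]
    have haI := mem_of_mem_erase ha
    have hbI := mem_of_mem_erase hb
    have h1 := hlow m b hbI a haI hab.symm
    have h2 := hh_div_le (R := R) (z m a) (z m b) (hz m a haI).2.1 (hz m b hbI).2.1 (hz m b hbI).1 (bz m) (hz m a haI).2.2 (hz m b hbI).2.2
    have h3 := hh_mul (R := R) (z m b * x m b / (z m a * x m a)) (z m a / z m b)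
    have h4 : z m b * x m b / (z m a * x m a) * (z m a / z m b) = x m b / x m a := by
      have e1 := (hz m a haI).2.1
      have e2 := (hz m b hbI).2.1
      have e3 := hx0 m a haI
      field_simp
    rw [h4] at h3
    have h5 := hbz m
    have h6 : e0 * H m ≤ c / 2 * H m := mul_le_mul_of_nonneg_right (min_le_right _ _) (hHp m).le
    show c / 2 * H m ≤ hh R.v R.n (z m b * x m b / (z m a * x m a))
    linarith

theorem noBad [CharZero K] (hM : ∀ (ι : Type) [Fintype ι] [DecidableEq ι] [Nonempty ι] (A B : S → Matrix ι ι ℤ), (∀ s, B s * A s = 1) → Mink R A) (s0 : S)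
    (c C : ℝ) (hc : 0 < c) (hC : 0 ≤ C) (I : Finset J) : I.Nonempty → ∃ ε > 0, ∃ H0, NB R I (fun _ => True) c C ε H0 := by
  induction I using Finset.strongInduction with
  | H I ih =>
    intro hne
    rcases Nat.lt_or_ge (#I) 3 with h3 | h3
    · rcases Nat.lt_or_ge (#I) 2 with h2 | h2
      · obtain ⟨i, rfl⟩ := card_eq_one.1 (le_antisymm (Nat.lt_succ_iff.1 h2) (card_pos.2 hne))
        refine ⟨1, one_pos, 0, ?_⟩
        intro x z b H _ _ _ hU hz _ hs _ _
        rw [sum_singleton] at hs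
        exact mul_ne_zero (hz i (by simp)).2.1 (hU i (by simp)).1 hs
      · obtain ⟨i, j, hij, rfl⟩ := card_eq_two.1 (le_antisymm (Nat.lt_succ_iff.1 h3) h2)
        refine ⟨c / 2, by positivity, 0, ?_⟩
        intro x z b H hH _ _ hU hz hb hs hl _
        rw [sum_pair hij] at hs
        have hi : i ∈ ({i, j} : Finset J) := by simp
        have hj : j ∈ ({i, j} : Finset J) := by simp
        have h1 := hl i hi j hj hij
        have h2 : x i / x j = -(z j / z i) := by
          have e1 := (hz i hi).2.1
          have e2 := (hU j hj).1
          rw [neg_div', div_eq_div_iff e2 e1]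
          linear_combination hs
        rw [h2, hh_neg] at h1
        have h4 := hh_div_le (R := R) (z j) (z i) (hz j hj).2.1 (hz i hi).2.1 (hz i hi).1 b (hz j hj).2.2 (hz i hi).2.2
        nlinarith
    · have IH : ∃ ε > 0, ∃ H0, ∀ I', I' ⊂ I → I'.Nonempty → NB R I' (fun _ => True) c C ε H0 := by
        refine unif (fun I' ε H0 => I' ⊂ I → I'.Nonempty → NB R I' (fun _ => True) c C ε H0) ?_ ?_
        · intro a ε H ε' H' h h1 h2 h3 h4
          exact (h h3 h4).mono h1 h2
        · intro I'
          by_cases h : I' ⊂ I ∧ I'.Nonempty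
          · obtain ⟨ε, hε, H0, h'⟩ := ih I' h.1 h.2
            exact ⟨ε, hε, H0, fun _ _ => h'⟩
          · exact ⟨1, one_pos, 0, fun h1 h2 => absurd ⟨h1, h2⟩ h⟩
      obtain ⟨ε, hε, H0, h⟩ := unif (fun (k : S → J) ε H0 => (∀ s, k s ∈ I) → NB R I (fun x => ∀ s, ∀ i ∈ I, R.v s (x i) ≤ R.v s (x (k s))) c C ε H0)
        (fun a ε H ε' H' h h1 h2 h3 => (h h3).mono h1 h2) (fun k => by
          by_cases hk : ∀ s, k s ∈ I
          · obtain ⟨ε, hε, H0, h⟩ := NB_step hM s0 I h3 k hk c C hc hC IH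
            exact ⟨ε, hε, H0, fun _ => h⟩
          · exact ⟨1, one_pos, 0, fun h => absurd h hk⟩)
      refine ⟨ε, hε, H0, ?_⟩
      intro x z b H h1 h2 _
      have : ∀ s, ∃ k ∈ I, ∀ i ∈ I, R.v s (x i) ≤ R.v s (x k) := fun s => exists_max_image I _ hne
      choose k hk hk' using this
      exact h k hk x z b H h1 h2 hk'

end G
end Sub
end

noncomputable section
open Finset
namespace Sub

section G
variable {J : Type} [Fintype J] [DecidableEq J] {K : Type} [Field K] {S : Type} [Fintype S] [DecidableEq S]
variable {R : Ar K S}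

lemma UU.hh_inv {x : K} (hx : UU R x) : hh R.v R.n x⁻¹ = hh R.v R.n x := by
  have h : ∀ y : K, y ≠ 0 → hh R.v R.n y⁻¹ = hh R.v R.n y - ∑ s, R.n s * Real.log (R.v s y) := by
    intro y hy
    unfold hh
    rw [← sum_sub_distrib]
    refine sum_congr rfl fun s _ => ?_
    have hp := (R.v s).pos hy
    rw [← mul_sub, ← Real.log_div (by positivity) hp.ne', ← max_div_div_right hp.le, div_self hp.ne', max_comm, map_inv₀, one_div]
  rw [h x hx.1, hx.sum, sub_zero]

lemma le_hh (x : K) (s : S) : R.n s * Real.log (max 1 (R.v s x)) ≤ hh R.v R.n x :=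
  single_le_sum (f := fun s => R.n s * Real.log (max 1 (R.v s x)))
    (fun s _ => mul_nonneg (R.hn s).le (Real.log_nonneg (le_max_left _ _))) (mem_univ s)

lemma v_le_hh [CharZero K] {x : K} (hx : x ≠ 0) (s : S) : Real.log (R.v s x) ≤ (∑ s, (R.n s)⁻¹) * hh R.v R.n x := by
  have h1 := le_hh (R := R) x s
  have hn := R.hn s
  have h2 : Real.log (R.v s x) ≤ Real.log (max 1 (R.v s x)) := Real.log_le_log ((R.v s).pos hx) (le_max_right _ _)
  have h3 : Real.log (max 1 (R.v s x)) ≤ (R.n s)⁻¹ * hh R.v R.n x := by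
    rw [inv_mul_eq_div, le_div_iff₀ hn]; linarith
  have h4 := single_le_sum (f := fun s => (R.n s)⁻¹) (fun s _ => (inv_pos.2 (R.hn s)).le) (mem_univ s)
  have h5 := mul_le_mul_of_nonneg_right h4 (hh_nonneg R.v R.n (fun s => (R.hn s).le) x)
  linarith

theorem weak [CharZero K] (hM : ∀ (ι : Type) [Fintype ι] [DecidableEq ι] [Nonempty ι] (A B : S → Matrix ι ι ℤ), (∀ s, B s * A s = 1) → Mink R A) (s0 : S)
    (hNor : ∀ T : ℝ, {u | UU R u ∧ ∀ s, R.v s u ≤ T}.Finite) (I : Finset J) : I.Nonempty → ∃ F : Set K, F.Finite ∧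
    ∀ x : J → K, (∀ i ∈ I, UU R (x i)) → ∑ i ∈ I, x i = 0 → ∃ i ∈ I, ∃ j ∈ I, i ≠ j ∧ x i / x j ∈ F := by
  classical
  induction I using Finset.strongInduction with
  | H I ih =>
  rintro ⟨i0, hi0⟩
  have hnn : ∀ x : K, 0 ≤ hh R.v R.n x := hh_nonneg R.v R.n (fun s => (R.hn s).le)
  have hIH : ∀ I' : Finset J, ∃ F : Set K, F.Finite ∧ (I' ⊂ I → I'.Nonempty → ∀ x : J → K, (∀ i ∈ I', UU R (x i)) → ∑ i ∈ I', x i = 0 →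
      ∃ i ∈ I', ∃ j ∈ I', i ≠ j ∧ x i / x j ∈ F) := by
    intro I'
    by_cases h : I' ⊂ I ∧ I'.Nonempty
    · obtain ⟨F, hF, h'⟩ := ih I' h.1 h.2
      exact ⟨F, hF, fun _ _ => h'⟩
    · exact ⟨∅, Set.finite_empty, fun h1 h2 => absurd ⟨h1, h2⟩ h⟩
  choose F hF hF' using hIH
  by_contra hcon
  push Not at hcon
  set C := ∑ s, (R.n s)⁻¹ with hC
  have hC0 : 0 ≤ C := sum_nonneg fun s _ => (inv_pos.2 (R.hn s)).le
  have hfin : ∀ m : ℝ, {u | UU R u ∧ hh R.v R.n u ≤ m}.Finite := by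
    intro m
    refine (hNor (Real.exp (C * m))).subset ?_
    rintro u ⟨h1, h2⟩
    refine ⟨h1, fun s => ?_⟩
    rw [← Real.log_le_iff_le_exp ((R.v s).pos h1.1)]
    exact (v_le_hh h1.1 s).trans (by gcongr)
  have hseq : ∀ m : ℕ, ∃ x : J → K, (∀ i, UU R (x i)) ∧ ∑ i ∈ I, x i = 0 ∧ (∀ i ∈ I, ∀ j ∈ I, i ≠ j → (m:ℝ) < hh R.v R.n (x i / x j)) ∧
      (∀ I', I' ⊂ I → I'.Nonempty → ∑ i ∈ I', x i ≠ 0) ∧ ∀ i, i ∉ I → x i = x i0 := by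
    intro m
    obtain ⟨x, h1, h2, h3⟩ := hcon ((⋃ I', F I') ∪ {u | UU R u ∧ hh R.v R.n u ≤ m}) ((Set.finite_iUnion hF).union (hfin m))
    have hxx : ∀ i ∈ I, (if i ∈ I then x i else x i0) = x i := fun i hi => if_pos hi
    refine ⟨fun i => if i ∈ I then x i else x i0, ?_, ?_, ?_, ?_, fun i hi => by beta_reduce; rw [if_neg hi, if_pos hi0]⟩
    · intro i; dsimp only; split_ifs with h
      · exact h1 i h
      · exact h1 i0 hi0
    · rw [← h2]; exact sum_congr rfl hxx
    · intro i hi j hj hij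
      beta_reduce
      rw [hxx i hi, hxx j hj]
      by_contra h
      exact h3 i hi j hj hij (Or.inr ⟨(h1 i hi).div (h1 j hj), not_lt.1 h⟩)
    · intro I' hI' hne hs
      rw [sum_congr rfl fun i hi => hxx i (hI'.1 hi)] at hs
      obtain ⟨i, hi, j, hj, hij, hm⟩ := hF' I' hI' hne x (fun i hi => h1 i (hI'.1 hi)) hs
      exact h3 i (hI'.1 hi) j (hI'.1 hj) hij (Or.inl (Set.mem_iUnion.2 ⟨I', hm⟩))
  choose x hU hsum hbig hsub hout using hseq
  have hx0 : ∀ m i, x m i ≠ 0 := fun m i => (hU m i).1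
  obtain ⟨i1, hi1, hi10⟩ : ∃ i1 ∈ I, i1 ≠ i0 := by
    by_contra! h
    have : I = {i0} := eq_singleton_iff_unique_mem.2 ⟨hi0, h⟩
    have h2 := hsum 0
    rw [this, sum_singleton] at h2
    exact hx0 0 i0 h2
  set H : ℕ → ℝ := fun m => ∑ i, ∑ j, hh R.v R.n (x m i / x m j) with hH
  have hleH : ∀ m i j, hh R.v R.n (x m i / x m j) ≤ H m := by
    intro m i j
    have f1 := single_le_sum (f := fun i => ∑ j, hh R.v R.n (x m i / x m j)) (fun i _ => sum_nonneg fun j _ => hnn _) (mem_univ i)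
    have f2 := single_le_sum (f := fun j => hh R.v R.n (x m i / x m j)) (fun j _ => hnn _) (mem_univ j)
    exact f2.trans f1
  have hHm : ∀ m : ℕ, (m:ℝ) < H m := fun m => (hbig m i1 hi1 i0 hi0 hi10).trans_le (hleH m i1 i0)
  have hHp : ∀ m, 0 < H m := fun m => lt_of_le_of_lt (by positivity) (hHm m)
  have hHt : Filter.Tendsto H Filter.atTop Filter.atTop := Filter.tendsto_atTop_mono (fun m => (hHm m).le) tendsto_natCast_atTop_atTop
  set q : ℕ → J → J → ℝ := fun m i j => hh R.v R.n (x m i / x m j) / H m with hq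
  have hq0 : ∀ m i j, 0 ≤ q m i j := fun m i j => div_nonneg (hnn _) (hHp m).le
  have hqb : ∀ m, q m ∈ Metric.closedBall (0 : J → J → ℝ) 1 := by
    intro m
    rw [mem_closedBall_zero_iff, pi_norm_le_iff_of_nonneg zero_le_one]
    intro i
    rw [pi_norm_le_iff_of_nonneg zero_le_one]
    intro j
    rw [Real.norm_eq_abs, abs_of_nonneg (hq0 m i j), div_le_one (hHp m)]
    exact hleH m i j
  obtain ⟨r, _, θ, hθ, hlim⟩ := (isCompact_closedBall (0 : J → J → ℝ) 1).tendsto_subseq hqb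
  have hlim' : ∀ i j, Filter.Tendsto (fun m => q (θ m) i j) Filter.atTop (nhds (r i j)) := fun i j =>
    (tendsto_pi_nhds.1 ((tendsto_pi_nhds.1 hlim) i)) j
  have hr0 : ∀ i j, 0 ≤ r i j := fun i j => ge_of_tendsto (hlim' i j) (Filter.Eventually.of_forall fun m => hq0 _ i j)
  have hrrefl : ∀ i, r i i = 0 := fun i => by
    refine tendsto_nhds_unique (hlim' i i) ?_
    have : ∀ m, q (θ m) i i = 0 := fun m => by simp [hq, hx0, hh]
    simp only [this]
    exact tendsto_const_nhds
  have hrsymm : ∀ i j, r i j = r j i := fun i j => by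
    refine tendsto_nhds_unique (hlim' i j) ?_
    have : ∀ m, q (θ m) i j = q (θ m) j i := fun m => by
      simp only [hq]; rw [← ((hU _ j).div (hU _ i)).hh_inv, inv_div]
    simp only [this]
    exact hlim' j i
  have hrtri : ∀ i j k, r i k ≤ r i j + r j k := fun i j k => by
    refine le_of_tendsto_of_tendsto' (hlim' i k) ((hlim' i j).add (hlim' j k)) fun m => ?_
    simp only [hq]
    rw [← add_div]
    have h1 := hh_mul (R := R) (x (θ m) i / x (θ m) j) (x (θ m) j / x (θ m) k)
    rw [div_mul_div_cancel₀ (hx0 _ _)] at h1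
    have := (hHp (θ m)).le
    gcongr
  have hrsum : ∑ i, ∑ j, r i j = 1 := by
    refine tendsto_nhds_unique (tendsto_finset_sum _ fun i _ => tendsto_finset_sum _ fun j _ => hlim' i j) ?_
    have : ∀ m, ∑ i, ∑ j, q (θ m) i j = 1 := fun m => by
      simp only [hq, ← sum_div]
      exact div_self (hHp _).ne'
    simp only [this]
    exact tendsto_const_nhds
  let st : Setoid J := ⟨fun i j => r i j = 0, ⟨hrrefl, fun {i j} h => (hrsymm j i).trans h, fun {i j k} h1 h2 =>
    le_antisymm (by have := hrtri i j k; linarith) (hr0 _ _)⟩⟩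
  obtain ⟨rep, hrepd⟩ : ∃ rep : J → J, rep = fun i => (Quotient.mk st i).out := ⟨_, rfl⟩
  have hrep : ∀ i, r i (rep i) = 0 := fun i => by
    rw [hrsymm, hrepd]; exact Quotient.mk_out (s := st) i
  have hrep' : ∀ i j, r i j = 0 → rep i = rep j := fun i j h => by
    rw [hrepd]; exact congrArg Quotient.out (Quotient.sound (s := st) h)
  obtain ⟨c, hc, _, hcr⟩ := unif (α := J × J) (fun a ε _ => r a.1 a.2 ≠ 0 → 2 * ε ≤ r a.1 a.2)
    (fun a ε H ε' H' h h1 _ h2 => by have := h h2; linarith)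
    (fun a => by
      by_cases h : r a.1 a.2 = 0
      · exact ⟨1, one_pos, 0, fun h' => absurd h h'⟩
      · exact ⟨r a.1 a.2 / 2, by have := lt_of_le_of_ne (hr0 a.1 a.2) (Ne.symm h); positivity, 0, fun _ => by linarith⟩)
  obtain ⟨ε, hε, H0, hNB⟩ := noBad (R := R) hM s0 c C hc hC0 (I.image rep) ⟨_, mem_image_of_mem rep hi0⟩
  set η := ε / (2 * (Fintype.card J + 1)) with hη
  have hη0 : 0 < η := by positivity
  have hlI : 0 ≤ Real.log (#I) := Real.log_natCast_nonneg _
  have hn1 : 0 ≤ ∑ s, R.n s := sum_nonneg fun s _ => (R.hn s).le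
  have ev1 : ∀ᶠ m in Filter.atTop, ∀ i, q (θ m) i (rep i) ≤ η := by
    rw [Filter.eventually_all]
    intro i
    exact (hlim' i (rep i)).eventually_le_const (by rw [hrep]; exact hη0)
  have ev2 : ∀ᶠ m in Filter.atTop, ∀ i j, r i j ≠ 0 → c ≤ q (θ m) i j := by
    rw [Filter.eventually_all]
    intro i
    rw [Filter.eventually_all]
    intro j
    by_cases h : r i j = 0
    · exact Filter.Eventually.of_forall fun m h' => absurd h h'
    · filter_upwards [(hlim' i j).eventually_const_le (show c < r i j by have := hcr (i, j) h; dsimp only at this; linarith)] with m hm _ using hm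
  have hHt' := hHt.comp hθ.tendsto_atTop
  have ev3 := hHt'.eventually_ge_atTop H0
  have ev4 := hHt'.eventually_ge_atTop (2 * ((∑ s, R.n s) * Real.log (#I)) / ε)
  obtain ⟨m', h1, h2, h3, h4⟩ := (ev1.and (ev2.and (ev3.and ev4))).exists
  simp only [Function.comp] at h3 h4
  set m := θ m' with hm
  have hHm' := hHp m
  have hcl : ∀ j, ¬ (∀ i ∈ I, rep i = j) := by
    intro j hj
    have hall : ∀ i, rep i = j := by
      intro i
      by_cases hi : i ∈ I
      · exact hj i hi
      · rw [← hj i0 hi0]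
        refine hrep' i i0 (tendsto_nhds_unique (hlim' i i0) ?_)
        have : ∀ m, q (θ m) i i0 = 0 := fun m => by simp [hq, hout _ i hi, hx0, hh]
        simp only [this]
        exact tendsto_const_nhds
    have : ∀ i k, r i k = 0 := fun i k => le_antisymm (by
      have e1 := hrtri i j k
      have e2 := hrep i
      have e3 := hrep k
      rw [hall] at e2 e3
      rw [hrsymm] at e3
      linarith) (hr0 _ _)
    simp [this] at hrsum
  set b : S → ℝ := fun s => Real.log (#I) + ∑ i, Real.log (max 1 (R.v s (x m i / x m (rep i)))) with hb
  have hIp : (0:ℝ) < #I := by exact_mod_cast card_pos.2 ⟨i0, hi0⟩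
  refine hNB (fun j => x m j / x m i0) (fun j => ∑ i ∈ I with rep i = j, x m i / x m j) b (H m) hHm' h3 trivial
    (fun i _ => (hU m i).div (hU m i0)) ?_ ?_ ?_ ?_ ?_
  · intro j hj
    obtain ⟨i', hi', rfl⟩ := mem_image.1 hj
    refine ⟨R.O.sum_mem fun i _ => ((hU m i).div (hU m _)).2.1, ?_, ?_⟩
    · beta_reduce
      rw [← sum_div]
      refine div_ne_zero (hsub m _ ?_ ⟨i', mem_filter.2 ⟨hi', rfl⟩⟩) (hx0 _ _)
      refine (filter_ssubset).2 ?_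
      by_contra! h
      exact hcl _ h
    · intro s
      beta_reduce
      refine ((R.v s).sum_le _ _).trans ?_
      rw [hb]; beta_reduce
      rw [Real.exp_add, Real.exp_log hIp]
      have : ∀ i ∈ I.filter (fun i => rep i = rep i'), R.v s (x m i / x m (rep i')) ≤ Real.exp (∑ i, Real.log (max 1 (R.v s (x m i / x m (rep i))))) := by
        intro i hi
        rw [← (mem_filter.1 hi).2]
        refine (le_max_right 1 _).trans ?_
        rw [← Real.log_le_iff_le_exp (by positivity)]
        exact single_le_sum (f := fun i => Real.log (max 1 (R.v s (x m i / x m (rep i))))) (fun i _ => Real.log_nonneg (le_max_left _ _)) (mem_univ i)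
      refine (sum_le_card_nsmul _ _ _ this).trans ?_
      rw [nsmul_eq_mul]
      gcongr
      exact filter_subset _ _
  · have e1 : nb R b = (∑ s, R.n s) * Real.log (#I) + ∑ i, hh R.v R.n (x m i / x m (rep i)) := by
      unfold nb hh
      rw [sum_comm, sum_mul, ← sum_add_distrib]
      refine sum_congr rfl fun s _ => ?_
      rw [hb]; beta_reduce
      rw [mul_add, mul_sum]
    have e2 : ∑ i, hh R.v R.n (x m i / x m (rep i)) ≤ ∑ i : J, η * H m := by
      refine sum_le_sum fun i _ => ?_
      have := h1 i
      simp only [hq] at this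
      rwa [div_le_iff₀ hHm'] at this
    rw [sum_const, card_univ, nsmul_eq_mul] at e2
    rw [div_le_iff₀ hε] at h4
    have e3 : (Fintype.card J : ℝ) * (η * H m) ≤ ε / 2 * H m := by
      rw [← mul_assoc]
      gcongr
      rw [hη]
      field_simp
      linarith
    rw [e1]
    nlinarith
  · have e1 : ∀ j ∈ I.image rep, (∑ i ∈ I with rep i = j, x m i / x m j) * (x m j / x m i0) = ∑ i ∈ I with rep i = j, x m i / x m i0 := by
      intro j _
      rw [sum_mul]
      exact sum_congr rfl fun i _ => div_mul_div_cancel₀ (hx0 _ _)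
    rw [sum_congr rfl e1, sum_fiberwise_of_maps_to (fun i hi => mem_image_of_mem rep hi), ← sum_div, hsum, zero_div]
  · intro i hi j hj hij
    beta_reduce
    rw [div_div_div_cancel_right₀ (hx0 _ _)]
    obtain ⟨i', hi', rfl⟩ := mem_image.1 hi
    obtain ⟨j', hj', rfl⟩ := mem_image.1 hj
    have := h2 (rep i') (rep j') (fun h => hij (by rw [hrep' _ _ (hrep i'), hrep' _ _ (hrep j'), hrep' _ _ h]))
    simp only [hq] at this
    rwa [le_div_iff₀ hHm'] at this
  · intro i _ s
    beta_reduce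
    have e0 := (hU m i).div (hU m i0)
    have e1 := v_le_hh (R := R) e0.1 s
    have e2 := v_le_hh (R := R) (inv_ne_zero e0.1) s
    rw [e0.hh_inv, map_inv₀, Real.log_inv] at e2
    have e3 : C * hh R.v R.n (x m i / x m i0) ≤ C * H m := mul_le_mul_of_nonneg_left (hleH m i i0) hC0
    exact abs_le.2 ⟨by linarith, by linarith⟩

end G
end Sub
end

noncomputable section
open Finset
namespace Sub

section NF
open NumberField
variable {K : Type} [Field K] [NumberField K]

abbrev SF (M : {M : 𝓞 K // M ≠ 0}) : Type := {w : FinitePlace K // w (M.1 : K) ≠ 1}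

lemma SF_fin (M : {M : 𝓞 K // M ≠ 0}) : Finite (SF M) := by
  have h : Function.HasFiniteMulSupport fun w : FinitePlace K => w (M.1 : K) :=
    FinitePlace.hasFiniteMulSupport (RingOfIntegers.coe_ne_zero_iff.2 M.2)
  have h' : (Function.mulSupport fun w : FinitePlace K => w (M.1 : K)).Finite := h
  exact h'.to_subtype

instance (M : {M : 𝓞 K // M ≠ 0}) : Fintype (SF M) := by
  haveI := SF_fin M
  exact Fintype.ofFinite _

abbrev SS (M : {M : 𝓞 K // M ≠ 0}) := InfinitePlace K ⊕ SF M

lemma fp_int (w : FinitePlace K) (x : 𝓞 K) : w (x : K) ≤ 1 := by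
  rw [← w.norm_embedding_eq]
  exact FinitePlace.norm_le_one K w.maximalIdeal x

lemma int_of_fp (x : K) (h : ∀ w : FinitePlace K, w x ≤ 1) : ∃ y : 𝓞 K, (y : K) = x := by
  have := IsDedekindDomain.HeightOneSpectrum.mem_integers_of_valuation_le_one (R := 𝓞 K) K x (fun v => by
    have h1 := h (FinitePlace.mk v)
    rw [FinitePlace.mk_apply, FinitePlace.norm_embedding, HeightOneSpectrum.adicAbv_def] at h1
    exact (WithZeroMulInt.toNNReal_le_one_iff (HeightOneSpectrum.one_lt_absNorm_nnreal v)).1 (by exact_mod_cast h1))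
  obtain ⟨y, hy⟩ := this
  exact ⟨y, hy⟩

lemma fp_pow (w : FinitePlace K) (x : 𝓞 K) (e : ℕ) (h : x ∈ w.maximalIdeal.asIdeal ^ e) :
    w (x : K) ≤ ((Ideal.absNorm w.maximalIdeal.asIdeal : ℝ)⁻¹) ^ e := by
  rw [← w.norm_embedding_eq]
  have h1 := FinitePlace.norm_embedding_int K w.maximalIdeal x
  rw [h1]
  have h2 := (w.maximalIdeal.intValuation_le_pow_iff_mem x e).2 h
  have h3 := (WithZeroMulInt.toNNReal_strictMono (HeightOneSpectrum.one_lt_absNorm_nnreal w.maximalIdeal)).monotone h2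
  refine (NNReal.coe_le_coe.2 h3).trans ?_
  rw [WithZero.exp]
  rw [WithZeroMulInt.toNNReal_neg_apply _ WithZero.coe_ne_zero, WithZero.unzero_coe, toAdd_ofAdd, zpow_neg, zpow_natCast]
  simp

def nfO (M : {M : 𝓞 K // M ≠ 0}) : Subring K where
  carrier := {x | ∀ w : FinitePlace K, w (M.1 : K) = 1 → w x ≤ 1}
  mul_mem' {a b} ha hb w hw := by
    rw [map_mul]; exact mul_le_one₀ (ha w hw) (apply_nonneg w b) (hb w hw)
  one_mem' w _ := by rw [map_one]
  add_mem' {a b} ha hb w hw := (FinitePlace.add_le w a b).trans (max_le (ha w hw) (hb w hw))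
  zero_mem' w _ := by rw [map_zero]; exact zero_le_one
  neg_mem' {a} ha w hw := by rw [map_neg_eq_map]; exact ha w hw

lemma nf_liou (M : {M : 𝓞 K // M ≠ 0}) (a : K) (ha : a ∈ nfO M) (h0 : a ≠ 0) :
    0 ≤ ∑ w : InfinitePlace K, (w.mult : ℝ) * Real.log (w a) + ∑ w : SF M, Real.log (w.1 a) := by
  have h1 := prod_abs_eq_one h0
  have hfs : (Function.mulSupport fun w : FinitePlace K => w a).Finite := FinitePlace.hasFiniteMulSupport h0
  have hpos : ∀ w : FinitePlace K, 0 < w a := fun w => FinitePlace.pos_iff.2 h0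
  haveI := SF_fin M
  classical
  set E : Finset (FinitePlace K) := univ.image (fun w : SF M => w.1) with hE
  have h2 : ∏ᶠ w : FinitePlace K, w a ≤ ∏ w ∈ E, w a := by
    rw [finprod_eq_prod_of_mulSupport_subset (s := hfs.toFinset ∪ E) _ (by intro x hx; simp at hx ⊢; left; exact hx),
      ← sdiff_union_of_subset (subset_union_right (s₁ := hfs.toFinset) (s₂ := E)), prod_union sdiff_disjoint]
    refine mul_le_of_le_one_left (prod_nonneg fun w _ => (hpos w).le) (prod_le_one (fun w _ => (hpos w).le) fun w hw => ?_)
    apply ha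
    by_contra h
    exact (mem_sdiff.1 hw).2 (mem_image.2 ⟨(⟨w, h⟩ : SF M), mem_univ _, rfl⟩)
  have h3 : ∏ w ∈ E, w a = ∏ w : SF M, w.1 a := by
    rw [hE, prod_image]
    intro x _ y _ h
    exact Subtype.ext h
  have hip : ∀ w : InfinitePlace K, 0 < w a := fun w => InfinitePlace.pos_iff.2 h0
  have h4 : 1 ≤ (∏ w : InfinitePlace K, w a ^ w.mult) * ∏ w : SF M, w.1 a := by
    refine h1.symm.le.trans ?_
    rw [← h3]
    exact mul_le_mul_of_nonneg_left h2 (prod_nonneg fun w _ => pow_nonneg (hip w).le _)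
  have h5 := Real.log_nonneg h4
  rw [Real.log_mul (prod_ne_zero_iff.2 fun w _ => (pow_pos (hip w) _).ne') (prod_ne_zero_iff.2 fun w _ => (hpos _).ne'),
    Real.log_prod (fun w _ => (pow_pos (hip w) _).ne'), Real.log_prod (fun w _ => (hpos _).ne')] at h5
  simpa [Real.log_pow] using h5

def nf (M : {M : 𝓞 K // M ≠ 0}) : Ar K (SS M) where
  v := Sum.elim (fun w => w.1) (fun w => w.1.1)
  n := Sum.elim (fun w => w.mult) (fun _ => 1)
  hn s := by
    rcases s with w | w
    · simpa using w.mult_pos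
    · exact one_pos
  O := nfO M
  liou a ha h0 := by
    rw [Fintype.sum_sum_type]
    simp only [Sum.elim_inl, Sum.elim_inr, one_mul]
    exact nf_liou M a ha h0

lemma nf_int (M : {M : 𝓞 K // M ≠ 0}) (x : 𝓞 K) : (x : K) ∈ (nf M).O := fun w _ => fp_int w x

lemma nf_UU (M : {M : 𝓞 K // M ≠ 0}) (x : K) (h0 : x ≠ 0) (y z : 𝓞 K) (hy : (y : K) = (M.1 : K) * x) (hz : (z : K) = (M.1 : K) * x⁻¹) :
    UU (nf M) x := by
  refine ⟨h0, fun w hw => ?_, fun w hw => ?_⟩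
  · have := fp_int w y
    rwa [hy, map_mul, hw, one_mul] at this
  · have := fp_int w z
    rwa [hz, map_mul, hw, one_mul] at this

lemma M_inv (M : {M : 𝓞 K // M ≠ 0}) : UU (nf M) (M.1 : K) := by
  have hM : (M.1 : K) ≠ 0 := RingOfIntegers.coe_ne_zero_iff.2 M.2
  refine nf_UU M _ hM (M.1 * M.1) 1 (by simp) (by simp [hM])

lemma M_lt (M : {M : 𝓞 K // M ≠ 0}) (w : SF M) : w.1 (M.1 : K) < 1 := lt_of_le_of_ne (fp_int _ _) w.2

/-- Northcott -/
lemma nf_nor (M : {M : 𝓞 K // M ≠ 0}) (T : ℝ) : {u | UU (nf M) u ∧ ∀ s, (nf M).v s u ≤ T}.Finite := by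
  have hM : (M.1 : K) ≠ 0 := RingOfIntegers.coe_ne_zero_iff.2 M.2
  have h1 : ∀ᶠ a : ℕ in Filter.atTop, ∀ w : SF M, (w.1 (M.1 : K)) ^ a * T ≤ 1 := by
    rw [Filter.eventually_all]
    intro w
    have := (tendsto_pow_atTop_nhds_zero_of_lt_one (apply_nonneg w.1 (M.1 : K)) (M_lt M w)).mul_const T
    rw [zero_mul] at this
    exact this.eventually_le_const one_pos
  obtain ⟨a, ha⟩ := h1.exists
  set B : ℝ := ∑ w : InfinitePlace K, (w (M.1 : K)) ^ a * |T| with hB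
  have hfin := Embeddings.finite_of_norm_le K ℂ B
  have hinj : Function.Injective (fun u : K => (M.1 : K) ^ a * u) := mul_right_injective₀ (pow_ne_zero _ hM)
  refine (hfin.preimage hinj.injOn).subset ?_
  rintro u ⟨hu, hT⟩
  refine ⟨?_, fun φ => ?_⟩
  · obtain ⟨y, hy⟩ := int_of_fp ((M.1 : K) ^ a * u) (fun w => by
      rw [map_mul, map_pow]
      by_cases hw : w (M.1 : K) = 1
      · rw [hw, one_pow, one_mul]; exact hu.2.1 w hw
      · exact (mul_le_mul_of_nonneg_left (hT (Sum.inr ⟨w, hw⟩)) (pow_nonneg (apply_nonneg w _) _)).trans (ha ⟨w, hw⟩))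
    beta_reduce
    rw [← hy]
    exact RingOfIntegers.isIntegral_coe y
  · beta_reduce
    rw [← InfinitePlace.apply, map_mul, map_pow]
    set w := InfinitePlace.mk φ
    have e1 : w u ≤ |T| := (hT (Sum.inl w)).trans (le_abs_self T)
    refine (mul_le_mul_of_nonneg_left e1 (pow_nonneg (apply_nonneg w _) _)).trans ?_
    exact single_le_sum (f := fun w : InfinitePlace K => (w (M.1 : K)) ^ a * |T|) (fun w _ => mul_nonneg (pow_nonneg (apply_nonneg w _) _) (abs_nonneg _)) (mem_univ w)

end NF
end Sub
end

noncomputable section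
open Finset
namespace Sub

section NF
open NumberField
variable {K : Type} [Field K] [NumberField K]

def Ev (w : InfinitePlace K) (k : ℕ) (z : K) : ℝ := if k = 0 then (w.embedding z).re else (w.embedding z).im

lemma Ev_le (w : InfinitePlace K) (k : ℕ) (z : K) : |Ev w k z| ≤ w z := by
  rw [← w.norm_embedding_eq]
  unfold Ev
  split_ifs
  · exact Complex.abs_re_le_norm _
  · exact Complex.abs_im_le_norm _

lemma Ev_sub (w : InfinitePlace K) (k : ℕ) (z z' : K) : Ev w k (z - z') = Ev w k z - Ev w k z' := by
  unfold Ev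
  split_ifs <;> simp

lemma le_Ev (w : InfinitePlace K) (z : K) (δ : ℝ) (hδ : 0 ≤ δ) (h : ∀ k : Fin w.mult, |Ev w k z| ≤ δ) : w z ≤ 2 * δ := by
  rw [← w.norm_embedding_eq]
  refine (Complex.norm_le_abs_re_add_abs_im _).trans ?_
  have h0 := h ⟨0, w.mult_pos⟩
  simp only [Ev, if_true] at h0
  by_cases hw : w.IsReal
  · have h1 := RingHom.congr_fun (InfinitePlace.isReal_iff.1 hw) z
    have h2 : (w.embedding z).im = 0 := Complex.conj_eq_iff_im.1 (by simpa using h1)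
    rw [h2, abs_zero]; linarith
  · have hm : w.mult = 2 := by simp [InfinitePlace.mult, hw]
    have h1 := h ⟨1, by rw [hm]; norm_num⟩
    simp only [Ev, one_ne_zero, if_false] at h1
    linarith

lemma pig (M : {M : 𝓞 K // M ≠ 0}) {ι : Type} [Fintype ι] [DecidableEq ι] (A : SS M → Matrix ι ι ℤ) :
    ∃ C0 : ℝ, 1 ≤ C0 ∧ ∀ (e : SF M → ι → ℕ) (δ : InfinitePlace K → ι → ℝ), (∀ w i, 0 < δ w i) →
      (∏ w : SF M, ∏ i, (Ideal.absNorm w.1.maximalIdeal.asIdeal : ℝ) ^ e w i) * ∏ w : InfinitePlace K, ∏ i, (C0 / δ w i) ^ w.mult < 1 →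
      ∃ y : ι → 𝓞 K, y ≠ 0 ∧ (∀ (w : SF M) i, ((A (.inr w)).map (Int.castRingHom (𝓞 K))).mulVec y i ∈ w.1.maximalIdeal.asIdeal ^ e w i) ∧
        ∀ (w : InfinitePlace K) i, w ((((A (.inl w)).map (Int.castRingHom (𝓞 K))).mulVec y i : 𝓞 K) : K) ≤ 2 * δ w i := by
  classical
  set ω := RingOfIntegers.basis K with hω
  set C2 : ℝ := ∑ w : InfinitePlace K, ∑ i, ∑ j, |(A (.inl w) i j : ℝ)| * ∑ b, w (ω b : K) with hC2
  have hC20 : 0 ≤ C2 := sum_nonneg fun w _ => sum_nonneg fun i _ => sum_nonneg fun j _ => mul_nonneg (abs_nonneg _) (sum_nonneg fun b _ => apply_nonneg w _)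
  refine ⟨2 * C2 + 1, by linarith, fun e δ hδ hlt => ?_⟩
  obtain ⟨Bd, hBd⟩ : ∃ Bd : ℕ, (∑ w, ∑ i, δ w i) < Bd := exists_nat_gt _
  have hBδ : ∀ w i, δ w i ≤ Bd := by
    intro w i
    refine le_trans ?_ hBd.le
    exact (single_le_sum (f := fun i => δ w i) (fun i _ => (hδ w i).le) (mem_univ i)).trans
      (single_le_sum (f := fun w => ∑ i, δ w i) (fun w _ => sum_nonneg fun i _ => (hδ w i).le) (mem_univ w))
  have hBd0 : 0 < (Bd : ℝ) := lt_of_le_of_lt (sum_nonneg fun w _ => sum_nonneg fun i _ => (hδ w i).le) hBd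
  let β := Module.Free.ChooseBasisIndex ℤ (𝓞 K)
  let Y : (ι → β → Fin Bd) → ι → 𝓞 K := fun x i => ∑ b, ((x i b : ℕ) : ℤ) • ω b
  let L : (s : SS M) → (ι → 𝓞 K) → ι → 𝓞 K := fun s y => ((A s).map (Int.castRingHom (𝓞 K))).mulVec y
  have hbound : ∀ (w : InfinitePlace K) x i, w (L (.inl w) (Y x) i : K) ≤ C2 * Bd := by
    intro w x i
    have e1 : (L (.inl w) (Y x) i : K) = ∑ j, (A (.inl w) i j : K) * ∑ b, ((x j b : ℕ) : K) * (ω b : K) := by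
      simp [L, Y, Matrix.mulVec, dotProduct]
    rw [e1]
    refine (w.1.sum_le _ _).trans ?_
    calc _ ≤ ∑ j, |(A (.inl w) i j : ℝ)| * ((∑ b, w (ω b : K)) * Bd) := by
          refine sum_le_sum fun j _ => ?_
          rw [w.1.map_mul]
          refine mul_le_mul (v_int_le _ _) ?_ (w.1.nonneg _) (abs_nonneg _)
          refine (w.1.sum_le _ _).trans ?_
          rw [sum_mul]
          refine sum_le_sum fun b _ => ?_
          rw [w.1.map_mul, mul_comm]
          refine mul_le_mul_of_nonneg_left ?_ (w.1.nonneg _)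
          have := v_int_le w.1 ((x j b : ℕ) : ℤ)
          simp only [Int.cast_natCast, Nat.abs_cast] at this
          exact this.trans (by exact_mod_cast (x j b).2.le)
      _ = (∑ j, |(A (.inl w) i j : ℝ)| * ∑ b, w (ω b : K)) * Bd := by
          rw [sum_mul univ (fun j => |(A (.inl w) i j : ℝ)| * ∑ b, w (ω b : K))]; exact sum_congr rfl fun j _ => (mul_assoc _ _ _).symm
      _ ≤ C2 * Bd := by
          refine mul_le_mul_of_nonneg_right ?_ hBd0.le
          rw [hC2]
          refine (single_le_sum (f := fun i => ∑ j, |(A (.inl w) i j : ℝ)| * ∑ b, w (ω b : K)) (fun i _ => ?_) (mem_univ i)).trans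
            (single_le_sum (f := fun w : InfinitePlace K => ∑ i, ∑ j, |(A (.inl w) i j : ℝ)| * ∑ b, w (ω b : K)) (fun w _ => ?_) (mem_univ w))
          · exact sum_nonneg fun j _ => mul_nonneg (abs_nonneg _) (sum_nonneg fun b _ => apply_nonneg w _)
          · exact sum_nonneg fun i _ => sum_nonneg fun j _ => mul_nonneg (abs_nonneg _) (sum_nonneg fun b _ => apply_nonneg w _)
  let nc : InfinitePlace K → ι → ℕ := fun w i => ⌊2 * C2 * Bd / δ w i⌋₊ + 1
  let uu : (w : InfinitePlace K) → ι → ℕ → (ι → β → Fin Bd) → ℝ := fun w i k x => (Ev w k (L (.inl w) (Y x) i : K) + C2 * Bd) / δ w i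
  have huu : ∀ w i k x, 0 ≤ uu w i k x ∧ uu w i k x ≤ 2 * C2 * Bd / δ w i := by
    intro w i k x
    have e1 := abs_le.1 ((Ev_le w k (L (.inl w) (Y x) i : K)).trans (hbound w x i))
    exact ⟨div_nonneg (by linarith [e1.1]) (hδ w i).le, div_le_div_of_nonneg_right (by linarith [e1.2]) (hδ w i).le⟩
  let P : SF M → Ideal (𝓞 K) := fun w => w.1.maximalIdeal.asIdeal
  have hPne : ∀ w i, P w ^ e w i ≠ ⊥ := fun w i => pow_ne_zero _ w.1.maximalIdeal.ne_bot
  haveI : ∀ w i, Finite (𝓞 K ⧸ P w ^ e w i) := fun w i => Ideal.finiteQuotientOfFreeOfNeBot _ (hPne w i)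
  letI : ∀ w i, Fintype (𝓞 K ⧸ P w ^ e w i) := fun w i => Fintype.ofFinite _
  let Φ : (ι → β → Fin Bd) → (∀ w i, 𝓞 K ⧸ P w ^ e w i) × (∀ (w : InfinitePlace K) (i : ι), Fin w.mult → Fin (nc w i)) := fun x =>
    (fun w i => Ideal.Quotient.mk _ (L (.inr w) (Y x) i), fun w i k => ⟨⌊uu w i k x⌋₊, Nat.lt_succ_of_le (Nat.floor_mono (huu w i k x).2)⟩)
  have hcard : Fintype.card ((∀ w i, 𝓞 K ⧸ P w ^ e w i) × (∀ (w : InfinitePlace K) (i : ι), Fin w.mult → Fin (nc w i))) <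
      Fintype.card (ι → β → Fin Bd) := by
    simp only [Fintype.card_prod, Fintype.card_pi, Fintype.card_fin, prod_const, card_univ]
    have e0 : ∀ w i, Fintype.card (𝓞 K ⧸ P w ^ e w i) = (Ideal.absNorm w.1.maximalIdeal.asIdeal) ^ e w i := by
      intro w i
      rw [← map_pow, Ideal.absNorm_apply, Submodule.cardQuot_apply, Nat.card_eq_fintype_card]
    simp only [e0]
    rw [← Nat.cast_lt (α := ℝ)]
    push_cast
    set Q := ∏ w : SF M, ∏ i, (Ideal.absNorm w.1.maximalIdeal.asIdeal : ℝ) ^ e w i with hQ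
    have hQ0 : 0 ≤ Q := prod_nonneg fun w _ => prod_nonneg fun i _ => by positivity
    have e1 : ∏ w : InfinitePlace K, ∏ i, (nc w i : ℝ) ^ w.mult ≤ (∏ w : InfinitePlace K, ∏ i, ((2 * C2 + 1) / δ w i) ^ w.mult) * ((Bd : ℝ) ^ Fintype.card β) ^ Fintype.card ι := by
      have e2 : ((Bd : ℝ) ^ Fintype.card β) ^ Fintype.card ι = ∏ w : InfinitePlace K, ∏ i : ι, (Bd : ℝ) ^ w.mult := by
        simp only [prod_const, card_univ]
        rw [prod_pow, prod_pow_eq_pow_sum, InfinitePlace.sum_mult_eq, ← RingOfIntegers.rank, Module.finrank_eq_card_chooseBasisIndex]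
      rw [e2, ← prod_mul_distrib]
      refine prod_le_prod (fun w _ => prod_nonneg fun i _ => by positivity) fun w _ => ?_
      rw [← prod_mul_distrib]
      refine prod_le_prod (fun i _ => by positivity) fun i _ => ?_
      rw [← mul_pow]
      refine pow_le_pow_left₀ (by positivity) ?_ _
      have hd := hδ w i
      have e3 : ((nc w i : ℕ) : ℝ) ≤ 2 * C2 * Bd / δ w i + 1 := by
        simp only [nc]; push_cast
        exact add_le_add_left (Nat.floor_le (by positivity)) _
      refine e3.trans ?_
      rw [div_add_one hd.ne', div_mul_eq_mul_div]
      refine div_le_div_of_nonneg_right ?_ hd.le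
      linarith [hBδ w i]
    refine (mul_le_mul_of_nonneg_left e1 hQ0).trans_lt ?_
    rw [← mul_assoc]
    exact mul_lt_of_lt_one_left (by positivity) hlt
  obtain ⟨x, x', hne, hΦ⟩ := Fintype.exists_ne_map_eq_of_card_lt Φ hcard
  have hL : ∀ s i, L s (Y x - Y x') i = L s (Y x) i - L s (Y x') i := fun s i => by
    simp only [L, Matrix.mulVec_sub, Pi.sub_apply]
  refine ⟨Y x - Y x', ?_, ?_, ?_⟩
  · intro h
    apply hne
    funext i b
    have h1 := congrFun (sub_eq_zero.1 h) i
    have h2 := congrArg (fun z => ω.repr z b) h1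
    simp only [Y] at h2
    rw [ω.repr_sum_self, ω.repr_sum_self] at h2
    exact Fin.ext (by exact_mod_cast h2)
  · intro w i
    have h1 := congrFun (congrFun (congrArg Prod.fst hΦ) w) i
    change L (.inr w) (Y x - Y x') i ∈ _
    rw [hL]
    exact Ideal.Quotient.eq.1 h1
  · intro w i
    change w (L (.inl w) (Y x - Y x') i : K) ≤ _
    refine le_Ev w _ _ (hδ w i).le fun k => ?_
    rw [hL]
    have h1 : ⌊uu w i k x⌋₊ = ⌊uu w i k x'⌋₊ := congrArg Fin.val (congrFun (congrFun (congrFun (congrArg Prod.snd hΦ) w) i) k)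
    have a1 := Nat.floor_le (huu w i k x).1
    have a2 := Nat.floor_le (huu w i k x').1
    have a3 := Nat.lt_floor_add_one (uu w i k x)
    have a4 := Nat.lt_floor_add_one (uu w i k x')
    rw [h1] at a1 a3
    have a5 : |uu w i k x - uu w i k x'| ≤ 1 := abs_le.2 ⟨by linarith, by linarith⟩
    have a6 : uu w i k x - uu w i k x' = Ev w k ((L (.inl w) (Y x) i - L (.inl w) (Y x') i : 𝓞 K) : K) / δ w i := by
      rw [show ((L (.inl w) (Y x) i - L (.inl w) (Y x') i : 𝓞 K) : K) = (L (.inl w) (Y x) i : K) - (L (.inl w) (Y x') i : K) from rfl, Ev_sub]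
      rw [show uu w i k x = (Ev w k (L (.inl w) (Y x) i : K) + C2 * Bd) / δ w i from rfl, show uu w i k x' = (Ev w k (L (.inl w) (Y x') i : K) + C2 * Bd) / δ w i from rfl]
      ring
    rw [a6, abs_div, abs_of_pos (hδ w i), div_le_one (hδ w i)] at a5
    exact a5

end NF
end Sub
end

noncomputable section
open Finset
namespace Sub

section NF
open NumberField
variable {K : Type} [Field K] [NumberField K]

lemma nf_mink (M : {M : 𝓞 K // M ≠ 0}) {ι : Type} [Fintype ι] [DecidableEq ι] [Nonempty ι] (A : SS M → Matrix ι ι ℤ) : Mink (nf M) A := by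
  classical
  obtain ⟨C0, hC0, hpig⟩ := pig M A
  set n := Module.finrank ℚ K with hn
  have hn0 : 0 < (n : ℝ) := by exact_mod_cast Module.finrank_pos
  set N := Fintype.card ι with hN
  have hN0 : 0 < (N : ℝ) := by exact_mod_cast Fintype.card_pos
  set q : SF M → ℝ := fun w => (Ideal.absNorm w.1.maximalIdeal.asIdeal : ℝ) with hq
  have hq1 : ∀ w, 1 < q w := fun w => by
    simp only [hq]; exact_mod_cast HeightOneSpectrum.one_lt_absNorm w.1.maximalIdeal
  have hql : ∀ w, 0 < Real.log (q w) := fun w => Real.log_pos (hq1 w)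
  refine ⟨n * N * Real.log (2 * C0) + N * ∑ w, Real.log (q w) + 1, fun c => ?_⟩
  set C := n * N * Real.log (2 * C0) + N * ∑ w, Real.log (q w) + 1 with hC
  have hM0 : (M.1 : K) ≠ 0 := RingOfIntegers.coe_ne_zero_iff.2 M.2
  have hMv : ∀ s, 0 < (nf M).v s (M.1 : K) := fun s => ((nf M).v s).pos hM0
  obtain ⟨a, ha⟩ : ∃ a : ℕ, ∀ (w : SF M) i, 0 ≤ c (.inr w) i - a * Real.log ((nf M).v (.inr w) (M.1 : K)) := by
    have : ∀ᶠ a : ℕ in Filter.atTop, ∀ (w : SF M) i, 0 ≤ c (.inr w) i - a * Real.log ((nf M).v (.inr w) (M.1 : K)) := by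
      rw [Filter.eventually_all]; intro w
      rw [Filter.eventually_all]; intro i
      have h1 : Real.log ((nf M).v (.inr w) (M.1 : K)) < 0 := Real.log_neg (hMv _) (M_lt M w)
      have h2 : Filter.Tendsto (fun a : ℕ => (a:ℝ) * -Real.log ((nf M).v (.inr w) (M.1 : K))) Filter.atTop Filter.atTop :=
        tendsto_natCast_atTop_atTop.atTop_mul_const (by linarith)
      filter_upwards [h2.eventually_ge_atTop (-c (.inr w) i)] with a ha
      linarith
    exact this.exists
  set c' : SS M → ι → ℝ := fun s i => c s i - a * Real.log ((nf M).v s (M.1 : K)) with hc'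
  have hvol : vol (nf M) c' = vol (nf M) c := by
    have h1 : vol (nf M) c' = vol (nf M) c - N * a * ∑ s, (nf M).n s * Real.log ((nf M).v s (M.1 : K)) := by
      unfold vol
      rw [mul_sum, ← sum_sub_distrib]
      refine sum_congr rfl fun s _ => ?_
      simp only [hc', sum_sub_distrib, sum_const, card_univ, nsmul_eq_mul]
      ring
    rw [h1, (M_inv M).sum, mul_zero, sub_zero]
  have hvol2 : vol (nf M) c' = ∑ w : InfinitePlace K, ∑ i, (w.mult : ℝ) * c' (.inl w) i + ∑ w : SF M, ∑ i, c' (.inr w) i := by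
    unfold vol
    rw [Fintype.sum_sum_type]
    simp [nf, mul_sum]
  have hmult : ∑ w : InfinitePlace K, (w.mult : ℝ) = n := by
    rw [hn, ← InfinitePlace.sum_mult_eq]; push_cast; rfl
  set β := (vol (nf M) c' + C) / (n * N) with hβ
  have hβ' : n * N * β = vol (nf M) c' + C := by rw [hβ]; field_simp
  set e : SF M → ι → ℕ := fun w i => ⌈c' (.inr w) i / Real.log (q w)⌉₊ with he
  have he1 : ∀ w i, c' (.inr w) i ≤ e w i * Real.log (q w) := fun w i => by
    rw [← div_le_iff₀ (hql w)]; exact Nat.le_ceil _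
  have he2 : ∀ w i, e w i * Real.log (q w) ≤ c' (.inr w) i + Real.log (q w) := fun w i => by
    have h1 := Nat.ceil_lt_add_one (show 0 ≤ c' (.inr w) i / Real.log (q w) from div_nonneg (ha w i) (hql w).le)
    have h2 := mul_le_mul_of_nonneg_right h1.le (hql w).le
    rwa [add_mul, div_mul_cancel₀ _ (hql w).ne', one_mul] at h2
  obtain ⟨y', hy0, hyf, hyi⟩ := hpig e (fun w i => Real.exp (β - c' (.inl w) i) / 2) (fun w i => by positivity) (by
    have e1 : ∏ w : SF M, ∏ i, (Ideal.absNorm w.1.maximalIdeal.asIdeal : ℝ) ^ e w i ≤ Real.exp (∑ w : SF M, ∑ i, (c' (.inr w) i + Real.log (q w))) := by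
      rw [Real.exp_sum]
      refine prod_le_prod (fun w _ => prod_nonneg fun i _ => by positivity) fun w _ => ?_
      rw [Real.exp_sum]
      refine prod_le_prod (fun i _ => by positivity) fun i _ => ?_
      refine le_trans (le_of_eq ?_) (Real.exp_le_exp.2 (he2 w i))
      have hqw : 0 < q w := one_pos.trans (hq1 w)
      rw [← Real.log_pow, Real.exp_log (pow_pos hqw _)]
    have e2 : ∏ w : InfinitePlace K, ∏ i, (C0 / (Real.exp (β - c' (.inl w) i) / 2)) ^ w.mult =
        Real.exp (∑ w : InfinitePlace K, ∑ i, (w.mult : ℝ) * (Real.log (2 * C0) - β + c' (.inl w) i)) := by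
      rw [Real.exp_sum]
      refine prod_congr rfl fun w _ => ?_
      rw [Real.exp_sum]
      refine prod_congr rfl fun i _ => ?_
      rw [Real.exp_nat_mul]
      congr 1
      rw [show Real.log (2 * C0) - β + c' (.inl w) i = Real.log (2 * C0) - (β - c' (.inl w) i) by ring, Real.exp_sub (Real.log (2 * C0)), Real.exp_log (by linarith)]
      field_simp
    rw [e2]
    refine (mul_le_mul_of_nonneg_right e1 (Real.exp_pos _).le).trans_lt ?_
    rw [← Real.exp_add, Real.exp_lt_one_iff]
    simp only [mul_add, sum_add_distrib, sum_const, card_univ, nsmul_eq_mul, ← mul_sum]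
    simp only [← mul_sum] at hvol2
    rw [← sum_mul, hmult]
    linarith)
  have hmv : ∀ s i, ((A s).map (Int.castRingHom K)).mulVec (fun i => ((M.1 : K) ^ a)⁻¹ * (y' i : K)) i =
      ((M.1 : K) ^ a)⁻¹ * ((((A s).map (Int.castRingHom (𝓞 K))).mulVec y' i : 𝓞 K) : K) := by
    intro s i
    simp only [Matrix.mulVec, dotProduct, map_sum, mul_sum, Matrix.map_apply, map_mul]
    refine sum_congr rfl fun j _ => ?_
    simp
    ring
  have hsc : ∀ s i z t, (nf M).v s z ≤ Real.exp (t - c' s i) → (nf M).v s (((M.1 : K) ^ a)⁻¹ * z) ≤ Real.exp (t - c s i) := by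
    intro s i z t h
    rw [map_mul, map_inv₀, map_pow, inv_mul_le_iff₀ (pow_pos (hMv s) _)]
    refine h.trans (le_of_eq ?_)
    rw [← Real.exp_log (pow_pos (hMv s) a), ← Real.exp_add, Real.log_pow]
    congr 1
    simp only [hc']; ring
  refine ⟨fun i => ((M.1 : K) ^ a)⁻¹ * (y' i : K), Sum.elim (fun _ => β) (fun _ => 0), ?_, ?_, ?_, ?_⟩
  · intro i
    refine (nf M).O.mul_mem ?_ (nf_int M _)
    rw [← inv_pow]
    exact (nf M).O.pow_mem (M_inv M).2.2 a
  · intro h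
    apply hy0
    funext i
    have h1 := congrFun h i
    simpa [hM0] using h1
  · rintro (w | w) i
    · rw [hmv]
      refine hsc _ i _ _ ((hyi w i).trans (le_of_eq ?_))
      simp only [Sum.elim_inl]
      ring
    · rw [hmv]
      refine hsc _ i _ _ ((fp_pow w.1 _ _ (hyf w i)).trans ?_)
      have hqw : 0 < q w := one_pos.trans (hq1 w)
      have : ((q w)⁻¹) ^ e w i = Real.exp (-(e w i * Real.log (q w))) := by
        rw [Real.exp_neg, ← Real.log_pow, Real.exp_log (pow_pos hqw _), inv_pow]
      change ((q w)⁻¹) ^ e w i ≤ _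
      rw [this, Real.exp_le_exp]
      have := he1 w i
      simp only [Sum.elim_inr]
      linarith
  · have : nb (nf M) (Sum.elim (fun _ => β) (fun _ => 0)) = n * β := by
      unfold nb
      rw [Fintype.sum_sum_type]
      simp [nf, ← sum_mul, hmult]
    rw [this, ← hvol]
    linarith

lemma UU.mul {S : Type} [Fintype S] {R : Ar K S} {x y : K} (hx : UU R x) (hy : UU R y) : UU R (x * y) :=
  ⟨mul_ne_zero hx.1 hy.1, R.O.mul_mem hx.2.1 hy.2.1, by rw [mul_inv]; exact R.O.mul_mem hx.2.2 hy.2.2⟩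

theorem weakK (G : Finset Kˣ) (J : Type) [Fintype J] [Nonempty J] : ∃ F : Set K, F.Finite ∧
    ∀ x : J → Kˣ, (∀ i, x i ∈ Subgroup.closure (G : Set Kˣ)) → ∑ i, (x i : K) = 0 → ∃ i j, i ≠ j ∧ (x i : K) / x j ∈ F := by
  classical
  obtain ⟨M, hM⟩ := IsLocalization.exist_integer_multiples_of_finset (nonZeroDivisors (𝓞 K)) (S := K)
    (G.image (fun g : Kˣ => (g : K)) ∪ G.image (fun g : Kˣ => (g : K)⁻¹))
  let M' : {M : 𝓞 K // M ≠ 0} := ⟨M.1, nonZeroDivisors.ne_zero M.2⟩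
  have hG : ∀ g ∈ G, UU (nf M') (g : K) := by
    intro g hg
    obtain ⟨y, hy⟩ := hM (g : K) (mem_union_left _ (mem_image_of_mem _ hg))
    obtain ⟨z, hz⟩ := hM ((g : K)⁻¹) (mem_union_right _ (mem_image.2 ⟨g, hg, rfl⟩))
    rw [Algebra.smul_def] at hy hz
    exact nf_UU M' _ g.ne_zero y z hy hz
  have hcl : ∀ g ∈ Subgroup.closure (G : Set Kˣ), UU (nf M') (g : K) := by
    intro g hg
    induction hg using Subgroup.closure_induction with
    | mem x hx => exact hG x hx
    | one => exact ⟨by simp, by simpa using (nf M').O.one_mem, by simpa using (nf M').O.one_mem⟩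
    | mul x y _ _ hx hy => rw [Units.val_mul]; exact hx.mul hy
    | inv x _ hx =>
      rw [Units.val_inv_eq_inv_val]
      exact ⟨inv_ne_zero hx.1, hx.2.2, by rw [inv_inv]; exact hx.2.1⟩
  obtain ⟨F, hF, h⟩ := weak (J := J) (R := nf M') (fun ι _ _ _ A B _ => nf_mink M' A) (Sum.inl (Classical.arbitrary (InfinitePlace K)))
    (nf_nor M') univ univ_nonempty
  refine ⟨F, hF, fun x hx hs => ?_⟩
  obtain ⟨i, _, j, _, hij, hm⟩ := h (fun i => (x i : K)) (fun i _ => hcl _ (hx i)) hs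
  exact ⟨i, j, hij, hm⟩

end NF
end Sub
end

noncomputable section
open Finset
namespace Sub

section NF
variable {L : Type} [Field L] [CharZero L] [Algebra.IsAlgebraic ℚ L]

theorem weakL (G : Finset Lˣ) (J : Type) [Fintype J] [Nonempty J] : ∃ F : Set L, F.Finite ∧
    ∀ x : J → Lˣ, (∀ i, x i ∈ Subgroup.closure (G : Set Lˣ)) → ∑ i, (x i : L) = 0 → ∃ i j, i ≠ j ∧ (x i : L) / x j ∈ F := by
  classical
  set K := IntermediateField.adjoin ℚ ((G.image (fun g : Lˣ => (g : L)) : Finset L) : Set L) with hK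
  haveI : FiniteDimensional ℚ K := IntermediateField.finiteDimensional_adjoin (fun x _ => Algebra.IsIntegral.isIntegral x)
  haveI : NumberField K := ⟨⟩
  have hmem : ∀ g ∈ G, (g : L) ∈ K := fun g hg => IntermediateField.subset_adjoin _ _ (mem_coe.2 (mem_image_of_mem _ hg))
  have hinj : Function.Injective (algebraMap K L) := (algebraMap K L).injective
  set φ : Kˣ →* Lˣ := Units.map (algebraMap K L : K →* L) with hφ
  have hφi : Function.Injective φ := Units.map_injective hinj
  have hlift : ∀ g ∈ G, ∃ u : Kˣ, φ u = g := by
    intro g hg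
    refine ⟨Units.mk0 ⟨(g : L), hmem g hg⟩ (fun h => g.ne_zero (congrArg Subtype.val h)), ?_⟩
    ext; rfl
  set G' : Finset Kˣ := G.preimage φ hφi.injOn with hG'
  have hcl : Subgroup.closure (G : Set Lˣ) ≤ (Subgroup.closure (G' : Set Kˣ)).map φ := by
    rw [Subgroup.closure_le]
    intro g hg
    obtain ⟨u, rfl⟩ := hlift g hg
    exact ⟨u, Subgroup.subset_closure (by simpa [hG'] using hg), rfl⟩
  obtain ⟨F, hF, h⟩ := weakK G' J
  refine ⟨algebraMap K L '' F, hF.image _, fun x hx hs => ?_⟩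
  choose y hy hyx using fun i => hcl (hx i)
  have hv : ∀ i, (x i : L) = algebraMap K L (y i : K) := fun i => by rw [← hyx]; rfl
  obtain ⟨i, j, hij, hm⟩ := h y hy (by
    apply hinj
    rw [map_sum, map_zero, ← hs]
    exact sum_congr rfl fun i _ => (hv i).symm)
  exact ⟨i, j, hij, _, hm, by rw [map_div₀, hv, hv]⟩

variable {J : Type} [Fintype J] [DecidableEq J]

theorem lemZ (κ : J → ℕ) (n : ℕ) : ∀ (G : Finset Lˣ) (T : Finset J), #T ≤ n → ∃ F : Set L, F.Finite ∧
    ∀ x : J → Lˣ, (∀ i ∈ T, x i ∈ Subgroup.closure (G : Set Lˣ)) → ∑ i ∈ T, (x i : L) = 0 →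
      (∀ k, ∑ i ∈ T with κ i = k, (x i : L) = 0) ∨ ∃ e ∈ T, ∃ e' ∈ T, κ e ≠ κ e' ∧ (x e : L) / x e' ∈ F := by
  classical
  induction n with
  | zero =>
    intro G T hT
    have : T = ∅ := card_eq_zero.1 (by omega)
    subst this
    exact ⟨∅, Set.finite_empty, fun x _ _ => Or.inl fun k => by simp⟩
  | succ n ih =>
    intro G T hT
    rcases T.eq_empty_or_nonempty with rfl | ⟨t0, ht0⟩
    · exact ⟨∅, Set.finite_empty, fun x _ _ => Or.inl fun k => by simp⟩
    haveI : Nonempty {i // i ∈ T} := ⟨⟨t0, ht0⟩⟩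
    obtain ⟨F0, hF0, h0⟩ := weakL G {i // i ∈ T}
    have key : ∀ (i j : J) (r : L), ∃ F' : Set L, F'.Finite ∧ (i ∈ T → j ∈ T → i ≠ j → κ i = κ j → 
        ∀ x : J → Lˣ, (∀ i ∈ T, x i ∈ Subgroup.closure (G : Set Lˣ)) → ∑ i ∈ T, (x i : L) = 0 → (x i : L) = r * x j → 
        (∀ k, ∑ i ∈ T with κ i = k, (x i : L) = 0) ∨ ∃ e ∈ T, ∃ e' ∈ T, κ e ≠ κ e' ∧ (x e : L) / x e' ∈ F') := by
      intro i j r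
      by_cases hc : i ∈ T ∧ j ∈ T ∧ i ≠ j ∧ κ i = κ j
      swap
      · exact ⟨∅, Set.finite_empty, fun h1 h2 h3 h4 => absurd ⟨h1, h2, h3, h4⟩ hc⟩
      obtain ⟨hi, hj, hij, hκ⟩ := hc
      have hji : j ∈ T.erase i := mem_erase.2 ⟨hij.symm, hj⟩
      have hcT : #(T.erase i) ≤ n := by rw [card_erase_of_mem hi]; omega
      have split : ∀ g : J → L, ∑ t ∈ T, g t = g i + (g j + ∑ t ∈ (T.erase i).erase j, g t) := fun g => by
        rw [add_sum_erase _ _ hji, add_sum_erase _ _ hi]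
      by_cases hr : 1 + r = 0
      · obtain ⟨F', hF', h'⟩ := ih G ((T.erase i).erase j) ((card_erase_le).trans hcT)
        have hsub : ∀ t ∈ (T.erase i).erase j, t ∈ T := fun t ht => mem_of_mem_erase (mem_of_mem_erase ht)
        refine ⟨F', hF', fun _ _ _ _ x hx hs hxr => ?_⟩
        have hz : (x i : L) + x j = 0 := by rw [hxr]; linear_combination (x j : L) * hr
        rcases h' x (fun t ht => hx t (hsub t ht)) (by have := split (fun t => (x t : L)); rw [hs] at this; linear_combination -this - hz) with h1 | ⟨e, he, e', he', h2⟩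
        · left
          intro k
          have h3 := h1 k
          rw [sum_filter] at h3 ⊢
          rw [split, h3]
          by_cases hk : κ i = k
          · rw [if_pos hk, if_pos (hκ ▸ hk)]; linear_combination hz
          · rw [if_neg hk, if_neg (hκ ▸ hk)]; ring
        · exact Or.inr ⟨e, hsub e he, e', hsub e' he', h2⟩
      · set ρ : Lˣ := Units.mk0 (1 + r) hr with hρ
        obtain ⟨F', hF', h'⟩ := ih (insert ρ G) (T.erase i) hcT
        refine ⟨F' ∪ ((fun z => (1 + r) * z) '' F' ∪ (fun z => (1 + r)⁻¹ * z) '' F'), hF'.union ((hF'.image _).union (hF'.image _)), fun _ _ _ _ x hx hs hxr => ?_⟩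
        have hGG : Subgroup.closure (G : Set Lˣ) ≤ Subgroup.closure ((insert ρ G : Finset Lˣ) : Set Lˣ) :=
          Subgroup.closure_mono (by simp)
        set x' : J → Lˣ := Function.update x j (ρ * x j) with hx'
        have hxj : x' j = ρ * x j := Function.update_self _ _ _
        have hxt : ∀ t, t ≠ j → x' t = x t := fun t ht => Function.update_of_ne ht _ _
        have split' : ∀ g : J → L, ∑ t ∈ T.erase i, g t = g j + ∑ t ∈ (T.erase i).erase j, g t := fun g => by
          rw [add_sum_erase _ _ hji]
        have hxjv : (x' j : L) = x i + x j := by rw [hxj, hxr]; simp [hρ]; ring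
        have hgen : ∀ (p : J → Prop) [DecidablePred p], (p i ↔ p j) → ∑ t ∈ T.erase i, (if p t then (x' t : L) else 0) = ∑ t ∈ T, (if p t then (x t : L) else 0) := by
          intro p _ hp
          rw [split, split', hxjv]
          have : ∑ t ∈ (T.erase i).erase j, (if p t then (x' t : L) else 0) = ∑ t ∈ (T.erase i).erase j, (if p t then (x t : L) else 0) :=
            sum_congr rfl fun t ht => by rw [hxt t (ne_of_mem_erase ht)]
          rw [this]
          by_cases hpi : p i
          · rw [if_pos hpi, if_pos (hp.1 hpi), if_pos (hp.1 hpi)]; ring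
          · rw [if_neg hpi, if_neg (fun h => hpi (hp.2 h)), if_neg (fun h => hpi (hp.2 h))]; ring
        have hmemx : ∀ t ∈ T.erase i, x' t ∈ Subgroup.closure ((insert ρ G : Finset Lˣ) : Set Lˣ) := by
          intro t ht
          by_cases htj : t = j
          · rw [htj, hxj]
            exact Subgroup.mul_mem _ (Subgroup.subset_closure (by simp)) (hGG (hx j hj))
          · rw [hxt t htj]; exact hGG (hx t (mem_of_mem_erase ht))
        rcases h' x' hmemx (by have := hgen (fun _ => True) Iff.rfl; simp only [if_true] at this; rw [this, hs]) with h1 | ⟨e, he, e', he', hk, h2⟩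
        · left
          intro k
          have h3 := h1 k
          rw [sum_filter, hgen (fun t => κ t = k) (by rw [hκ])] at h3
          rwa [sum_filter]
        · right
          refine ⟨e, mem_of_mem_erase he, e', mem_of_mem_erase he', hk, ?_⟩
          by_cases h3 : e = j
          · have h4 : e' ≠ j := fun h => hk (by rw [h3, h])
            right; right
            refine ⟨_, h2, ?_⟩
            subst h3
            rw [hxj, hxt e' h4]
            simp only [hρ, Units.val_mul, Units.val_mk0]
            rw [mul_div_assoc, inv_mul_cancel_left₀ hr]
          · by_cases h4 : e' = j
            · right; left
              refine ⟨_, h2, ?_⟩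
              subst h4
              rw [hxj, hxt e h3]
              simp only [hρ, Units.val_mul, Units.val_mk0]
              have := (x e').ne_zero
              field_simp
            · left; rwa [hxt e h3, hxt e' h4] at h2
    choose F' hF' hk using key
    refine ⟨F0 ∪ ⋃ i, ⋃ j, ⋃ r ∈ F0, F' i j r, hF0.union (Set.finite_iUnion fun i => Set.finite_iUnion fun j => hF0.biUnion fun r _ => hF' i j r), ?_⟩
    intro x hx hs
    obtain ⟨i, j, hij, hm⟩ := h0 (fun i => x i.1) (fun i => hx _ i.2) (by rw [← hs]; exact sum_coe_sort T (fun i => (x i : L)))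
    by_cases hκ : κ i.1 = κ j.1
    · rcases hk i.1 j.1 _ i.2 j.2 (fun h => hij (Subtype.ext h)) hκ x hx hs (div_mul_cancel₀ _ (x j.1).ne_zero).symm with h1 | ⟨e, he, e', he', h1, h2⟩
      · exact Or.inl h1
      · refine Or.inr ⟨e, he, e', he', h1, Or.inr ?_⟩
        simp only [Set.mem_iUnion]
        exact ⟨i.1, j.1, _, hm, h2⟩
    · exact Or.inr ⟨i.1, i.2, j.1, j.2, hκ, Or.inl hm⟩

end NF
end Sub
end

noncomputable section
open Finset
namespace Sub

theorem final {Q : Type} [Field Q] [CharZero Q] [Algebra.IsAlgebraic ℚ Q] (d : ℕ) 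
    (f : Polynomial (MvPolynomial (Fin d) Q))
    (μ : Qˣ) (μs : Fin d → Qˣ)
    (hμ : ∀ k : ℤ, k ≠ 0 → μ ^ k ≠ 1)
    (hind : Subgroup.zpowers μ ⊓ Subgroup.closure (Set.range μs) = ⊥) :
    Set.Finite {m : ℤ | ∃ a : Fin d → ℤ,
      Polynomial.eval ((μ ^ m : Qˣ) : Q)
        (f.map (MvPolynomial.eval
          (fun i => ((μs i ^ a i : Qˣ) : Q)))) = 0 ∧
      0 < (f.map (MvPolynomial.eval
          (fun i => ((μs i ^ a i : Qˣ) : Q)))).natDegree} := by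
  classical
  set E : Finset (Σ _ : ℕ, (Fin d →₀ ℕ)) := f.support.sigma (fun k => (f.coeff k).support) with hE
  have hc0 : ∀ e : {e // e ∈ E}, (f.coeff e.1.1).coeff e.1.2 ≠ 0 := fun e =>
    MvPolynomial.mem_support_iff.1 (mem_sigma.1 e.2).2
  set c : {e // e ∈ E} → Qˣ := fun e => Units.mk0 _ (hc0 e) with hc
  set V : {e // e ∈ E} → (Fin d → ℤ) → Qˣ := fun e a => ∏ i, (μs i ^ a i) ^ (e.1.2 i) with hV
  have hVm : ∀ e a, V e a ∈ Subgroup.closure (Set.range μs) := fun e a =>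
    Subgroup.prod_mem _ fun i _ => Subgroup.pow_mem _ (Subgroup.zpow_mem _ (Subgroup.subset_closure (Set.mem_range_self i)) _) _
  set X : ℤ → (Fin d → ℤ) → {e // e ∈ E} → Qˣ := fun m a e => c e * ((μ ^ m) ^ (e.1.1) * V e a) with hX
  set G : Finset Qˣ := univ.image c ∪ insert μ (univ.image μs) with hG
  have hXm : ∀ m a e, X m a e ∈ Subgroup.closure (G : Set Qˣ) := by
    intro m a e
    refine Subgroup.mul_mem _ (Subgroup.subset_closure (by simp [hG])) (Subgroup.mul_mem _ (Subgroup.pow_mem _ (Subgroup.zpow_mem _ (Subgroup.subset_closure (by simp [hG])) _) _) ?_)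
    refine Subgroup.closure_mono ?_ (hVm e a)
    rintro _ ⟨i, rfl⟩
    simp [hG]
  obtain ⟨F, hF, h⟩ := lemZ (L := Q) (fun e : {e // e ∈ E} => e.1.1) _ G univ le_rfl
  have hcoef : ∀ (a : Fin d → ℤ) (k : ℕ), (f.coeff k).eval (fun i => ((μs i ^ a i : Qˣ) : Q)) = ∑ m ∈ (f.coeff k).support, (f.coeff k).coeff m * ∏ i, ((μs i ^ a i : Qˣ) : Q) ^ m i := fun a k => MvPolynomial.eval_eq' _ _
  have hXv : ∀ (m : ℤ) (a : Fin d → ℤ) e, (X m a e : Q) = (f.coeff e.1.1).coeff e.1.2 * ((((μ ^ m : Qˣ) : Q)) ^ e.1.1 * ∏ i, ((μs i ^ a i : Qˣ) : Q) ^ e.1.2 i) := by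
    intro m a e
    simp [hX, hc, hV]
  have hsumk : ∀ (m : ℤ) (a : Fin d → ℤ) (k : ℕ), ∑ e : {e // e ∈ E} with e.1.1 = k, (X m a e : Q) = (f.map (MvPolynomial.eval (fun i => ((μs i ^ a i : Qˣ) : Q)))).coeff k * ((μ ^ m : Qˣ) : Q) ^ k := by
    intro m a k
    rw [Polynomial.coeff_map, hcoef, sum_filter]
    simp only [hXv]
    rw [sum_coe_sort E (fun e => if e.1 = k then (f.coeff e.1).coeff e.2 * ((((μ ^ m : Qˣ) : Q)) ^ e.1 * ∏ i, ((μs i ^ a i : Qˣ) : Q) ^ e.2 i) else 0)]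
    rw [hE, sum_sigma]
    by_cases hk : k ∈ f.support
    · rw [sum_eq_single_of_mem k hk (fun b _ hb => sum_eq_zero fun t _ => if_neg hb), sum_mul]
      refine sum_congr rfl fun t _ => ?_
      rw [if_pos rfl]; ring
    · rw [Polynomial.notMem_support_iff.1 hk]
      simp only [MvPolynomial.support_zero, sum_empty, zero_mul]
      refine sum_eq_zero fun b hb => sum_eq_zero fun t _ => if_neg (fun (hh : b = k) => hk (hh ▸ hb))
  have hsum : ∀ (m : ℤ) (a : Fin d → ℤ), ∑ e, (X m a e : Q) = (f.map (MvPolynomial.eval (fun i => ((μs i ^ a i : Qˣ) : Q)))).eval ((μ ^ m : Qˣ) : Q) := by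
    intro m a
    rw [Polynomial.eval_eq_sum_range' (n := f.natDegree + 1) (Nat.lt_succ_of_le Polynomial.natDegree_map_le)]
    simp only [← hsumk]
    rw [sum_fiberwise_of_maps_to]
    intro e _
    exact mem_range.2 (Nat.lt_succ_of_le (Polynomial.le_natDegree_of_mem_supp _ (mem_sigma.1 e.2).1))
  have hcover : {m : ℤ | ∃ a : Fin d → ℤ, Polynomial.eval ((μ ^ m : Qˣ) : Q) (f.map (MvPolynomial.eval (fun i => ((μs i ^ a i : Qˣ) : Q)))) = 0 ∧
      0 < (f.map (MvPolynomial.eval (fun i => ((μs i ^ a i : Qˣ) : Q)))).natDegree} ⊆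
      ⋃ e : {e // e ∈ E}, ⋃ e' : {e // e ∈ E}, ⋃ z ∈ F, {m : ℤ | e.1.1 ≠ e'.1.1 ∧ ∃ a, (X m a e : Q) / X m a e' = z} := by
    rintro m ⟨a, h1, h2⟩
    rcases h (X m a) (fun e _ => hXm m a e) (by rw [hsum, h1]) with h3 | ⟨e, _, e', _, h3, h4⟩
    · exfalso
      have : f.map (MvPolynomial.eval (fun i => ((μs i ^ a i : Qˣ) : Q))) = 0 := by
        ext k
        have h4 := h3 k
        beta_reduce at h4
        rw [hsumk] at h4
        rcases mul_eq_zero.1 h4 with h5 | h5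
        · rw [h5, Polynomial.coeff_zero]
        · exact absurd h5 (pow_ne_zero _ (Units.ne_zero _))
      rw [this] at h2
      simp at h2
    · simp only [Set.mem_iUnion]
      exact ⟨e, e', _, h4, h3, a, rfl⟩
  refine Set.Finite.subset (Set.finite_iUnion fun e => Set.finite_iUnion fun e' => hF.biUnion fun z _ => Set.Subsingleton.finite ?_) hcover
  rintro m ⟨hne, a, ha⟩ m' ⟨_, a', ha'⟩
  have h1 : X m a e / X m a e' = X m' a' e / X m' a' e' := by
    ext
    rw [Units.val_div_eq_div_val, Units.val_div_eq_div_val, ha, ha']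
  have h2 : μ ^ ((m - m') * ((e.1.1 : ℤ) - e'.1.1)) = V e' a * (V e a)⁻¹ * (V e a' * (V e' a')⁻¹) := by
    have e1 : μ ^ ((m - m') * ((e.1.1 : ℤ) - e'.1.1)) = (μ ^ m) ^ e.1.1 * ((μ ^ m) ^ e'.1.1)⁻¹ * (((μ ^ m') ^ e.1.1)⁻¹ * (μ ^ m') ^ e'.1.1) := by
      simp only [← zpow_natCast, ← zpow_mul, ← zpow_neg, ← zpow_add]
      congr 1; ring
    rw [e1]
    simp only [hX] at h1
    rw [div_eq_div_iff_mul_eq_mul] at h1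
    generalize (μ ^ m) ^ e.1.1 = p1 at *
    generalize (μ ^ m) ^ e'.1.1 = p2 at *
    generalize (μ ^ m') ^ e.1.1 = p3 at *
    generalize (μ ^ m') ^ e'.1.1 = p4 at *
    have h1' : p1 * V e a * (p4 * V e' a') = p3 * V e a' * (p2 * V e' a) := by
      have : (c e * c e') * (p1 * V e a * (p4 * V e' a')) = (c e * c e') * (p3 * V e a' * (p2 * V e' a)) := by
        refine Units.ext ?_
        have h5 := congrArg Units.val h1
        push_cast at h5 ⊢
        linear_combination h5
      exact mul_left_cancel this
    have h3 : p1 * p4 * (V e a * V e' a') = p3 * p2 * (V e a' * V e' a) := by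
      rw [mul_mul_mul_comm, h1', mul_mul_mul_comm]
    calc p1 * p2⁻¹ * (p3⁻¹ * p4) = (p1 * p4 * (V e a * V e' a')) * ((V e a)⁻¹ * (V e' a')⁻¹) * (p2⁻¹ * p3⁻¹) := by
          refine Units.ext ?_
          push_cast
          field_simp
      _ = _ := by
          rw [h3]
          refine Units.ext ?_
          push_cast
          field_simp
  have h3 : μ ^ ((m - m') * ((e.1.1 : ℤ) - e'.1.1)) = 1 := by
    have : μ ^ ((m - m') * ((e.1.1 : ℤ) - e'.1.1)) ∈ Subgroup.zpowers μ ⊓ Subgroup.closure (Set.range μs) := by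
      refine ⟨⟨_, rfl⟩, ?_⟩
      rw [h2]
      exact Subgroup.mul_mem _ (Subgroup.mul_mem _ (hVm _ _) (Subgroup.inv_mem _ (hVm _ _))) (Subgroup.mul_mem _ (hVm _ _) (Subgroup.inv_mem _ (hVm _ _)))
    rw [hind] at this
    exact Subgroup.mem_bot.1 this
  by_contra hmm
  refine hμ _ (mul_ne_zero (sub_ne_zero.2 hmm) (sub_ne_zero.2 ?_)) h3
  exact_mod_cast hne

end Sub
end

/-- An application of Laurent's theorem: given `f ∈ ℚ̄[x₁,…,x_d][x]` and
`μ, μ₁, …, μ_d ∈ ℚ̄ˣ` with `μ` not a root of unity and `⟨μ⟩ ∩ ⟨μ₁,…,μ_d⟩ = {1}`,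
the set of integers `m` for which there are integers `a₁,…,a_d` with
`f(μ^m, μ₁^{a₁},…,μ_d^{a_d}) = 0` and `f(x, μ₁^{a₁},…,μ_d^{a_d})` non-constant is finite. -/
theorem stmt_8 (d : ℕ) (hd : 1 ≤ d)
    (f : Polynomial (MvPolynomial (Fin d) (AlgebraicClosure ℚ)))
    (μ : (AlgebraicClosure ℚ)ˣ) (μs : Fin d → (AlgebraicClosure ℚ)ˣ)
    (hμ : ∀ k : ℤ, k ≠ 0 → μ ^ k ≠ 1)
    (hind : Subgroup.zpowers μ ⊓ Subgroup.closure (Set.range μs) = ⊥) :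
    Set.Finite {m : ℤ | ∃ a : Fin d → ℤ,
      Polynomial.eval ((μ ^ m : (AlgebraicClosure ℚ)ˣ) : AlgebraicClosure ℚ)
        (f.map (MvPolynomial.eval
          (fun i => ((μs i ^ a i : (AlgebraicClosure ℚ)ˣ) : AlgebraicClosure ℚ)))) = 0 ∧
      0 < (f.map (MvPolynomial.eval
          (fun i => ((μs i ^ a i : (AlgebraicClosure ℚ)ˣ) : AlgebraicClosure ℚ)))).natDegree} := by
  haveI : Algebra.IsAlgebraic ℚ (AlgebraicClosure ℚ) := AlgebraicClosure.isAlgebraic ℚ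
  haveI h0 : @Algebra.IsAlgebraic ℚ (AlgebraicClosure ℚ) _ _ DivisionRing.toRatAlgebra := by
    convert this
  exact Sub.final d f μ μs hμ hind
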